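/- Let m and n be positive integers, at least one of which is odd. Suppose cr(K_{a,b}) = Z(a,b) holds for all positive integers a, b (Zarankiewicz's conjecture), and suppose cr(K_{2,m,n}) = Z(m+2,n+2) − mn (Harborth's conjecture for K_{2,m,n}). Then cr(K_{1,1,m,n}) = Z(m+2,n+2) − mn + ⌊m/2⌋⌊n/2⌋. -/

import Mathlib

open SimpleGraph

variable {V : Type*}

/-- A drawing of a simple graph in the plane: an injective placement of the
vertices in `ℝ²` together with, for each edge, a continuous arc joining the
positions of its endpoints (parametrised compatibly in both directions),
such that no arc passes through the position of a vertex other than its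
endpoints. -/
structure Drawing (G : SimpleGraph V) where
  pos : V → ℝ × ℝ
  pos_inj : Function.Injective pos
  arc : V → V → ℝ → ℝ × ℝ
  arc_cont : ∀ ⦃a b⦄, G.Adj a b → ContinuousOn (arc a b) (Set.Icc 0 1)
  arc_zero : ∀ ⦃a b⦄, G.Adj a b → arc a b 0 = pos a
  arc_one : ∀ ⦃a b⦄, G.Adj a b → arc a b 1 = pos b
  arc_symm : ∀ ⦃a b⦄, G.Adj a b → ∀ t, arc b a t = arc a b (1 - t)
  arc_avoid : ∀ ⦃a b⦄, G.Adj a b → ∀ c, c ≠ a → c ≠ b →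
      pos c ∉ arc a b '' Set.Icc 0 1

namespace Drawing

variable {G : SimpleGraph V} (D : Drawing G)

/-- The set of points of the plane used by the edge `e`. -/
def edgePoints (e : Sym2 V) : Set (ℝ × ℝ) :=
  {p | ∃ a b, e = s(a, b) ∧ G.Adj a b ∧ p ∈ D.arc a b '' Set.Icc 0 1}

/-- The positions of the endpoints of an edge. -/
def ends (e : Sym2 V) : Set (ℝ × ℝ) := {p | ∃ a ∈ e, p = D.pos a}

/-- `p` is a crossing of the (distinct) edges `e` and `f` in the drawing `D`:
a common point of the two edges other than an endpoint. -/
def IsCrossing (e f : Sym2 V) (p : ℝ × ℝ) : Prop :=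
  e ∈ G.edgeSet ∧ f ∈ G.edgeSet ∧ e ≠ f ∧
    p ∈ D.edgePoints e ∧ p ∈ D.edgePoints f ∧ p ∉ D.ends e ∧ p ∉ D.ends f

/-- The crossings between an edge of `A` and an edge of `B`: a crossing is
recorded as a point of the plane together with the unordered pair of edges
crossing there. -/
def crossings (A B : Set (Sym2 V)) : Set ((ℝ × ℝ) × Sym2 (Sym2 V)) :=
  {q | ∃ e f, q.2 = s(e, f) ∧ e ∈ A ∧ f ∈ B ∧ D.IsCrossing e f q.1}

/-- `cr_D(A, B)`: the number of crossings between an edge of `A` and an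
edge of `B`. -/
noncomputable def crBetween (A B : Set (Sym2 V)) : ℕ := Nat.card (D.crossings A B)

/-- `cr(D)`: the total number of crossings of the drawing `D`. -/
noncomputable def crNum : ℕ := D.crBetween G.edgeSet G.edgeSet

/-- A good drawing: no edge crosses itself (each arc is a simple arc),
no two adjacent edges cross, no two edges cross more than once, and no three
edges cross at a common point. -/
structure IsGood : Prop where
  arc_inj : ∀ ⦃a b⦄, G.Adj a b → Set.InjOn (D.arc a b) (Set.Icc 0 1)
  adj_no_cross : ∀ e f : Sym2 V, (∃ a, a ∈ e ∧ a ∈ f) → ∀ p, ¬ D.IsCrossing e f p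
  cross_once : ∀ e f : Sym2 V, {p | D.IsCrossing e f p}.Subsingleton
  no_triple : ∀ p, ∀ e f g : Sym2 V, e ≠ f → e ≠ g → f ≠ g →
      ¬ (D.IsCrossing e f p ∧ D.IsCrossing f g p ∧ D.IsCrossing e g p)

end Drawing

/-- The crossing number of a graph: the minimum number of crossings among
all good drawings of `G` in the plane. -/
noncomputable def crossingNumber (G : SimpleGraph V) : ℕ :=
  sInf {n | ∃ D : Drawing G, D.IsGood ∧ D.crNum = n}

/-- The Zarankiewicz function `Z(m,n) = ⌊m/2⌋⌊(m-1)/2⌋⌊n/2⌋⌊(n-1)/2⌋`. -/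
def Z (m n : ℕ) : ℕ := m / 2 * ((m - 1) / 2) * (n / 2) * ((n - 1) / 2)

/-- The complete bipartite graph `K_{a,b}`. -/
abbrev bipK (a b : ℕ) : SimpleGraph (Fin a ⊕ Fin b) :=
  completeBipartiteGraph (Fin a) (Fin b)

/-- The complete tripartite graph `K_{a,b,c}`. -/
abbrev triK (a b c : ℕ) : SimpleGraph (Σ i : Fin 3, ![Fin a, Fin b, Fin c] i) :=
  completeMultipartiteGraph ![Fin a, Fin b, Fin c]

/-- The complete 4-partite graph `K_{a,b,c,d}`. -/
abbrev quadK (a b c d : ℕ) : SimpleGraph (Σ i : Fin 4, ![Fin a, Fin b, Fin c, Fin d] i) :=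
  completeMultipartiteGraph ![Fin a, Fin b, Fin c, Fin d]

/-- `E(V₁, V₂)`: the set of pairs `{v₁, v₂}` with `v₁ ∈ V₁` and `v₂ ∈ V₂`. -/
def pairEdges {α : Type*} (V₁ V₂ : Set α) : Set (Sym2 α) :=
  {e | ∃ a ∈ V₁, ∃ b ∈ V₂, e = s(a, b)}



/-! ### Arcs in the complex plane -/

/-- `S` is a simple arc from `p` to `q`. -/
def IsArc (S : Set ℂ) (p q : ℂ) : Prop :=
  ∃ γ : ℝ → ℂ, ContinuousOn γ (Set.Icc 0 1) ∧ Set.InjOn γ (Set.Icc 0 1) ∧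
    γ 0 = p ∧ γ 1 = q ∧ γ '' Set.Icc 0 1 = S

theorem IsArc.of_path {γ : ℝ → ℂ} {a b : ℝ} (hab : a < b)
    (hc : ContinuousOn γ (Set.Icc a b)) (hi : Set.InjOn γ (Set.Icc a b)) :
    IsArc (γ '' Set.Icc a b) (γ a) (γ b) := by
  have him : (fun t : ℝ => a + t * (b - a)) '' Set.Icc 0 1 = Set.Icc a b := by
    ext x
    constructor
    · rintro ⟨t, ⟨h0, h1⟩, rfl⟩
      constructor <;> simp only <;> nlinarith
    · rintro ⟨h0, h1⟩
      refine ⟨(x - a) / (b - a), ⟨div_nonneg (by linarith) (by linarith), ?_⟩, ?_⟩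
      · rw [div_le_one (by linarith)]; linarith
      · have : b - a ≠ 0 := by linarith
        simp only; field_simp; ring
  have hm : Set.MapsTo (fun t : ℝ => a + t * (b - a)) (Set.Icc 0 1) (Set.Icc a b) := by
    rw [← him]; exact Set.mapsTo_image _ _
  refine ⟨fun t => γ (a + t * (b - a)), ?_, ?_, by simp, by simp, ?_⟩
  · exact hc.comp (by fun_prop) hm
  · intro s hs t ht hst
    have := hi (hm hs) (hm ht) hst
    have h2 : (s - t) * (b - a) = 0 := by linarith
    rcases mul_eq_zero.1 h2 with h | h <;> linarith
  · rw [← him, Set.image_image]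

theorem IsArc.symm {S : Set ℂ} {p q : ℂ} (h : IsArc S p q) : IsArc S q p := by
  obtain ⟨γ, hc, hi, h0, h1, hS⟩ := h
  have hm : Set.MapsTo (fun t : ℝ => 1 - t) (Set.Icc 0 1) (Set.Icc 0 1) := by
    rintro t ⟨h0, h1⟩; constructor <;> simp only <;> linarith
  refine ⟨fun t => γ (1 - t), hc.comp (by fun_prop) hm, ?_, by simpa, by simpa, ?_⟩
  · intro s hs t ht hst
    have := hi (hm hs) (hm ht) hst
    simp only at this; linarith
  · rw [← hS]
    ext z
    constructor
    · rintro ⟨t, ht, rfl⟩; exact ⟨1 - t, hm ht, rfl⟩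
    · rintro ⟨t, ht, rfl⟩; exact ⟨1 - t, hm ht, by simp⟩

theorem IsArc.left_mem {S : Set ℂ} {p q : ℂ} (h : IsArc S p q) : p ∈ S := by
  obtain ⟨γ, hc, hi, h0, h1, hS⟩ := h
  rw [← hS, ← h0]; exact ⟨0, by simp, rfl⟩

theorem IsArc.right_mem {S : Set ℂ} {p q : ℂ} (h : IsArc S p q) : q ∈ S := h.symm.left_mem

theorem IsArc.ne {S : Set ℂ} {p q : ℂ} (h : IsArc S p q) : p ≠ q := by
  obtain ⟨γ, hc, hi, h0, h1, hS⟩ := h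
  rw [← h0, ← h1]
  intro h
  have := hi (by simp) (by simp) h
  norm_num at this

theorem IsArc.isCompact {S : Set ℂ} {p q : ℂ} (h : IsArc S p q) : IsCompact S := by
  obtain ⟨γ, hc, hi, h0, h1, hS⟩ := h
  rw [← hS]; exact isCompact_Icc.image_of_continuousOn hc

theorem IsArc.isClosed {S : Set ℂ} {p q : ℂ} (h : IsArc S p q) : IsClosed S :=
  h.isCompact.isClosed

theorem IsArc.isPreconnected {S : Set ℂ} {p q : ℂ} (h : IsArc S p q) : IsPreconnected S := by
  obtain ⟨γ, hc, hi, h0, h1, hS⟩ := h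
  rw [← hS]; exact isPreconnected_Icc.image _ hc

theorem IsArc.map {S : Set ℂ} {p q : ℂ} (h : IsArc S p q) {f : ℂ → ℂ} (hf : Continuous f)
    (hfi : Function.Injective f) : IsArc (f '' S) (f p) (f q) := by
  obtain ⟨γ, hc, hi, h0, h1, hS⟩ := h
  refine ⟨f ∘ γ, hf.comp_continuousOn hc, hfi.comp_injOn hi, by simp [h0], by simp [h1], ?_⟩
  rw [Set.image_comp, hS]

theorem IsArc.trans {S T : Set ℂ} {p q r : ℂ} (h : IsArc S p q) (h' : IsArc T q r)
    (hST : S ∩ T ⊆ {q}) : IsArc (S ∪ T) p r := by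
  obtain ⟨γ, hc, hi, h0, h1, hS⟩ := h
  obtain ⟨γ', hc', hi', h0', h1', hS'⟩ := h'
  set δ : ℝ → ℂ := fun t => if t ≤ 1 then γ t else γ' (t - 1) with hδ
  have e1 : ∀ t ∈ Set.Icc (0:ℝ) 1, δ t = γ t := fun t ht => by simp [hδ, ht.2]
  have e2 : ∀ t ∈ Set.Icc (1:ℝ) 2, δ t = γ' (t - 1) := fun t ht => by
    rcases eq_or_lt_of_le ht.1 with h | h
    · simp [hδ, ← h, h1, h0']
    · simp [hδ, not_le.2 h]
  have hm : Set.MapsTo (fun t : ℝ => t - 1) (Set.Icc 1 2) (Set.Icc 0 1) := by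
    rintro t ⟨h0, h1⟩; constructor <;> simp only <;> linarith
  have hu : Set.Icc (0:ℝ) 1 ∪ Set.Icc 1 2 = Set.Icc 0 2 :=
    Set.Icc_union_Icc_eq_Icc (by norm_num) (by norm_num)
  have c1 : ContinuousOn δ (Set.Icc 0 1) := hc.congr e1
  have c2 : ContinuousOn δ (Set.Icc 1 2) := (hc'.comp (by fun_prop) hm).congr e2
  have c : ContinuousOn δ (Set.Icc 0 2) := by
    rw [← hu]; exact c1.union_of_isClosed c2 isClosed_Icc isClosed_Icc
  have i1 : δ '' Set.Icc 0 1 = S := by rw [← hS]; exact Set.image_congr e1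
  have i2 : δ '' Set.Icc 1 2 = T := by
    rw [← hS', Set.image_congr e2]
    ext z
    constructor
    · rintro ⟨t, ht, rfl⟩; exact ⟨_, hm ht, rfl⟩
    · rintro ⟨t, ht, rfl⟩
      exact ⟨t + 1, ⟨by linarith [ht.1], by linarith [ht.2]⟩, by simp⟩
  have key : ∀ s ∈ Set.Icc (0:ℝ) 1, ∀ t ∈ Set.Icc (1:ℝ) 2, δ s = δ t → s = t := by
    intro s hs t ht hst
    have m1 : δ s ∈ S := i1 ▸ ⟨s, hs, rfl⟩
    have m2 : δ s ∈ T := i2 ▸ ⟨t, ht, hst.symm⟩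
    have hq : δ s = q := hST ⟨m1, m2⟩
    have a1 : s = 1 := hi hs (by simp) (by rw [← e1 s hs, hq, h1])
    have a2 : t - 1 = 0 := hi' (hm ht) (by simp) (by rw [← e2 t ht, ← hst, hq, h0'])
    linarith
  have i : Set.InjOn δ (Set.Icc 0 2) := by
    rw [← hu]
    rintro s (hs | hs) t (ht | ht) hst
    · exact hi hs ht (by rw [← e1 s hs, ← e1 t ht, hst])
    · exact key s hs t ht hst
    · exact (key t ht s hs hst.symm).symm
    · have := hi' (hm hs) (hm ht) (by rw [← e2 s hs, ← e2 t ht, hst])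
      simp only at this; linarith
  have := IsArc.of_path (by norm_num : (0:ℝ) < 2) c i
  rw [← hu, Set.image_union, i1, i2] at this
  convert this using 1
  · rw [e1 0 (by simp), h0]
  · rw [e2 2 (by norm_num)]; norm_num [h1']

theorem IsArc.segment {p q : ℂ} (h : p ≠ q) : IsArc (segment ℝ p q) p q := by
  refine ⟨fun t => AffineMap.lineMap p q t, ?_, ?_, by simp, by simp, ?_⟩
  · exact (AffineMap.lineMap_continuous).continuousOn
  · exact (AffineMap.lineMap_injective ℝ h).injOn
  · rw [segment_eq_image_lineMap]

/-- A sub-arc between two parameters. -/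
theorem arc_sub {γ : ℝ → ℂ} (hc : ContinuousOn γ (Set.Icc 0 1)) (hi : Set.InjOn γ (Set.Icc 0 1))
    {s t : ℝ} (hs : 0 ≤ s) (hst : s < t) (ht : t ≤ 1) :
    IsArc (γ '' Set.Icc s t) (γ s) (γ t) :=
  IsArc.of_path hst (hc.mono (Set.Icc_subset_Icc hs ht)) (hi.mono (Set.Icc_subset_Icc hs ht))

/-- first and last parameter in a closed set -/
theorem first_last {γ : ℝ → ℂ} (hc : ContinuousOn γ (Set.Icc 0 1)) {K : Set ℂ} (hK : IsClosed K)
    (hne : (γ '' Set.Icc 0 1 ∩ K).Nonempty) :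
    ∃ s ∈ Set.Icc (0:ℝ) 1, ∃ t ∈ Set.Icc (0:ℝ) 1, γ s ∈ K ∧ γ t ∈ K ∧
      ∀ r ∈ Set.Icc (0:ℝ) 1, γ r ∈ K → s ≤ r ∧ r ≤ t := by
  set W := Set.Icc (0:ℝ) 1 ∩ γ ⁻¹' K
  have hW : IsCompact W :=
    isCompact_Icc.of_isClosed_subset (hc.preimage_isClosed_of_isClosed isClosed_Icc hK)
      Set.inter_subset_left
  have hWn : W.Nonempty := by
    obtain ⟨z, ⟨t, ht, rfl⟩, hz⟩ := hne
    exact ⟨t, ht, hz⟩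
  obtain ⟨s, hs, hs'⟩ := hW.exists_isLeast hWn
  obtain ⟨t, ht, ht'⟩ := hW.exists_isGreatest hWn
  exact ⟨s, hs.1, t, ht.1, hs.2, ht.2, fun r hr hrK => ⟨hs' ⟨hr, hrK⟩, ht' ⟨hr, hrK⟩⟩⟩

theorem IsArc.first_hit {S K : Set ℂ} {p q : ℂ} (h : IsArc S p q) (hK : IsClosed K) (hp : p ∉ K)
    (hne : (S ∩ K).Nonempty) :
    ∃ u S', S' ⊆ S ∧ IsArc S' p u ∧ S' ∩ K = {u} ∧ (u ≠ q → q ∉ S') := by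
  obtain ⟨γ, hc, hi, h0, h1, hS⟩ := h
  rw [← hS] at hne
  obtain ⟨s, hs, t, ht, hsK, htK, hall⟩ := first_last hc hK hne
  have hs0 : 0 < s := by
    rcases eq_or_lt_of_le hs.1 with h | h
    · rw [← h, h0] at hsK; exact absurd hsK hp
    · exact h
  refine ⟨γ s, γ '' Set.Icc 0 s, ?_, ?_, ?_, ?_⟩
  · rw [← hS]; exact Set.image_mono (Set.Icc_subset_Icc le_rfl hs.2)
  · have := arc_sub hc hi le_rfl hs0 hs.2
    rwa [h0] at this
  · ext z
    constructor
    · rintro ⟨⟨r, hr, rfl⟩, hz⟩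
      have := (hall r ⟨hr.1, hr.2.trans hs.2⟩ hz).1
      rw [le_antisymm hr.2 this]; rfl
    · rintro rfl; exact ⟨⟨s, ⟨hs.1, le_rfl⟩, rfl⟩, hsK⟩
  · rintro hne ⟨r, hr, hrq⟩
    have : r = 1 := hi ⟨hr.1, hr.2.trans hs.2⟩ (by simp) (hrq.trans h1.symm)
    have : s = 1 := le_antisymm hs.2 (this ▸ hr.2)
    exact hne (by rw [this, h1])

theorem IsArc.not_mem_interior {S K : Set ℂ} {p u : ℂ} (h : IsArc S p u) (hSK : S ∩ K = {u}) :
    u ∉ interior K := by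
  intro hu
  obtain ⟨γ, hc, hi, h0, h1, hS⟩ := h
  have h2 := (hc 1 (by simp)) (by rw [h1]; exact isOpen_interior.mem_nhds hu :
    interior K ∈ nhds (γ 1))
  have h3 : ∀ᶠ t in nhdsWithin (1:ℝ) (Set.Ico 0 1), γ t ∈ interior K :=
    (nhdsWithin_mono _ Set.Ico_subset_Icc_self) h2
  have h4 : (nhdsWithin (1:ℝ) (Set.Ico 0 1)).NeBot := by
    rw [← mem_closure_iff_nhdsWithin_neBot, closure_Ico (by norm_num)]; simp
  obtain ⟨t, ht, ht'⟩ := (h3.and self_mem_nhdsWithin).exists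
  have : γ t ∈ S ∩ K := ⟨hS ▸ ⟨t, Set.Ico_subset_Icc_self ht', rfl⟩, interior_subset ht⟩
  rw [hSK] at this
  have := hi (Set.Ico_subset_Icc_self ht') (by simp) (this.trans h1.symm)
  exact absurd this ht'.2.ne

theorem IsArc.mem_sphere {S : Set ℂ} {p u c : ℂ} {r : ℝ} (h : IsArc S p u) (hr : r ≠ 0)
    (hSK : S ∩ Metric.closedBall c r = {u}) : Dist.dist u c = r := by
  have h1 : u ∈ Metric.closedBall c r := by
    have : u ∈ S ∩ Metric.closedBall c r := by rw [hSK]; rfl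
    exact this.2
  have h2 := h.not_mem_interior hSK
  rw [interior_closedBall _ hr] at h2
  exact le_antisymm h1 (not_lt.1 h2)

theorem IsArc.through {S K : Set ℂ} {p q z : ℂ} (h : IsArc S p q) (hK : IsClosed K) (hp : p ∉ K)
    (hq : q ∉ K) (hz : z ∈ S) (hzK : z ∈ interior K) :
    ∃ u v S₁ S₂, S₁ ⊆ S ∧ S₂ ⊆ S ∧ IsArc S₁ p u ∧ IsArc S₂ v q ∧ S₁ ∩ K = {u} ∧ S₂ ∩ K = {v} ∧
      Disjoint S₁ S₂ := by
  obtain ⟨γ, hc, hi, h0, h1, hS⟩ := h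
  have hne : (γ '' Set.Icc 0 1 ∩ K).Nonempty := ⟨z, hS ▸ hz, interior_subset hzK⟩
  obtain ⟨s, hs, t, ht, hsK, htK, hall⟩ := first_last hc hK hne
  have hs0 : 0 < s := by
    rcases eq_or_lt_of_le hs.1 with h | h
    · rw [← h, h0] at hsK; exact absurd hsK hp
    · exact h
  have ht1 : t < 1 := by
    rcases eq_or_lt_of_le ht.2 with h | h
    · rw [h, h1] at htK; exact absurd htK hq
    · exact h
  have A1 := arc_sub hc hi le_rfl hs0 hs.2
  have A2 := arc_sub hc hi ht.1 ht1 le_rfl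
  rw [h0] at A1; rw [h1] at A2
  have I1 : γ '' Set.Icc 0 s ∩ K = {γ s} := by
    ext w
    constructor
    · rintro ⟨⟨r, hr, rfl⟩, hz⟩
      have := (hall r ⟨hr.1, hr.2.trans hs.2⟩ hz).1
      rw [le_antisymm hr.2 this]; rfl
    · rintro rfl; exact ⟨⟨s, ⟨hs.1, le_rfl⟩, rfl⟩, hsK⟩
  have I2 : γ '' Set.Icc t 1 ∩ K = {γ t} := by
    ext w
    constructor
    · rintro ⟨⟨r, hr, rfl⟩, hz⟩
      have := (hall r ⟨ht.1.trans hr.1, hr.2⟩ hz).2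
      rw [le_antisymm hr.1 this]; rfl
    · rintro rfl; exact ⟨⟨t, ⟨le_rfl, ht.2⟩, rfl⟩, htK⟩
  refine ⟨γ s, γ t, _, _, ?_, ?_, A1, A2, I1, I2, ?_⟩
  · rw [← hS]; exact Set.image_mono (Set.Icc_subset_Icc le_rfl hs.2)
  · rw [← hS]; exact Set.image_mono (Set.Icc_subset_Icc ht.1 le_rfl)
  · have hst : s < t := by
      rcases eq_or_lt_of_le (hall s hs hsK).2 with h | h
      · exfalso
        rw [← hS] at hz
        obtain ⟨r, hr, rfl⟩ := hz
        have h5 := hall r hr (interior_subset hzK)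
        have : r = s := by linarith [h5.1, h5.2]
        rw [this] at hzK
        exact A1.not_mem_interior I1 hzK
      · exact h
    rw [Set.disjoint_left]
    rintro w ⟨r, hr, rfl⟩ ⟨r', hr', he⟩
    have := hi ⟨ht.1.trans hr'.1, hr'.2⟩ ⟨hr.1, hr.2.trans hs.2⟩ he
    have := hr.2; have := hr'.1; linarith

/-- The part of an arc between two disjoint closed sets. -/
theorem IsArc.between {S K L : Set ℂ} {p q : ℂ} (h : IsArc S p q) (hK : IsClosed K)
    (hL : IsClosed L) (hKL : Disjoint K L) (hp : p ∈ K) (hq : q ∈ L) :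
    ∃ u v S', S' ⊆ S ∧ IsArc S' u v ∧ S' ∩ K = {u} ∧ S' ∩ L = {v} := by
  obtain ⟨v, S₁, h1, h2, h3, -⟩ := h.first_hit hL (Set.disjoint_left.1 hKL hp) ⟨q, h.right_mem, hq⟩
  have hv : v ∈ S₁ ∩ L := by rw [h3]; rfl
  obtain ⟨u, S₂, h4, h5, h6, -⟩ := h2.symm.first_hit hK (Set.disjoint_right.1 hKL hv.2)
    ⟨p, h2.left_mem, hp⟩
  refine ⟨u, v, S₂, h4.trans h1, h5.symm, h6, ?_⟩
  refine Set.Subset.antisymm ?_ ?_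
  · rw [← h3]; exact Set.inter_subset_inter_left _ h4
  · rintro _ rfl; exact ⟨h5.left_mem, hv.2⟩



/-! ### Threading two disjoint arcs through a connected open set -/

theorem IsArc.hit_extend {F : Set ℂ} {p q : ℂ} {K : Set ℂ} (h : IsArc F p q) (hK : IsClosed K)
    (hq : q ∈ K) : ∃ s F₀, F₀ ⊆ F ∧ F₀ ∩ K = {s} ∧
      ∀ T r, IsArc T s r → T ⊆ K → IsArc (F₀ ∪ T) p r := by
  by_cases hp : p ∈ K
  · refine ⟨p, {p}, by simpa using h.left_mem, by simpa using hp, fun T r hT _ => ?_⟩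
    have : {p} ∪ T = T := by simpa using hT.left_mem
    rwa [this]
  · obtain ⟨u, S', h1, h2, h3, -⟩ := h.first_hit hK hp ⟨q, h.right_mem, hq⟩
    refine ⟨u, S', h1, h3, fun T r hT hTK => h2.trans hT ?_⟩
    rw [← h3]; exact Set.inter_subset_inter_right _ hTK

theorem segs_disjoint {z s₁ s₂ : ℂ} {ε : ℝ} (hε : 0 < ε)
    (h : ((starRingEnd ℂ) (s₁ - z) * (s₂ - z)).im ≠ 0) :
    Disjoint (segment ℝ s₁ (z + ε * (s₁ - z))) (segment ℝ s₂ (z + ε * (s₂ - z))) := by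
  have key : ∀ s x : ℂ, x ∈ segment ℝ s (z + ε * (s - z)) →
      ∃ a : ℝ, 0 < a ∧ x = z + a * (s - z) := by
    rintro s x ⟨a, b, ha, hb, hab, rfl⟩
    refine ⟨a + b * ε, ?_, ?_⟩
    · rcases eq_or_lt_of_le ha with h | h
      · have : b = 1 := by linarith
        rw [← h, this]; simpa
      · positivity
    · have : (b : ℂ) = 1 - a := by rw [eq_sub_iff_add_eq']; exact_mod_cast hab
      simp only [Complex.real_smul]
      push_cast; rw [this]; ring
  rw [Set.disjoint_left]
  intro x h1 h2
  obtain ⟨a, ha, rfl⟩ := key _ _ h1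
  obtain ⟨b, hb, hab⟩ := key _ _ h2
  apply h
  have e : (s₂ - z) = ((a / b : ℝ) : ℂ) * (s₁ - z) := by
    have : (b : ℂ) ≠ 0 := by exact_mod_cast hb.ne'
    push_cast; field_simp
    linear_combination -hab
  rw [e]
  simp only [Complex.mul_im, Complex.mul_re, Complex.conj_re, Complex.conj_im, Complex.ofReal_re,
    Complex.ofReal_im]
  ring

theorem exists_offline {s₁ s₂ z : ℂ} (h : s₁ ≠ s₂) {r : ℝ} (hr : 0 < r) :
    ∃ w, Dist.dist w z < r ∧ ((starRingEnd ℂ) (s₁ - w) * (s₂ - w)).im ≠ 0 := by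
  set d := s₂ - s₁
  have hd : d ≠ 0 := sub_ne_zero.2 h.symm
  have hn : 0 < ‖d‖ := norm_pos_iff.2 hd
  have hnsq : 0 < d.re ^ 2 + d.im ^ 2 := by
    have := Complex.normSq_pos.2 hd
    rw [Complex.normSq_apply] at this; nlinarith
  have comp : ∀ η : ℝ, ((starRingEnd ℂ) (s₁ - (z + η * Complex.I * d)) *
      (s₂ - (z + η * Complex.I * d))).im =
      ((starRingEnd ℂ) (s₁ - z) * (s₂ - z)).im + η * (d.re ^ 2 + d.im ^ 2) := by
    intro η
    simp [d]
    ring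
  have hdist : ∀ η : ℝ, 0 < η → η ≤ r / (2 * ‖d‖) → Dist.dist (z + η * Complex.I * d) z < r := by
    intro η h0 h1
    rw [dist_eq_norm]
    simp only [add_sub_cancel_left, norm_mul, Complex.norm_I, Complex.norm_real, mul_one,
      Real.norm_eq_abs, abs_of_pos h0]
    calc η * ‖d‖ ≤ r / (2 * ‖d‖) * ‖d‖ := by gcongr
      _ = r / 2 := by field_simp
      _ < r := by linarith
  set η := r / (2 * ‖d‖)
  have hη : 0 < η := by positivity
  by_cases hz : ((starRingEnd ℂ) (s₁ - z) * (s₂ - z)).im + η * (d.re ^ 2 + d.im ^ 2) = 0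
  · refine ⟨z + (η / 2 : ℝ) * Complex.I * d, hdist _ (by positivity) (by linarith), ?_⟩
    rw [comp]
    intro h2
    have : η / 2 * (d.re ^ 2 + d.im ^ 2) = 0 := by linarith
    have : 0 < η / 2 * (d.re ^ 2 + d.im ^ 2) := by positivity
    linarith
  · refine ⟨z + η * Complex.I * d, hdist _ hη le_rfl, ?_⟩
    rwa [comp]

/-- two points near `z` can be joined to `p₁`, `p₂` by disjoint arcs in `U` -/
def TwoJoin (U : Set ℂ) (p₁ p₂ z : ℂ) : Prop :=
  ∀ r > 0, ∃ q₁ q₂ F₁ F₂, Dist.dist q₁ z < r ∧ Dist.dist q₂ z < r ∧ F₁ ⊆ U ∧ F₂ ⊆ U ∧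
    IsArc F₁ p₁ q₁ ∧ IsArc F₂ p₂ q₂ ∧ Disjoint F₁ F₂

theorem TwoJoin.extend {U : Set ℂ} {p₁ p₂ z z' : ℂ} {ρ : ℝ}
    (hU : Metric.closedBall z ρ ⊆ U) (h : TwoJoin U p₁ p₂ z) (hz' : Dist.dist z' z < ρ) :
    TwoJoin U p₁ p₂ z' := by
  intro r hr
  have hρ : 0 < ρ := dist_nonneg.trans_lt hz'
  obtain ⟨q₁, q₂, F₁, F₂, hq₁, hq₂, hF₁, hF₂, A₁, A₂, hd⟩ := h ρ hρ
  have hKc : IsClosed (Metric.closedBall z ρ) := Metric.isClosed_closedBall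
  obtain ⟨s₁, G₁, hG₁, hs₁, ex₁⟩ := A₁.hit_extend hKc (Metric.mem_closedBall.2 hq₁.le)
  obtain ⟨s₂, G₂, hG₂, hs₂, ex₂⟩ := A₂.hit_extend hKc (Metric.mem_closedBall.2 hq₂.le)
  have m₁ : s₁ ∈ G₁ ∩ Metric.closedBall z ρ := by rw [hs₁]; rfl
  have m₂ : s₂ ∈ G₂ ∩ Metric.closedBall z ρ := by rw [hs₂]; rfl
  have hne : s₁ ≠ s₂ := by
    rintro rfl
    exact Set.disjoint_left.1 hd (hG₁ m₁.1) (hG₂ m₂.1)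
  obtain ⟨w, hw, hoff⟩ := exists_offline (z := z') hne
    (lt_min (half_pos hr) (sub_pos.2 hz') : 0 < min (r / 2) (ρ - Dist.dist z' z))
  have hw1 : Dist.dist w z' < r / 2 := hw.trans_le (min_le_left _ _)
  have hwK : w ∈ Metric.closedBall z ρ := by
    have := hw.trans_le (min_le_right _ _)
    have := _root_.dist_triangle w z' z
    rw [Metric.mem_closedBall]; linarith
  have hw1' : w ≠ s₁ := by rintro rfl; simp at hoff
  have hw2' : w ≠ s₂ := by rintro rfl; simp at hoff
  set M := ‖s₁ - w‖ + ‖s₂ - w‖ + r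
  have hM : 0 < M := by positivity
  set ε := r / (2 * M)
  have hε : 0 < ε := by positivity
  have hε1 : ε < 1 := by
    rw [div_lt_one (by positivity)]
    have := norm_nonneg (s₁ - w); have := norm_nonneg (s₂ - w)
    simp only [M]; linarith
  have hεM : ε * M = r / 2 := by simp only [ε]; field_simp
  have near : ∀ s, ‖s - w‖ ≤ M → Dist.dist (w + ε * (s - w)) z' < r := by
    intro s hs
    have h1 : Dist.dist (w + ε * (s - w)) w ≤ r / 2 := by
      rw [dist_eq_norm]
      simp only [add_sub_cancel_left, norm_mul, Complex.norm_real, Real.norm_eq_abs, abs_of_pos hε]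
      rw [← hεM]; gcongr
    have := _root_.dist_triangle (w + ε * (s - w)) w z'
    linarith
  have qK : ∀ s, s ∈ Metric.closedBall z ρ →
      segment ℝ s (w + ε * (s - w)) ⊆ Metric.closedBall z ρ := by
    intro s hs
    refine (convex_closedBall z ρ).segment_subset hs ?_
    refine (convex_closedBall z ρ).segment_subset hwK hs ?_
    refine ⟨1 - ε, ε, by linarith, hε.le, by ring, ?_⟩
    simp only [Complex.real_smul]; push_cast; ring
  have qne : ∀ s, w ≠ s → s ≠ w + ε * (s - w) := by
    intro s hs h
    have : (1 - ε : ℂ) * (s - w) = 0 := by linear_combination h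
    rcases mul_eq_zero.1 this with h | h
    · have : (1 - ε : ℝ) = 0 := by exact_mod_cast h
      linarith
    · exact hs (sub_eq_zero.1 h).symm
  have dT := segs_disjoint hε hoff
  refine ⟨_, _, _, _, near s₁ ?_, near s₂ ?_, ?_, ?_,
    ex₁ _ _ (IsArc.segment (qne s₁ hw1')) (qK s₁ m₁.2),
    ex₂ _ _ (IsArc.segment (qne s₂ hw2')) (qK s₂ m₂.2), ?_⟩
  · have := norm_nonneg (s₂ - w); simp only [M]; linarith
  · have := norm_nonneg (s₁ - w); simp only [M]; linarith
  · exact Set.union_subset (hG₁.trans hF₁) ((qK s₁ m₁.2).trans hU)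
  · exact Set.union_subset (hG₂.trans hF₂) ((qK s₂ m₂.2).trans hU)
  · rw [Set.disjoint_left]
    rintro x (h1 | h1) (h2 | h2)
    · exact Set.disjoint_left.1 hd (hG₁ h1) (hG₂ h2)
    · have : x ∈ G₁ ∩ Metric.closedBall z ρ := ⟨h1, qK s₂ m₂.2 h2⟩
      rw [hs₁] at this
      rw [Set.mem_singleton_iff.1 this] at h2
      exact Set.disjoint_left.1 dT (left_mem_segment _ _ _) h2
    · have : x ∈ G₂ ∩ Metric.closedBall z ρ := ⟨h2, qK s₁ m₁.2 h1⟩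
      rw [hs₂] at this
      rw [Set.mem_singleton_iff.1 this] at h1
      exact Set.disjoint_left.1 dT h1 (left_mem_segment _ _ _)
    · exact Set.disjoint_left.1 dT h1 h2

theorem thread_conn {U : Set ℂ} (hU : IsOpen U) (hUc : IsPreconnected U) {a b : ℂ}
    (ha : a ∈ U) (hb : b ∈ U) {V : Set ℂ} (hV : IsOpen V) (haV : a ∈ V) :
    ∃ p₁ ∈ V, ∃ p₂ ∈ V, TwoJoin U p₁ p₂ b := by
  obtain ⟨ρ, hρ, hB⟩ := Metric.isOpen_iff.1 (hU.inter hV) a ⟨ha, haV⟩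
  set p₁ := a + ((ρ / 2 : ℝ) : ℂ)
  set p₂ := a - ((ρ / 2 : ℝ) : ℂ)
  have real_ball : ∀ t : ℝ, |t| < ρ → a + (t : ℂ) ∈ U ∩ V := by
    intro t ht
    apply hB
    rw [Metric.mem_ball, dist_eq_norm]
    simpa using ht
  have mem_seg : ∀ s t : ℝ, ∀ x ∈ segment ℝ (a + (s : ℂ)) (a + (t : ℂ)),
      ∃ u : ℝ, u ∈ segment ℝ s t ∧ x = a + (u : ℂ) := by
    rintro s t x ⟨α, β, hα, hβ, hαβ, rfl⟩
    refine ⟨α * s + β * t, ⟨α, β, hα, hβ, hαβ, rfl⟩, ?_⟩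
    have : (β : ℂ) = 1 - α := by rw [eq_sub_iff_add_eq']; exact_mod_cast hαβ
    simp only [Complex.real_smul]; push_cast; rw [this]; ring
  have hpU1 : p₁ ∈ U ∩ V := real_ball (ρ / 2) (by rw [abs_of_pos] <;> linarith)
  have hpU2 : p₂ ∈ U ∩ V := by
    have := real_ball (-(ρ / 2)) (by rw [abs_neg, abs_of_pos] <;> linarith)
    simpa [p₂, sub_eq_add_neg] using this
  have base : TwoJoin U p₁ p₂ a := by
    intro r hr
    set ε := min (ρ / 4) (r / 2)
    have hε : 0 < ε := by positivity
    have hε1 : ε ≤ ρ / 4 := min_le_left _ _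
    have hε2 : ε ≤ r / 2 := min_le_right _ _
    have P2 : p₂ = a + ((-(ρ / 2) : ℝ) : ℂ) := by simp [p₂, sub_eq_add_neg]
    have ne : ∀ s t : ℝ, s ≠ t → a + (s : ℂ) ≠ a + (t : ℂ) := by
      intro s t hst h; apply hst; exact_mod_cast add_left_cancel h
    refine ⟨a + (ε : ℂ), a + ((-ε : ℝ) : ℂ), segment ℝ p₁ (a + (ε : ℂ)),
      segment ℝ p₂ (a + ((-ε : ℝ) : ℂ)), ?_, ?_, ?_, ?_, ?_, ?_, ?_⟩
    · rw [dist_eq_norm]; simp [abs_of_pos hε]; linarith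
    · rw [dist_eq_norm]; simp [abs_of_pos hε]; linarith
    · intro x hx
      obtain ⟨u, hu, rfl⟩ := mem_seg _ _ x hx
      rw [segment_symm, segment_eq_Icc (by linarith)] at hu
      exact (real_ball u (by rw [abs_lt]; constructor <;> linarith [hu.1, hu.2])).1
    · intro x hx
      rw [P2] at hx
      obtain ⟨u, hu, rfl⟩ := mem_seg _ _ x hx
      rw [segment_eq_Icc (by linarith)] at hu
      exact (real_ball u (by rw [abs_lt]; constructor <;> linarith [hu.1, hu.2])).1
    · exact IsArc.segment (ne _ _ (by linarith))
    · rw [P2]; exact IsArc.segment (ne _ _ (by linarith))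
    · rw [Set.disjoint_left]
      intro x h1 h2
      rw [P2] at h2
      obtain ⟨u, hu, rfl⟩ := mem_seg _ _ x h1
      obtain ⟨v, hv, hx⟩ := mem_seg _ _ _ h2
      rw [segment_symm, segment_eq_Icc (by linarith)] at hu
      rw [segment_eq_Icc (by linarith)] at hv
      have : u = v := by exact_mod_cast add_left_cancel hx
      linarith [hu.1, hv.2]
  refine ⟨p₁, hpU1.2, p₂, hpU2.2, ?_⟩
  set W := {z | z ∈ U ∧ TwoJoin U p₁ p₂ z}
  have hW : IsOpen W := by
    rw [Metric.isOpen_iff]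
    rintro z ⟨hz, hzj⟩
    obtain ⟨σ, hσ, hσU⟩ := Metric.isOpen_iff.1 hU z hz
    have hsub : Metric.closedBall z (σ / 2) ⊆ U :=
      (Metric.closedBall_subset_ball (by linarith)).trans hσU
    refine ⟨σ / 2, by positivity, fun z' hz' => ⟨hsub (Metric.ball_subset_closedBall hz'), ?_⟩⟩
    exact hzj.extend hsub hz'
  have hcl : closure W ∩ U ⊆ W := by
    rintro z ⟨hz, hzU⟩
    refine ⟨hzU, fun r hr => ?_⟩
    obtain ⟨z', hz', hd⟩ := Metric.mem_closure_iff.1 hz (r / 2) (by positivity)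
    obtain ⟨q₁, q₂, F₁, F₂, h1, h2, h3⟩ := hz'.2 (r / 2) (by positivity)
    rw [_root_.dist_comm] at hd
    refine ⟨q₁, q₂, F₁, F₂, ?_, ?_, h3⟩
    · have := _root_.dist_triangle q₁ z' z; linarith
    · have := _root_.dist_triangle q₂ z' z; linarith
  exact (hUc.subset_of_closure_inter_subset hW ⟨a, ha, ha, base⟩ hcl hb).2

/-- Two disjoint parallel copies of an arc from a disc to a disc, inside an open set. -/
theorem thread {Ω E : Set ℂ} (hΩ : IsOpen Ω) {p q c c' : ℂ} {r r' : ℝ} (hE : IsArc E p q)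
    (hEΩ : E ⊆ Ω) (hp : Dist.dist p c = r) (hq : Dist.dist q c' = r') (hr : 0 < r) (hr' : 0 < r')
    (hd : Disjoint (Metric.closedBall c r) (Metric.closedBall c' r')) :
    ∃ E₁ E₂ p₁ p₂ q₁ q₂, E₁ ⊆ Ω ∧ E₂ ⊆ Ω ∧ IsArc E₁ p₁ q₁ ∧ IsArc E₂ p₂ q₂ ∧
      E₁ ∩ Metric.closedBall c r = {p₁} ∧ E₂ ∩ Metric.closedBall c r = {p₂} ∧
      E₁ ∩ Metric.closedBall c' r' = {q₁} ∧ E₂ ∩ Metric.closedBall c' r' = {q₂} ∧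
      Disjoint E₁ E₂ := by
  set U := connectedComponentIn Ω p
  have hU : IsOpen U := hΩ.connectedComponentIn
  have hUc : IsPreconnected U := isPreconnected_connectedComponentIn
  have hUΩ : U ⊆ Ω := connectedComponentIn_subset _ _
  have hEU : E ⊆ U := hE.isPreconnected.subset_connectedComponentIn hE.left_mem hEΩ
  have near : ∀ (x c : ℂ) (r : ℝ), 0 < r → Dist.dist x c = r → x ∈ U → (U ∩ Metric.ball c r).Nonempty := by
    intro x c r hr hx hxU
    have : x ∈ closure (Metric.ball c r) := by rw [closure_ball _ hr.ne']; exact hx.le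
    exact mem_closure_iff.1 this U hU hxU
  obtain ⟨a, ha, haB⟩ := near p c r hr hp (hEU hE.left_mem)
  obtain ⟨b, hb, hbB⟩ := near q c' r' hr' hq (hEU hE.right_mem)
  obtain ⟨p₁, hp₁, p₂, hp₂, hj⟩ := thread_conn hU hUc ha hb Metric.isOpen_ball haB
  obtain ⟨q₁, q₂, F₁, F₂, h1, h2, hF₁, hF₂, A₁, A₂, hdis⟩ := hj (r' - Dist.dist b c') (sub_pos.2 hbB)
  have m1 : q₁ ∈ Metric.closedBall c' r' := by
    have := _root_.dist_triangle q₁ b c'; rw [Metric.mem_closedBall]; linarith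
  have m2 : q₂ ∈ Metric.closedBall c' r' := by
    have := _root_.dist_triangle q₂ b c'; rw [Metric.mem_closedBall]; linarith
  obtain ⟨u₁, v₁, E₁, s₁, B₁, k₁, l₁⟩ := A₁.between Metric.isClosed_closedBall
    Metric.isClosed_closedBall hd (Metric.ball_subset_closedBall hp₁) m1
  obtain ⟨u₂, v₂, E₂, s₂, B₂, k₂, l₂⟩ := A₂.between Metric.isClosed_closedBall
    Metric.isClosed_closedBall hd (Metric.ball_subset_closedBall hp₂) m2
  exact ⟨E₁, E₂, u₁, u₂, v₁, v₂, s₁.trans (hF₁.trans hUΩ), s₂.trans (hF₂.trans hUΩ), B₁, B₂,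
    k₁, k₂, l₁, l₂, hdis.mono s₁ s₂⟩



/-! ### Chords of circles -/

theorem chord_sq (a b c : ℂ) (t ρ : ℝ) (ha : Dist.dist a c = ρ) (hb : Dist.dist b c = ρ) :
    Dist.dist (a + t * (b - a)) c ^ 2 = ρ ^ 2 - t * (1 - t) * Dist.dist a b ^ 2 := by
  have h : ∀ z : ℂ, ‖z‖ ^ 2 = z.re ^ 2 + z.im ^ 2 := by
    intro z; rw [Complex.sq_norm, Complex.normSq_apply]; ring
  have ha' : Dist.dist a c ^ 2 = ρ ^ 2 := by rw [ha]
  have hb' : Dist.dist b c ^ 2 = ρ ^ 2 := by rw [hb]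
  rw [dist_eq_norm, h] at ha' hb'
  rw [dist_eq_norm, h, dist_eq_norm, h]
  simp only [Complex.sub_re, Complex.sub_im, Complex.add_re, Complex.add_im, Complex.mul_re,
    Complex.mul_im, Complex.ofReal_re, Complex.ofReal_im] at *
  linear_combination (1 - t) * ha' + t * hb'

theorem chord_line {a b c : ℂ} {t ρ : ℝ} (ha : Dist.dist a c = ρ) (hb : Dist.dist b c = ρ)
    (ht : Dist.dist (a + t * (b - a)) c = ρ) : a + t * (b - a) = a ∨ a + t * (b - a) = b := by
  have h := chord_sq a b c t ρ ha hb
  rw [ht] at h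
  have h2 : t * (1 - t) * Dist.dist a b ^ 2 = 0 := by linarith
  rcases mul_eq_zero.1 h2 with h3 | h3
  · rcases mul_eq_zero.1 h3 with h4 | h4
    · left; simp [h4]
    · right
      have : t = 1 := by linarith
      simp [this]
  · have : a = b := by simpa using h3
    left; simp [this]

theorem mem_seg_iff {a b x : ℂ} (h : x ∈ segment ℝ a b) : ∃ t : ℝ, x = a + t * (b - a) := by
  obtain ⟨α, β, hα, hβ, hαβ, rfl⟩ := h
  refine ⟨β, ?_⟩
  have : (α : ℂ) = 1 - β := by rw [eq_sub_iff_add_eq]; exact_mod_cast hαβ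
  simp only [Complex.real_smul, this]; ring

theorem chord_sphere {a b c x : ℂ} {ρ : ℝ} (ha : Dist.dist a c = ρ) (hb : Dist.dist b c = ρ)
    (hx : x ∈ segment ℝ a b) (hxs : Dist.dist x c = ρ) : x = a ∨ x = b := by
  obtain ⟨t, rfl⟩ := mem_seg_iff hx
  exact chord_line ha hb hxs

theorem chord_inter {a b a' b' c : ℂ} {ρ : ℝ} (ha : Dist.dist a c = ρ) (hb : Dist.dist b c = ρ)
    (ha' : Dist.dist a' c = ρ) (h1 : a' ≠ a) (h2 : a' ≠ b) :
    (segment ℝ a b ∩ segment ℝ a' b').Subsingleton := by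
  rintro x ⟨hx, hx'⟩ y ⟨hy, hy'⟩
  by_contra hne
  obtain ⟨t, ht⟩ := mem_seg_iff hx
  obtain ⟨s, hs⟩ := mem_seg_iff hx'
  obtain ⟨t', ht'⟩ := mem_seg_iff hy
  obtain ⟨s', hs'⟩ := mem_seg_iff hy'
  have e : ((s' - s : ℝ) : ℂ) * (b' - a') = ((t' - t : ℝ) : ℂ) * (b - a) := by
    push_cast; linear_combination hs - hs' - ht + ht'
  have hss : s' - s ≠ 0 := by
    intro h
    apply hne
    have : s' = s := by linarith
    rw [hs, hs', this]
  have hss' : ((s' - s : ℝ) : ℂ) ≠ 0 := by exact_mod_cast hss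
  have : a' = a + ((t - s * ((t' - t) / (s' - s)) : ℝ) : ℂ) * (b - a) := by
    have e2 : b' - a' = ((t' - t : ℝ) : ℂ) * (b - a) / ((s' - s : ℝ) : ℂ) := by
      rw [← e]; field_simp
    have e3 : a' = x - s * (b' - a') := by linear_combination -hs
    rw [e3, e2, ht]
    push_cast at *
    field_simp
    ring
  rw [this] at ha' h1 h2
  rcases chord_line ha hb ha' with h | h
  · exact h1 h
  · exact h2 h

theorem chord_inter' {a b b' c : ℂ} {ρ : ℝ} (ha : Dist.dist a c = ρ) (hb : Dist.dist b c = ρ)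
    (hb' : Dist.dist b' c = ρ) (h1 : b' ≠ a) (h2 : b' ≠ b) {x : ℂ} (hx : x ∈ segment ℝ a b)
    (hx' : x ∈ segment ℝ a b') : x = a := by
  have := chord_inter (b' := a) ha hb hb' h1 h2
  rw [segment_symm ℝ b' a] at this
  exact this ⟨hx, hx'⟩ ⟨left_mem_segment _ _ _, left_mem_segment _ _ _⟩

theorem matching {p₁ p₂ q₁ q₂ c : ℂ} {ρ : ℝ} (h1 : Dist.dist p₁ c = ρ) (h2 : Dist.dist p₂ c = ρ)
    (h3 : Dist.dist q₁ c = ρ) (h4 : Dist.dist q₂ c = ρ) (hp : p₁ ≠ p₂) (hq : q₁ ≠ q₂)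
    (h12 : p₁ ≠ q₂) (h22 : p₂ ≠ q₂) :
    Disjoint (segment ℝ p₁ q₁) (segment ℝ p₂ q₂) ∨
      Disjoint (segment ℝ p₁ q₂) (segment ℝ p₂ q₁) := by
  by_contra hcon
  push Not at hcon
  obtain ⟨hx, hy⟩ := hcon
  rw [Set.not_disjoint_iff] at hx hy
  obtain ⟨x, hx1, hx2⟩ := hx
  obtain ⟨y, hy1, hy2⟩ := hy
  have a1 := dist_add_dist_of_mem_segment hx1
  have a2 := dist_add_dist_of_mem_segment hx2
  have a3 := dist_add_dist_of_mem_segment hy1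
  have a4 := dist_add_dist_of_mem_segment hy2
  have t1 := _root_.dist_triangle p₁ x q₂
  have t2 := _root_.dist_triangle p₂ x q₁
  have t3 := _root_.dist_triangle p₁ y q₁
  have t4 := _root_.dist_triangle p₂ y q₂
  have e1 : Dist.dist p₁ x + Dist.dist x q₂ = Dist.dist p₁ q₂ := by linarith
  have e2 : Dist.dist p₂ x + Dist.dist x q₁ = Dist.dist p₂ q₁ := by linarith
  rw [dist_add_dist_eq_iff, ← mem_segment_iff_wbtw] at e1 e2
  have f1 := chord_inter' h1 h3 h4 h12.symm hq.symm hx1 e1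
  have f2 := chord_inter' h2 h3 h4 h22.symm hq.symm e2 hx2
  exact hp (f1.symm.trans f2)

theorem arc_through {γ : ℝ → ℂ} (hc : ContinuousOn γ (Set.Icc 0 1))
    (hi : Set.InjOn γ (Set.Icc 0 1)) {K : Set ℂ} (hK : IsClosed K) {t₀ : ℝ}
    (ht₀ : t₀ ∈ Set.Icc (0:ℝ) 1) (h₀ : γ t₀ ∈ interior K) (hp : γ 0 ∉ K) (hq : γ 1 ∉ K) :
    ∃ s t, 0 < s ∧ s < t₀ ∧ t₀ < t ∧ t < 1 ∧ γ '' Set.Icc 0 s ∩ K = {γ s} ∧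
      γ '' Set.Icc t 1 ∩ K = {γ t} := by
  have hne : (γ '' Set.Icc 0 1 ∩ K).Nonempty := ⟨γ t₀, ⟨t₀, ht₀, rfl⟩, interior_subset h₀⟩
  obtain ⟨s, hs, t, ht, hsK, htK, hall⟩ := first_last hc hK hne
  have hs0 : 0 < s := by
    rcases eq_or_lt_of_le hs.1 with h | h
    · rw [← h] at hsK; exact absurd hsK hp
    · exact h
  have ht1 : t < 1 := by
    rcases eq_or_lt_of_le ht.2 with h | h
    · rw [h] at htK; exact absurd htK hq
    · exact h
  have A1 := arc_sub hc hi le_rfl hs0 hs.2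
  have A2 := arc_sub hc hi ht.1 ht1 le_rfl
  have I1 : γ '' Set.Icc 0 s ∩ K = {γ s} := by
    ext w
    constructor
    · rintro ⟨⟨r, hr, rfl⟩, hz⟩
      have := (hall r ⟨hr.1, hr.2.trans hs.2⟩ hz).1
      rw [le_antisymm hr.2 this]; rfl
    · rintro rfl; exact ⟨⟨s, ⟨hs.1, le_rfl⟩, rfl⟩, hsK⟩
  have I2 : γ '' Set.Icc t 1 ∩ K = {γ t} := by
    ext w
    constructor
    · rintro ⟨⟨r, hr, rfl⟩, hz⟩
      have := (hall r ⟨ht.1.trans hr.1, hr.2⟩ hz).2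
      rw [le_antisymm hr.1 this]; rfl
    · rintro rfl; exact ⟨⟨t, ⟨le_rfl, ht.2⟩, rfl⟩, htK⟩
  have h5 := hall t₀ ht₀ (interior_subset h₀)
  refine ⟨s, t, hs0, lt_of_le_of_ne h5.1 ?_, lt_of_le_of_ne h5.2 ?_, ht1, I1, I2⟩
  · rintro rfl; exact A1.not_mem_interior I1 h₀
  · rintro rfl; exact A2.symm.not_mem_interior I2 h₀



/-! ### Doubling an arc -/

/-- The outcome of doubling an arc from the disc `K` to the disc `L` inside `Ω`, where the arcs `F i`
cross the given arc. -/
structure Doubled {ι : Type*} (I : Finset ι) (F : ι → Set ℂ) (fa fb : ι → ℂ) (Ω K L : Set ℂ)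
    (E : Bool → Set ℂ) (p q : Bool → ℂ) (F' N : ι → Set ℂ) : Prop where
  E_sub : ∀ k, E k ⊆ Ω
  arc : ∀ k, IsArc (E k) (p k) (q k)
  EK : ∀ k, E k ∩ K = {p k}
  EL : ∀ k, E k ∩ L = {q k}
  disj : Disjoint (E false) (E true)
  F_arc : ∀ i ∈ I, IsArc (F' i) (fa i) (fb i)
  F_sub : ∀ i ∈ I, F' i ⊆ F i ∪ N i
  N_sub : ∀ i ∈ I, N i ⊆ Ω
  NK : ∀ i ∈ I, Disjoint (N i) K
  NL : ∀ i ∈ I, Disjoint (N i) L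
  N_a : ∀ i ∈ I, fa i ∉ N i
  N_b : ∀ i ∈ I, fb i ∉ N i
  NN : ∀ i ∈ I, ∀ j ∈ I, i ≠ j → Disjoint (N i) (N j)
  NF : ∀ i ∈ I, ∀ j ∈ I, i ≠ j → Disjoint (N i) (F j)
  once : ∀ k, ∀ i ∈ I, (E k ∩ F' i).Subsingleton
  EF : ∀ k, ∀ i ∈ I, E k ∩ F' i ⊆ N i

theorem thread_bool {Ω E : Set ℂ} (hΩ : IsOpen Ω) {p q c c' : ℂ} {r r' : ℝ} (hE : IsArc E p q)
    (hEΩ : E ⊆ Ω) (hp : Dist.dist p c = r) (hq : Dist.dist q c' = r') (hr : 0 < r) (hr' : 0 < r')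
    (hd : Disjoint (Metric.closedBall c r) (Metric.closedBall c' r')) :
    ∃ (E : Bool → Set ℂ) (p q : Bool → ℂ), (∀ k, E k ⊆ Ω) ∧ (∀ k, IsArc (E k) (p k) (q k)) ∧
      (∀ k, E k ∩ Metric.closedBall c r = {p k}) ∧ (∀ k, E k ∩ Metric.closedBall c' r' = {q k}) ∧
      Disjoint (E false) (E true) := by
  obtain ⟨E₁, E₂, p₁, p₂, q₁, q₂, h1, h2, h3, h4, h5, h6, h7, h8, h9⟩ :=
    thread hΩ hE hEΩ hp hq hr hr' hd
  refine ⟨fun k => bif k then E₂ else E₁, fun k => bif k then p₂ else p₁,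
    fun k => bif k then q₂ else q₁, ?_, ?_, ?_, ?_, h9⟩ <;>
  · rintro (_ | _) <;> assumption

theorem eq_sing_mem {S K : Set ℂ} {u : ℂ} (h : S ∩ K = {u}) : u ∈ S ∧ u ∈ K := by
  have : u ∈ S ∩ K := by rw [h]; rfl
  exact this

theorem sing_eq {S K : Set ℂ} {u x : ℂ} (h : S ∩ K = {u}) (hx : x ∈ S) (hx' : x ∈ K) : x = u := by
  have : x ∈ S ∩ K := ⟨hx, hx'⟩
  rw [h] at this; exact this

theorem disj_bool {X : Bool → Set ℂ} (h : Disjoint (X false) (X true)) {k l : Bool} (hkl : k ≠ l) :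
    Disjoint (X k) (X l) := by
  cases k <;> cases l <;> first | exact absurd rfl hkl | exact h | exact h.symm

theorem doubling {ι : Type*} (F : ι → Set ℂ) (fa fb : ι → ℂ) :
    ∀ (I : Finset ι) (c c' : ℂ) (r r' : ℝ) (Ω E : Set ℂ) (p q : ℂ), 0 < r → 0 < r' →
      Disjoint (Metric.closedBall c r) (Metric.closedBall c' r') → IsOpen Ω → IsArc E p q →
      E ⊆ Ω → E ∩ Metric.closedBall c r = {p} → E ∩ Metric.closedBall c' r' = {q} →
      (∀ i ∈ I, IsArc (F i) (fa i) (fb i)) → (∀ i ∈ I, Disjoint (F i) (Metric.closedBall c r)) →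
      (∀ i ∈ I, Disjoint (F i) (Metric.closedBall c' r')) →
      (∀ i ∈ I, ∃ z, F i ∩ E = {z} ∧ z ≠ fa i ∧ z ≠ fb i ∧ ∀ j ∈ I, j ≠ i → z ∉ F j) →
      ∃ E' p' q' F' N, Doubled I F fa fb Ω (Metric.closedBall c r) (Metric.closedBall c' r')
        E' p' q' F' N := by
  classical
  intro I
  induction I using Finset.strongInduction with
  | H I ih =>
  intro c c' r r' Ω E p q hr hr' hd hΩ hE hEΩ hEK hEL hF hFK hFL hz
  rcases I.eq_empty_or_nonempty with rfl | hI
  · obtain ⟨E', p', q', h1, h2, h3, h4, h5⟩ := thread_bool hΩ hE hEΩ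
      (hE.symm.mem_sphere hr.ne' hEK) (hE.mem_sphere hr'.ne' hEL) hr hr' hd
    exact ⟨E', p', q', fun _ => ∅, fun _ => ∅, h1, h2, h3, h4, h5, by simp, by simp, by simp,
      by simp, by simp, by simp, by simp, by simp, by simp, by simp, by simp⟩
  set K := Metric.closedBall c r with hKdef
  set L := Metric.closedBall c' r' with hLdef
  have hKc : IsClosed K := Metric.isClosed_closedBall
  have hLc : IsClosed L := Metric.isClosed_closedBall
  obtain ⟨γ, hc, hi, h0, h1, hS⟩ := id hE
  -- parameters of the crossings
  have hpar : ∀ i, ∃ t : ℝ, i ∈ I → t ∈ Set.Icc (0:ℝ) 1 ∧ F i ∩ E = {γ t} ∧ γ t ≠ fa i ∧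
      γ t ≠ fb i ∧ ∀ j ∈ I, j ≠ i → γ t ∉ F j := by
    intro i
    by_cases hiI : i ∈ I
    · obtain ⟨z, hz1, hz2, hz3, hz4⟩ := hz i hiI
      have := (eq_sing_mem hz1).2
      rw [← hS] at this
      obtain ⟨t, ht, rfl⟩ := this
      exact ⟨t, fun _ => ⟨ht, hz1, hz2, hz3, hz4⟩⟩
    · exact ⟨0, fun h => absurd h hiI⟩
  choose τ hτ using hpar
  obtain ⟨e, heI, hmax⟩ := I.exists_max_image τ hI
  obtain ⟨he0, he1, he2, he3, he4⟩ := hτ e heI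
  set z := γ (τ e) with hzdef
  have hzF : z ∈ F e := (eq_sing_mem he1).1
  have hzE : z ∈ E := (eq_sing_mem he1).2
  have hlt : ∀ i ∈ I, i ≠ e → τ i < τ e := by
    intro i hiI hie
    refine lt_of_le_of_ne (hmax i hiI) fun h => ?_
    have := (hτ i hiI).2.2.2.2 e heI hie.symm
    rw [h] at this; exact this hzF
  -- the small disc
  set B : Set ℂ := K ∪ L ∪ (⋃ j ∈ I.erase e, F j) ∪ (⋃ j ∈ I.erase e, γ '' Set.Icc 0 (τ j)) ∪
    {fa e, fb e} with hB
  have hBc : IsClosed B := by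
    refine (((hKc.union hLc).union ?_).union ?_).union ?_
    · exact (I.erase e).finite_toSet.isClosed_biUnion
        fun j hj => (hF j (Finset.mem_of_mem_erase hj)).isClosed
    · refine (I.erase e).finite_toSet.isClosed_biUnion fun j hj => ?_
      have hj' := (hτ j (Finset.mem_of_mem_erase hj)).1
      exact (isCompact_Icc.image_of_continuousOn
        (hc.mono (Set.Icc_subset_Icc le_rfl hj'.2))).isClosed
    · exact (Set.toFinite _).isClosed
  have hzB : z ∉ B := by
    rintro ((((h | h) | h) | h) | h)
    · exact Set.disjoint_left.1 (hFK e heI) hzF h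
    · exact Set.disjoint_left.1 (hFL e heI) hzF h
    · simp only [Set.mem_iUnion] at h
      obtain ⟨j, hj, hzj⟩ := h
      exact he4 j (Finset.mem_of_mem_erase hj) (Finset.ne_of_mem_erase hj) hzj
    · simp only [Set.mem_iUnion] at h
      obtain ⟨j, hj, t, ht, hzj⟩ := h
      have hjI := Finset.mem_of_mem_erase hj
      have := hlt j hjI (Finset.ne_of_mem_erase hj)
      have h5 := hi ⟨ht.1, ht.2.trans (hτ j hjI).1.2⟩ he0 hzj
      have := ht.2
      linarith
    · rcases h with h | h
      · exact he2 h
      · exact he3 h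
  obtain ⟨ρ₀, hρ₀, hball⟩ := Metric.isOpen_iff.1 (hΩ.sdiff hBc) z ⟨hEΩ hzE, hzB⟩
  set ρ := ρ₀ / 2
  have hρ : 0 < ρ := half_pos hρ₀
  set Q := Metric.closedBall z ρ with hQdef
  have hQc : IsClosed Q := Metric.isClosed_closedBall
  have hQB : Q ⊆ Ω \ B := (Metric.closedBall_subset_ball (half_lt_self hρ₀)).trans hball
  have hQΩ : Q ⊆ Ω := fun x hx => (hQB hx).1
  have hQK : Disjoint Q K := Set.disjoint_left.2 fun x hx hxK =>
    (hQB hx).2 (Or.inl (Or.inl (Or.inl (Or.inl hxK))))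
  have hQL : Disjoint Q L := Set.disjoint_left.2 fun x hx hxK =>
    (hQB hx).2 (Or.inl (Or.inl (Or.inl (Or.inr hxK))))
  have hQF : ∀ j ∈ I, j ≠ e → Disjoint Q (F j) := fun j hj hje =>
    Set.disjoint_left.2 fun x hx hxK => (hQB hx).2 (Or.inl (Or.inl (Or.inr (by
      simp only [Set.mem_iUnion]; exact ⟨j, Finset.mem_erase.2 ⟨hje, hj⟩, hxK⟩))))
  have hQγ : ∀ j ∈ I, j ≠ e → Disjoint Q (γ '' Set.Icc 0 (τ j)) := fun j hj hje =>
    Set.disjoint_left.2 fun x hx hxK => (hQB hx).2 (Or.inl (Or.inr (by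
      simp only [Set.mem_iUnion]; exact ⟨j, Finset.mem_erase.2 ⟨hje, hj⟩, hxK⟩)))
  have hQa : fa e ∉ Q := fun h => (hQB h).2 (Or.inr (by simp))
  have hQb : fb e ∉ Q := fun h => (hQB h).2 (Or.inr (by simp))
  have hzQ : z ∈ interior Q := by
    rw [hQdef, interior_closedBall _ hρ.ne']; exact Metric.mem_ball_self hρ
  have hpK := eq_sing_mem hEK
  have hqL := eq_sing_mem hEL
  obtain ⟨s, t, hs0, hst, htt, ht1, hSQ, hTQ⟩ := arc_through hc hi hQc he0 hzQ
    (by rw [h0]; exact fun h => Set.disjoint_left.1 hQK h hpK.2)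
    (by rw [h1]; exact fun h => Set.disjoint_left.1 hQL h hqL.2)
  set S₁ := γ '' Set.Icc 0 s with hS₁
  set S₂ := γ '' Set.Icc t 1 with hS₂
  have A1 : IsArc S₁ p (γ s) := by
    have := arc_sub hc hi le_rfl hs0 (by linarith); rwa [h0] at this
  have A2 : IsArc S₂ (γ t) q := by
    have := arc_sub hc hi (by linarith) ht1 le_rfl; rwa [h1] at this
  have S₁E : S₁ ⊆ E := by rw [← hS]; exact Set.image_mono (Set.Icc_subset_Icc le_rfl (by linarith))
  have S₂E : S₂ ⊆ E := by rw [← hS]; exact Set.image_mono (Set.Icc_subset_Icc (by linarith) le_rfl)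
  have hS12 : Disjoint S₁ S₂ := by
    rw [Set.disjoint_left]
    rintro x ⟨a, ha, rfl⟩ ⟨b, hb, hab⟩
    have := hi ⟨by linarith [hb.1], hb.2⟩ ⟨ha.1, by linarith [ha.2]⟩ hab
    linarith [ha.2, hb.1]
  have zS₁ : z ∉ S₁ := fun h => by
    obtain ⟨a, ha, hab⟩ := h
    have := hi ⟨ha.1, by linarith [ha.2]⟩ he0 hab
    linarith [ha.2]
  have τS₂ : ∀ i ∈ I, γ (τ i) ∉ S₂ := fun i hiI h => by
    obtain ⟨a, ha, hab⟩ := h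
    have := hi ⟨by linarith [ha.1], ha.2⟩ (hτ i hiI).1 hab
    linarith [ha.1, hmax i hiI]
  have τs : ∀ i ∈ I, i ≠ e → τ i < s := fun i hiI hie => by
    by_contra hcon
    exact Set.disjoint_left.1 (hQγ i hiI hie) (eq_sing_mem hSQ).2
      ⟨s, ⟨hs0.le, not_lt.1 hcon⟩, rfl⟩
  have pS₂ : p ∉ S₂ := fun h => Set.disjoint_left.1 hS12 A1.left_mem h
  have qS₁ : q ∉ S₁ := fun h => Set.disjoint_left.1 hS12 h A2.right_mem
  obtain ⟨W₁, W₂, hW₁, hW₂, hSW₁, hSW₂, hWd⟩ :=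
    SeparatedNhds.of_isCompact_isCompact A1.isCompact A2.isCompact hS12
  set Ω₁ := (Ω ∩ W₁) \ (F e ∪ L) with hΩ₁
  set Ω₂ := (Ω ∩ W₂) \ (K ∪ ⋃ j ∈ I, F j) with hΩ₂
  have hΩ₁o : IsOpen Ω₁ := (hΩ.inter hW₁).sdiff ((hF e heI).isClosed.union hLc)
  have hΩ₂o : IsOpen Ω₂ := (hΩ.inter hW₂).sdiff
    (hKc.union (I.finite_toSet.isClosed_biUnion fun j hj => (hF j hj).isClosed))
  have hΩ₁Ω : Ω₁ ⊆ Ω := fun x hx => hx.1.1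
  have hΩ₂Ω : Ω₂ ⊆ Ω := fun x hx => hx.1.1
  have hΩ12 : Disjoint Ω₁ Ω₂ := hWd.mono (fun x hx => hx.1.2) (fun x hx => hx.1.2)
  have hΩ₁F : Disjoint Ω₁ (F e) := Set.disjoint_left.2 fun x hx h => hx.2 (Or.inl h)
  have hΩ₁L : Disjoint Ω₁ L := Set.disjoint_left.2 fun x hx h => hx.2 (Or.inr h)
  have hΩ₂K : Disjoint Ω₂ K := Set.disjoint_left.2 fun x hx h => hx.2 (Or.inl h)
  have hΩ₂F : ∀ j ∈ I, Disjoint Ω₂ (F j) := fun j hj => Set.disjoint_left.2 fun x hx h =>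
    hx.2 (Or.inr (by simp only [Set.mem_iUnion]; exact ⟨j, hj, h⟩))
  have S₁Ω₁ : S₁ ⊆ Ω₁ := by
    intro x hx
    refine ⟨⟨hEΩ (S₁E hx), hSW₁ hx⟩, ?_⟩
    rintro (h | h)
    · rw [sing_eq he1 h (S₁E hx)] at hx; exact zS₁ hx
    · rw [sing_eq hEL (S₁E hx) h] at hx; exact qS₁ hx
  have S₂Ω₂ : S₂ ⊆ Ω₂ := by
    intro x hx
    refine ⟨⟨hEΩ (S₂E hx), hSW₂ hx⟩, ?_⟩
    rintro (h | h)
    · rw [sing_eq hEK (S₂E hx) h] at hx; exact pS₂ hx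
    · simp only [Set.mem_iUnion] at h
      obtain ⟨j, hj, hxj⟩ := h
      rw [sing_eq (hτ j hj).2.1 hxj (S₂E hx)] at hx; exact τS₂ j hj hx
  have S₁K : S₁ ∩ K = {p} := by
    refine Set.Subset.antisymm ?_ ?_
    · rw [← hEK]; exact Set.inter_subset_inter_left _ S₁E
    · rintro _ rfl; exact ⟨A1.left_mem, hpK.2⟩
  have S₂L : S₂ ∩ L = {q} := by
    refine Set.Subset.antisymm ?_ ?_
    · rw [← hEL]; exact Set.inter_subset_inter_left _ S₂E
    · rintro _ rfl; exact ⟨A2.right_mem, hqL.2⟩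
  -- induction hypothesis on the first part
  obtain ⟨X, p', x, F', N, hX⟩ := ih (I.erase e) (Finset.erase_ssubset heI) c z r ρ Ω₁ S₁ p (γ s)
    hr hρ hQK.symm hΩ₁o A1 S₁Ω₁ S₁K hSQ (fun i hi => hF i (Finset.mem_of_mem_erase hi))
    (fun i hi => hFK i (Finset.mem_of_mem_erase hi))
    (fun i hi => (hQF i (Finset.mem_of_mem_erase hi) (Finset.ne_of_mem_erase hi)).symm)
    (fun i hi' => by
      have hiI := Finset.mem_of_mem_erase hi'
      have hie := Finset.ne_of_mem_erase hi'
      obtain ⟨b1, b2, b3, b4, b5⟩ := hτ i hiI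
      refine ⟨γ (τ i), ?_, b3, b4, fun j hj hji => b5 j (Finset.mem_of_mem_erase hj) hji⟩
      refine Set.Subset.antisymm ?_ ?_
      · rw [← b2]; exact Set.inter_subset_inter_right _ S₁E
      · rintro _ rfl
        exact ⟨(eq_sing_mem b2).1, ⟨τ i, ⟨b1.1, (τs i hiI hie).le⟩, rfl⟩⟩)
  -- thread on the second part
  obtain ⟨Y₀, y₀, q₀, hY1, hY2, hY3, hY4, hY5⟩ := thread_bool hΩ₂o A2 S₂Ω₂
    (A2.symm.mem_sphere hρ.ne' hTQ) (A2.mem_sphere hr'.ne' S₂L) hρ hr' hQL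
  -- passing F e through Q
  obtain ⟨u, v, G₁, G₂, g1, g2, g3, g4, g5, g6, g7⟩ := (hF e heI).through hQc hQa hQb hzF hzQ
  have hu : Dist.dist u z = ρ := g3.mem_sphere hρ.ne' g5
  have hv : Dist.dist v z = ρ := g4.symm.mem_sphere hρ.ne' g6
  have hxs : ∀ k, Dist.dist (x k) z = ρ := fun k => (hX.arc k).mem_sphere hρ.ne' (hX.EL k)
  have hy₀s : ∀ k, Dist.dist (y₀ k) z = ρ := fun k => (hY2 k).symm.mem_sphere hρ.ne' (hY3 k)
  have hxΩ : ∀ k, x k ∈ Ω₁ := fun k => hX.E_sub k (hX.arc k).right_mem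
  have hy₀Ω : ∀ k, y₀ k ∈ Ω₂ := fun k => hY1 k (hY2 k).left_mem
  have hxy₀ : ∀ k l, x k ≠ y₀ l := fun k l h =>
    Set.disjoint_left.1 hΩ12 (hxΩ k) (h ▸ hy₀Ω l)
  have hxx : x false ≠ x true := fun h =>
    Set.disjoint_left.1 hX.disj (hX.arc false).right_mem (h ▸ (hX.arc true).right_mem)
  have hyy : y₀ false ≠ y₀ true := fun h =>
    Set.disjoint_left.1 hY5 (hY2 false).left_mem (h ▸ (hY2 true).left_mem)
  -- choose the matching
  have hmatch : ∃ (Y : Bool → Set ℂ) (y q' : Bool → ℂ), (∀ k, Y k ⊆ Ω₂) ∧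
      (∀ k, IsArc (Y k) (y k) (q' k)) ∧ (∀ k, Y k ∩ Q = {y k}) ∧ (∀ k, Y k ∩ L = {q' k}) ∧
      Disjoint (Y false) (Y true) ∧ (∀ k, Dist.dist (y k) z = ρ) ∧
      Disjoint (segment ℝ (x false) (y false)) (segment ℝ (x true) (y true)) := by
    rcases matching (hxs false) (hxs true) (hy₀s false) (hy₀s true) hxx hyy (hxy₀ _ _)
      (hxy₀ _ _) with h | h
    · exact ⟨Y₀, y₀, q₀, hY1, hY2, hY3, hY4, hY5, hy₀s, h⟩
    · exact ⟨fun k => Y₀ (!k), fun k => y₀ (!k), fun k => q₀ (!k), fun k => hY1 _, fun k => hY2 _,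
        fun k => hY3 _, fun k => hY4 _, hY5.symm, fun k => hy₀s _, h⟩
  clear hY1 hY2 hY3 hY4 hY5 hxy₀ hy₀Ω hy₀s hyy
  obtain ⟨Y, y, q', hY1, hY2, hY3, hY4, hY5, hys, hm⟩ := hmatch
  have hyΩ : ∀ k, y k ∈ Ω₂ := fun k => hY1 k (hY2 k).left_mem
  have hxy : ∀ k l, x k ≠ y l := fun k l h =>
    Set.disjoint_left.1 hΩ12 (hxΩ k) (h ▸ hyΩ l)
  set J : Bool → Set ℂ := fun k => segment ℝ (x k) (y k) with hJ
  have hJQ : ∀ k, J k ⊆ Q := fun k => (convex_closedBall z ρ).segment_subset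
    (Metric.mem_closedBall.2 (hxs k).le) (Metric.mem_closedBall.2 (hys k).le)
  have hJd : Disjoint (J false) (J true) := hm
  have hXY : ∀ k l, Disjoint (X k) (Y l) := fun k l => hΩ12.mono (hX.E_sub k) (hY1 l)
  have hXJ : ∀ k, X k ∩ J k ⊆ {x k} := fun k => by
    rw [← hX.EL k]; exact Set.inter_subset_inter_right _ (hJQ k)
  have hJY : ∀ k, J k ∩ Y k ⊆ {y k} := fun k => by
    rw [← hY3 k, Set.inter_comm]; exact Set.inter_subset_inter_right _ (hJQ k)
  have hJarc : ∀ k, IsArc (J k) (x k) (y k) := fun k => IsArc.segment (hxy k k)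
  have hEarc : ∀ k, IsArc (X k ∪ J k ∪ Y k) (p' k) (q' k) := fun k => by
    refine ((hX.arc k).trans (hJarc k) (hXJ k)).trans (hY2 k) ?_
    rintro w ⟨h1 | h1, h2⟩
    · exact absurd h2 (Set.disjoint_left.1 (hXY k k) h1)
    · exact hJY k ⟨h1, h2⟩
  have hune : u ≠ v := fun h => Set.disjoint_left.1 g7 g3.right_mem (h ▸ g4.left_mem)
  have hCarc : IsArc (segment ℝ u v) u v := IsArc.segment hune
  have hCQ : segment ℝ u v ⊆ Q := (convex_closedBall z ρ).segment_subset
    (Metric.mem_closedBall.2 hu.le) (Metric.mem_closedBall.2 hv.le)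
  have hFe : IsArc (G₁ ∪ segment ℝ u v ∪ G₂) (fa e) (fb e) := by
    refine (g3.trans hCarc ?_).trans g4 ?_
    · rw [← g5]; exact Set.inter_subset_inter_right _ hCQ
    · rintro w ⟨h1 | h1, h2⟩
      · exact absurd h2 (Set.disjoint_left.1 g7 h1)
      · rw [← g6]; exact ⟨h2, hCQ h1⟩
  have huF : u ∈ F e := g1 g3.right_mem
  have hvF : v ∈ F e := g2 g4.left_mem
  have hxu : ∀ k, x k ≠ u := fun k h => Set.disjoint_left.1 hΩ₁F (hxΩ k) (h ▸ huF)
  have hxv : ∀ k, x k ≠ v := fun k h => Set.disjoint_left.1 hΩ₁F (hxΩ k) (h ▸ hvF)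
  have hyu : ∀ k, y k ≠ u := fun k h => Set.disjoint_left.1 (hΩ₂F e heI) (hyΩ k) (h ▸ huF)
  have hyv : ∀ k, y k ≠ v := fun k h => Set.disjoint_left.1 (hΩ₂F e heI) (hyΩ k) (h ▸ hvF)
  have hxC : ∀ k, x k ∉ segment ℝ u v := fun k h => by
    rcases chord_sphere hu hv h (hxs k) with h | h
    · exact hxu k h
    · exact hxv k h
  have hyC : ∀ k, y k ∉ segment ℝ u v := fun k h => by
    rcases chord_sphere hu hv h (hys k) with h | h
    · exact hyu k h
    · exact hyv k h
  have huJ : ∀ k, u ∉ J k := fun k h => by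
    rcases chord_sphere (hxs k) (hys k) h hu with h | h
    · exact hxu k h.symm
    · exact hyu k h.symm
  have hvJ : ∀ k, v ∉ J k := fun k h => by
    rcases chord_sphere (hxs k) (hys k) h hv with h | h
    · exact hxv k h.symm
    · exact hyv k h.symm
  -- intersection of the threads with the new arc through Q
  have hcrossE : ∀ k, (X k ∪ J k ∪ Y k) ∩ (G₁ ∪ segment ℝ u v ∪ G₂) ⊆ J k ∩ segment ℝ u v := by
    rintro k w ⟨(h | h) | h, (h' | h') | h'⟩
    · exact absurd (g1 h') (Set.disjoint_left.1 hΩ₁F (hX.E_sub k h))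
    · rw [sing_eq (hX.EL k) h (hCQ h')] at h'; exact absurd h' (hxC k)
    · exact absurd (g2 h') (Set.disjoint_left.1 hΩ₁F (hX.E_sub k h))
    · rw [sing_eq g5 h' (hJQ k h)] at h; exact absurd h (huJ k)
    · exact ⟨h, h'⟩
    · rw [sing_eq g6 h' (hJQ k h)] at h; exact absurd h (hvJ k)
    · exact absurd (g1 h') (Set.disjoint_left.1 (hΩ₂F e heI) (hY1 k h))
    · rw [sing_eq (hY3 k) h (hCQ h')] at h'; exact absurd h' (hyC k)
    · exact absurd (g2 h') (Set.disjoint_left.1 (hΩ₂F e heI) (hY1 k h))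
  have hcrossI : ∀ k, ∀ i ∈ I, i ≠ e → (X k ∪ J k ∪ Y k) ∩ F' i ⊆ X k ∩ F' i := by
    rintro k i hiI hie w ⟨(h | h) | h, h'⟩
    · exact ⟨h, h'⟩
    · have hi' := Finset.mem_erase.2 ⟨hie, hiI⟩
      rcases hX.F_sub i hi' h' with h2 | h2
      · exact absurd h2 (Set.disjoint_left.1 (hQF i hiI hie) (hJQ k h))
      · exact absurd (hJQ k h) (Set.disjoint_left.1 (hX.NL i hi') h2)
    · have hi' := Finset.mem_erase.2 ⟨hie, hiI⟩
      rcases hX.F_sub i hi' h' with h2 | h2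
      · exact absurd h2 (Set.disjoint_left.1 (hΩ₂F i hiI) (hY1 k h))
      · exact absurd (hY1 k h) (Set.disjoint_left.1 hΩ12 (hX.N_sub i hi' h2))
  set F'' : ι → Set ℂ := fun i => if i = e then G₁ ∪ segment ℝ u v ∪ G₂ else F' i with hF''
  set N'' : ι → Set ℂ := fun i => if i = e then Q else N i with hN''
  have F''e : F'' e = G₁ ∪ segment ℝ u v ∪ G₂ := by simp [hF'']
  have N''e : N'' e = Q := by simp [hN'']
  have F''i : ∀ i, i ≠ e → F'' i = F' i := fun i h => by simp [hF'', h]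
  have N''i : ∀ i, i ≠ e → N'' i = N i := fun i h => by simp [hN'', h]
  refine ⟨fun k => X k ∪ J k ∪ Y k, p', q', F'', N'', ?_, hEarc, ?_, ?_, ?_, ?_, ?_, ?_, ?_, ?_, ?_,
    ?_, ?_, ?_, ?_, ?_⟩
  · intro k
    exact Set.union_subset (Set.union_subset ((hX.E_sub k).trans hΩ₁Ω) ((hJQ k).trans hQΩ))
      ((hY1 k).trans hΩ₂Ω)
  · intro k
    refine Set.Subset.antisymm ?_ ?_
    · rintro w ⟨(h | h) | h, h'⟩
      · exact sing_eq (hX.EK k) h h'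
      · exact absurd h' (Set.disjoint_left.1 hQK (hJQ k h))
      · exact absurd h' (Set.disjoint_left.1 hΩ₂K (hY1 k h))
    · rintro _ rfl
      exact ⟨(hEarc k).left_mem, (eq_sing_mem (hX.EK k)).2⟩
  · intro k
    refine Set.Subset.antisymm ?_ ?_
    · rintro w ⟨(h | h) | h, h'⟩
      · exact absurd h' (Set.disjoint_left.1 hΩ₁L (hX.E_sub k h))
      · exact absurd h' (Set.disjoint_left.1 hQL (hJQ k h))
      · exact sing_eq (hY4 k) h h'
    · rintro _ rfl
      exact ⟨(hEarc k).right_mem, (eq_sing_mem (hY4 k)).2⟩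
  · rw [Set.disjoint_left]
    rintro w ((h | h) | h) ((h' | h') | h')
    · exact Set.disjoint_left.1 hX.disj h h'
    · rw [sing_eq (hX.EL _) h (hJQ _ h')] at h'
      exact Set.disjoint_left.1 hJd (left_mem_segment _ _ _) h'
    · exact Set.disjoint_left.1 (hXY _ _) h h'
    · rw [sing_eq (hX.EL _) h' (hJQ _ h)] at h
      exact Set.disjoint_left.1 hJd h (left_mem_segment _ _ _)
    · exact Set.disjoint_left.1 hJd h h'
    · rw [sing_eq (hY3 _) h' (hJQ _ h)] at h
      exact Set.disjoint_left.1 hJd h (right_mem_segment _ _ _)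
    · exact Set.disjoint_left.1 (hXY _ _) h' h
    · rw [sing_eq (hY3 _) h (hJQ _ h')] at h'
      exact Set.disjoint_left.1 hJd (right_mem_segment _ _ _) h'
    · exact Set.disjoint_left.1 hY5 h h'
  · intro i hiI
    by_cases hie : i = e
    · rw [hie, F''e]; exact hFe
    · rw [F''i i hie]; exact hX.F_arc i (Finset.mem_erase.2 ⟨hie, hiI⟩)
  · intro i hiI
    by_cases hie : i = e
    · rw [hie, F''e, N''e]
      exact Set.union_subset (Set.union_subset (g1.trans Set.subset_union_left)
        (hCQ.trans Set.subset_union_right)) (g2.trans Set.subset_union_left)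
    · rw [F''i i hie, N''i i hie]; exact hX.F_sub i (Finset.mem_erase.2 ⟨hie, hiI⟩)
  · intro i hiI
    by_cases hie : i = e
    · rw [hie, N''e]; exact hQΩ
    · rw [N''i i hie]; exact (hX.N_sub i (Finset.mem_erase.2 ⟨hie, hiI⟩)).trans hΩ₁Ω
  · intro i hiI
    by_cases hie : i = e
    · rw [hie, N''e]; exact hQK
    · rw [N''i i hie]; exact hX.NK i (Finset.mem_erase.2 ⟨hie, hiI⟩)
  · intro i hiI
    by_cases hie : i = e
    · rw [hie, N''e]; exact hQL
    · rw [N''i i hie]; exact hΩ₁L.mono_left (hX.N_sub i (Finset.mem_erase.2 ⟨hie, hiI⟩))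
  · intro i hiI
    by_cases hie : i = e
    · rw [hie, N''e]; exact hQa
    · rw [N''i i hie]; exact hX.N_a i (Finset.mem_erase.2 ⟨hie, hiI⟩)
  · intro i hiI
    by_cases hie : i = e
    · rw [hie, N''e]; exact hQb
    · rw [N''i i hie]; exact hX.N_b i (Finset.mem_erase.2 ⟨hie, hiI⟩)
  · intro i hiI j hjI hij
    by_cases hie : i = e
    · have hje : j ≠ e := fun h => hij (hie.trans h.symm)
      rw [hie, N''e, N''i j hje]; exact (hX.NL j (Finset.mem_erase.2 ⟨hje, hjI⟩)).symm
    · rw [N''i i hie]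
      by_cases hje : j = e
      · rw [hje, N''e]; exact hX.NL i (Finset.mem_erase.2 ⟨hie, hiI⟩)
      · rw [N''i j hje]
        exact hX.NN i (Finset.mem_erase.2 ⟨hie, hiI⟩) j (Finset.mem_erase.2 ⟨hje, hjI⟩) hij
  · intro i hiI j hjI hij
    by_cases hie : i = e
    · have hje : j ≠ e := fun h => hij (hie.trans h.symm)
      rw [hie, N''e]; exact hQF j hjI hje
    · rw [N''i i hie]
      by_cases hje : j = e
      · rw [hje]; exact hΩ₁F.mono_left (hX.N_sub i (Finset.mem_erase.2 ⟨hie, hiI⟩))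
      · exact hX.NF i (Finset.mem_erase.2 ⟨hie, hiI⟩) j (Finset.mem_erase.2 ⟨hje, hjI⟩) hij
  · intro k i hiI
    by_cases hie : i = e
    · rw [hie, F''e]
      exact (chord_inter hu hv (hxs k) (hxu k) (hxv k)).anti
        ((hcrossE k).trans (by rw [Set.inter_comm]))
    · rw [F''i i hie]
      exact (hX.once k i (Finset.mem_erase.2 ⟨hie, hiI⟩)).anti (hcrossI k i hiI hie)
  · intro k i hiI
    by_cases hie : i = e
    · rw [hie, F''e, N''e]
      exact (hcrossE k).trans (Set.inter_subset_left.trans (hJQ k))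
    · rw [F''i i hie, N''i i hie]
      exact (hcrossI k i hiI hie).trans (hX.EF k i (Finset.mem_erase.2 ⟨hie, hiI⟩))



/-! ### The gadget inside a disc -/

/-- polar coordinates around `c`, normalised by `d` -/
noncomputable def pol (c d : ℂ) (ρ θ : ℝ) : ℂ := c + d * (ρ * Complex.exp (θ * Complex.I))

theorem pol_zero (c d : ℂ) (θ : ℝ) : pol c d 0 θ = c := by simp [pol]

theorem dist_pol (c d : ℂ) {ρ : ℝ} (hρ : 0 ≤ ρ) (θ : ℝ) : Dist.dist (pol c d ρ θ) c = ‖d‖ * ρ := by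
  rw [dist_eq_norm, pol, add_sub_cancel_left, norm_mul, norm_mul, Complex.norm_exp_ofReal_mul_I,
    Complex.norm_real, Real.norm_eq_abs, abs_of_nonneg hρ, mul_one]

theorem pol_inj {c d : ℂ} (hd : d ≠ 0) {ρ ρ' θ θ' : ℝ} (hρ : 0 ≤ ρ) (hρ' : 0 ≤ ρ')
    (h : pol c d ρ θ = pol c d ρ' θ') :
    ρ = ρ' ∧ (ρ = 0 ∨ ∃ n : ℤ, θ = θ' + n * (2 * Real.pi)) := by
  have h1 : ρ = ρ' := by
    have := dist_pol c d hρ θ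
    rw [h, dist_pol c d hρ'] at this
    exact (mul_left_cancel₀ (norm_ne_zero_iff.2 hd) this).symm
  refine ⟨h1, ?_⟩
  by_cases h0 : ρ = 0
  · exact Or.inl h0
  right
  have h2 : Complex.exp (θ * Complex.I) = Complex.exp (θ' * Complex.I) := by
    have := add_left_cancel h
    have := mul_left_cancel₀ hd this
    rw [← h1] at this
    exact mul_left_cancel₀ (by exact_mod_cast h0) this
  obtain ⟨n, hn⟩ := Complex.exp_eq_exp_iff_exists_int.1 h2
  refine ⟨n, ?_⟩
  have h3 : (θ : ℂ) = θ' + n * (2 * Real.pi) := by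
    have : (θ : ℂ) * Complex.I = (θ' + n * (2 * Real.pi)) * Complex.I := by
      rw [hn]; ring
    exact mul_right_cancel₀ Complex.I_ne_zero this
  exact_mod_cast h3

theorem int_small {n : ℤ} {x : ℝ} (h1 : -(2 * Real.pi) < x) (h2 : x < 2 * Real.pi)
    (h : x = n * (2 * Real.pi)) : n = 0 := by
  have hp := Real.pi_pos
  rw [h] at h1 h2
  have a1 : (n : ℝ) < 1 := by nlinarith
  have a2 : (-1 : ℝ) < n := by nlinarith
  have b1 : n < 1 := by exact_mod_cast a1
  have b2 : -1 < n := by exact_mod_cast a2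
  omega

/-- radial strand -/
def radial (c d : ℂ) (θ : ℝ) : Set ℂ := (fun ρ => pol c d ρ θ) '' Set.Icc 0 1

/-- spiral strand -/
def spiral (c d : ℂ) (φ : ℝ) : Set ℂ := (fun t => pol c d ((1 + t) / 2) (t * φ)) '' Set.Icc 0 1

/-- inner edge -/
def innerSeg (c d : ℂ) : Set ℂ := (fun ρ => pol c d ρ 0) '' Set.Icc 0 (1 / 2)

theorem radial_arc {c d : ℂ} (hd : d ≠ 0) (θ : ℝ) : IsArc (radial c d θ) c (pol c d 1 θ) := by
  have := IsArc.of_path (γ := fun ρ => pol c d ρ θ) (a := 0) (b := 1) (by norm_num)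
    (by unfold pol; fun_prop)
    (fun x hx y hy h => (pol_inj hd hx.1 hy.1 h).1)
  rwa [pol_zero] at this

theorem innerSeg_arc {c d : ℂ} (hd : d ≠ 0) : IsArc (innerSeg c d) c (pol c d (1 / 2) 0) := by
  have := IsArc.of_path (γ := fun ρ => pol c d ρ 0) (a := 0) (b := 1 / 2) (by norm_num)
    (by unfold pol; fun_prop)
    (fun x hx y hy h => (pol_inj hd hx.1 hy.1 h).1)
  rwa [pol_zero] at this

theorem spiral_arc {c d : ℂ} (hd : d ≠ 0) (φ : ℝ) :
    IsArc (spiral c d φ) (pol c d (1 / 2) 0) (pol c d 1 φ) := by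
  have := IsArc.of_path (γ := fun t => pol c d ((1 + t) / 2) (t * φ)) (a := 0) (b := 1)
    (by norm_num) (by unfold pol; fun_prop)
    (fun x hx y hy h => by
      have := (pol_inj hd (by linarith [hx.1]) (by linarith [hy.1]) h).1
      linarith)
  norm_num at this
  exact this

theorem radial_ball {c d : ℂ} {θ : ℝ} : radial c d θ ⊆ Metric.closedBall c ‖d‖ := by
  rintro _ ⟨ρ, hρ, rfl⟩
  rw [Metric.mem_closedBall, dist_pol _ _ hρ.1]
  have := norm_nonneg d; nlinarith [hρ.2]

theorem innerSeg_ball {c d : ℂ} (hd : d ≠ 0) : innerSeg c d ⊆ Metric.ball c ‖d‖ := by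
  rintro _ ⟨ρ, hρ, rfl⟩
  rw [Metric.mem_ball, dist_pol _ _ hρ.1]
  have := norm_pos_iff.2 hd; nlinarith [hρ.2]

theorem spiral_ball {c d : ℂ} {φ : ℝ} : spiral c d φ ⊆ Metric.closedBall c ‖d‖ := by
  rintro _ ⟨t, ht, rfl⟩
  rw [Metric.mem_closedBall, dist_pol _ _ (by linarith [ht.1])]
  have := norm_nonneg d; nlinarith [ht.2]

theorem radial_sphere {c d : ℂ} (hd : d ≠ 0) {θ : ℝ} {x : ℂ} (hx : x ∈ radial c d θ)
    (h : Dist.dist x c = ‖d‖) : x = pol c d 1 θ := by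
  obtain ⟨ρ, hρ, rfl⟩ := hx
  simp only at h
  rw [dist_pol _ _ hρ.1] at h
  have hn := norm_ne_zero_iff.2 hd
  have : ρ = 1 := mul_left_cancel₀ hn (by linarith)
  rw [this]

theorem spiral_sphere {c d : ℂ} (hd : d ≠ 0) {φ : ℝ} {x : ℂ} (hx : x ∈ spiral c d φ)
    (h : Dist.dist x c = ‖d‖) : x = pol c d 1 φ := by
  obtain ⟨t, ht, rfl⟩ := hx
  simp only at h
  rw [dist_pol _ _ (by linarith [ht.1])] at h
  have hn := norm_ne_zero_iff.2 hd
  have : (1 + t) / 2 = 1 := mul_left_cancel₀ hn (by linarith)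
  have : t = 1 := by linarith
  simp [this]

theorem radial_radial {c d : ℂ} (hd : d ≠ 0) {θ θ' : ℝ} (h0 : 0 < θ) (h1 : θ < 2 * Real.pi)
    (h0' : 0 < θ') (h1' : θ' < 2 * Real.pi) (hne : θ ≠ θ') {x : ℂ} (hx : x ∈ radial c d θ)
    (hx' : x ∈ radial c d θ') : x = c := by
  obtain ⟨ρ, hρ, rfl⟩ := hx
  obtain ⟨ρ', hρ', h⟩ := hx'
  obtain ⟨e, h | ⟨n, hn⟩⟩ := pol_inj hd hρ'.1 hρ.1 h
  · simp only; rw [← e, h, pol_zero]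
  · have : n = 0 := int_small (x := θ' - θ) (by linarith) (by linarith) (by linarith)
    subst this; simp at hn; exact absurd hn.symm hne

theorem radial_inner {c d : ℂ} (hd : d ≠ 0) {θ : ℝ} (h0 : 0 < θ) (h1 : θ < 2 * Real.pi)
    {x : ℂ} (hx : x ∈ radial c d θ) (hx' : x ∈ innerSeg c d) : x = c := by
  obtain ⟨ρ, hρ, rfl⟩ := hx
  obtain ⟨ρ', hρ', h⟩ := hx'
  obtain ⟨e, h | ⟨n, hn⟩⟩ := pol_inj hd hρ'.1 hρ.1 h
  · simp only; rw [← e, h, pol_zero]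
  · have : n = 0 := int_small (x := 0 - θ) (by linarith) (by linarith) (by linarith)
    subst this; simp at hn; exact absurd hn h0.ne

theorem spiral_inner {c d : ℂ} (hd : d ≠ 0) {φ : ℝ}
    {x : ℂ} (hx : x ∈ spiral c d φ) (hx' : x ∈ innerSeg c d) : x = pol c d (1 / 2) 0 := by
  obtain ⟨t, ht, rfl⟩ := hx
  obtain ⟨ρ', hρ', h⟩ := hx'
  obtain ⟨e, -⟩ := pol_inj hd hρ'.1 (by linarith [ht.1]) h
  have : t = 0 := by linarith [hρ'.2, ht.1]
  simp [this]

theorem spiral_spiral {c d : ℂ} (hd : d ≠ 0) {φ φ' : ℝ} (hne : φ ≠ φ')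
    (h : |φ - φ'| < 2 * Real.pi) {x : ℂ} (hx : x ∈ spiral c d φ)
    (hx' : x ∈ spiral c d φ') : x = pol c d (1 / 2) 0 := by
  obtain ⟨t, ht, rfl⟩ := hx
  obtain ⟨t', ht', h'⟩ := hx'
  obtain ⟨e, h0 | ⟨n, hn⟩⟩ := pol_inj hd (by linarith [ht'.1]) (by linarith [ht.1]) h'
  · linarith [ht'.1]
  · have et : t' = t := by linarith
    subst et
    rw [abs_lt] at h
    have hp := Real.pi_pos
    have : n = 0 := int_small (x := t' * (φ' - φ)) (by nlinarith [ht.1, ht.2])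
      (by nlinarith [ht.1, ht.2]) (by linarith)
    subst this
    have : t' * (φ' - φ) = 0 := by simp at hn; rcases hn with h | h <;> simp [h]
    rcases mul_eq_zero.1 this with h | h
    · simp [h]
    · exact absurd (by linarith) hne

theorem radial_spiral_aux {c d : ℂ} (hd : d ≠ 0) {θ φ : ℝ} (h0 : 0 < θ)
    (h1 : θ < 2 * Real.pi) (g0 : -(2 * Real.pi) < φ) (g1 : φ < 2 * Real.pi)
    {x : ℂ} (hx : x ∈ radial c d θ) (hx' : x ∈ spiral c d φ) :
    ∃ t ∈ Set.Icc (0:ℝ) 1, x = pol c d ((1 + t) / 2) (t * φ) ∧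
      ((0 < φ ∧ t * φ = θ) ∨ (φ < 0 ∧ t * φ = θ - 2 * Real.pi)) := by
  obtain ⟨ρ, hρ, rfl⟩ := hx
  obtain ⟨t, ht, h'⟩ := hx'
  refine ⟨t, ht, h'.symm, ?_⟩
  have hp := Real.pi_pos
  obtain ⟨e, h | ⟨n, hn⟩⟩ := pol_inj hd (by linarith [ht.1]) hρ.1 h'
  · linarith [ht.1]
  rcases lt_trichotomy φ 0 with hφ | hφ | hφ
  · right
    refine ⟨hφ, ?_⟩
    have : n + 1 = 0 := int_small (x := t * φ - θ + 2 * Real.pi) (by nlinarith [ht.1, ht.2])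
      (by nlinarith [ht.1, ht.2]) (by push_cast; linarith)
    have : n = -1 := by omega
    subst this; push_cast at hn; linarith
  · exfalso
    subst hφ
    have : n = 0 := int_small (x := 0 - θ) (by linarith) (by linarith) (by linarith)
    subst this; simp at hn; linarith
  · left
    refine ⟨hφ, ?_⟩
    have : n = 0 := int_small (x := t * φ - θ) (by nlinarith [ht.1, ht.2])
      (by nlinarith [ht.1, ht.2]) (by linarith)
    subst this; simp at hn; linarith

theorem radial_spiral_sub {c d : ℂ} (hd : d ≠ 0) {θ φ : ℝ} (h0 : 0 < θ)
    (h1 : θ < 2 * Real.pi) (g0 : -(2 * Real.pi) < φ) (g1 : φ < 2 * Real.pi) :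
    (radial c d θ ∩ spiral c d φ).Subsingleton := by
  rintro x ⟨hx, hx'⟩ y ⟨hy, hy'⟩
  obtain ⟨t, ht, rfl, h⟩ := radial_spiral_aux hd h0 h1 g0 g1 hx hx'
  obtain ⟨s, hs, rfl, h'⟩ := radial_spiral_aux hd h0 h1 g0 g1 hy hy'
  have : t = s := by
    rcases h with h | h <;> rcases h' with h' | h'
    · exact mul_right_cancel₀ h.1.ne' (h.2.trans h'.2.symm)
    · linarith [h.1, h'.1]
    · linarith [h.1, h'.1]
    · exact mul_right_cancel₀ h.1.ne (h.2.trans h'.2.symm)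
  rw [this]

theorem radial_spiral_pred {c d : ℂ} (hd : d ≠ 0) {θ φ : ℝ} (h0 : 0 < θ)
    (h1 : θ < 2 * Real.pi) (g0 : -(2 * Real.pi) < φ) (g1 : φ < 2 * Real.pi)
    (hne : θ ≠ φ) (hne' : θ ≠ φ + 2 * Real.pi) {x : ℂ} (hx : x ∈ radial c d θ)
    (hx' : x ∈ spiral c d φ) : (0 < φ ∧ θ < φ) ∨ (φ < 0 ∧ φ + 2 * Real.pi < θ) := by
  obtain ⟨t, ht, rfl, h⟩ := radial_spiral_aux hd h0 h1 g0 g1 hx hx'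
  rcases h with h | h
  · left
    exact ⟨h.1, lt_of_le_of_ne (by nlinarith [ht.2, h.1]) hne⟩
  · right
    exact ⟨h.1, lt_of_le_of_ne (by nlinarith [ht.2, h.1]) hne'.symm⟩

theorem center_not_spiral {c d : ℂ} (hd : d ≠ 0) {φ : ℝ} : c ∉ spiral c d φ := by
  rintro ⟨t, ht, h⟩
  have h2 := dist_pol c d (ρ := (1 + t) / 2) (by linarith [ht.1]) (t * φ)
  simp only at h
  rw [h, _root_.dist_self] at h2
  have := norm_pos_iff.2 hd
  nlinarith [ht.1]

theorem half_not_radial {c d : ℂ} (hd : d ≠ 0) {θ : ℝ} (h0 : 0 < θ) (h1 : θ < 2 * Real.pi) :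
    pol c d (1 / 2) 0 ∉ radial c d θ := by
  rintro ⟨ρ, hρ, h⟩
  obtain ⟨e, h | ⟨n, hn⟩⟩ := pol_inj hd hρ.1 (by norm_num) h
  · rw [e] at h; norm_num at h
  · have : n = 0 := int_small (x := θ - 0) (by linarith) (by linarith) (by linarith)
    subst this; simp at hn; linarith



/-! ### Drawings as systems of arcs in `ℂ` -/

/-- A good drawing described by the point sets of its edges in `ℂ`. -/
structure PlaneSys {V : Type*} (G : SimpleGraph V) where
  P : V → ℂ
  C : Sym2 V → Set ℂ
  P_inj : Function.Injective P
  arc : ∀ a b, G.Adj a b → IsArc (C s(a, b)) (P a) (P b)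
  avoid : ∀ e ∈ G.edgeSet, ∀ c, c ∉ e → P c ∉ C e
  adj_inter : ∀ e ∈ G.edgeSet, ∀ f ∈ G.edgeSet, e ≠ f → ∀ v, v ∈ e → v ∈ f → C e ∩ C f ⊆ {P v}
  once : ∀ e ∈ G.edgeSet, ∀ f ∈ G.edgeSet, (∀ v, v ∈ e → v ∉ f) → (C e ∩ C f).Subsingleton
  triple : ∀ e ∈ G.edgeSet, ∀ f ∈ G.edgeSet, ∀ g ∈ G.edgeSet, e ≠ f → e ≠ g → f ≠ g →
    ∀ x, x ∈ C e → x ∈ C f → x ∈ C g → ∃ v, x = P v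

/-- Two non-adjacent edges that cross. -/
def PlaneSys.Cross {V : Type*} {G : SimpleGraph V} (S : PlaneSys G) (e f : Sym2 V) : Prop :=
  e ∈ G.edgeSet ∧ f ∈ G.edgeSet ∧ (∀ v, v ∈ e → v ∉ f) ∧ (S.C e ∩ S.C f).Nonempty

/-- Twice the number of crossings. -/
noncomputable def PlaneSys.cr2 {V : Type*} {G : SimpleGraph V} (S : PlaneSys G) : ℕ :=
  Set.ncard {p : Sym2 V × Sym2 V | S.Cross p.1 p.2}

namespace Drawing

variable {G : SimpleGraph V} (D : Drawing G)

theorem isCrossing_symm {e f : Sym2 V} {p : ℝ × ℝ} (h : D.IsCrossing e f p) :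
    D.IsCrossing f e p := by
  obtain ⟨h1, h2, h3, h4, h5, h6, h7⟩ := h
  exact ⟨h2, h1, h3.symm, h5, h4, h7, h6⟩

/-- The crossing graph. -/
def crossGraph : SimpleGraph (Sym2 V) where
  Adj e f := ∃ p, D.IsCrossing e f p
  symm := ⟨fun _ _ ⟨p, h⟩ => ⟨p, D.isCrossing_symm h⟩⟩
  loopless := ⟨fun _ ⟨_, h⟩ => h.2.2.1 rfl⟩

theorem two_crNum [Finite V] (hD : D.IsGood) :
    Set.ncard {p : Sym2 V × Sym2 V | ∃ x, D.IsCrossing p.1 p.2 x} = 2 * D.crNum := by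
  classical
  have := Fintype.ofFinite V
  have h1 : D.crNum = D.crossGraph.edgeFinset.card := by
    unfold crNum crBetween
    rw [← SimpleGraph.coe_edgeFinset] at *
    have : Nat.card (D.crossings ↑G.edgeFinset ↑G.edgeFinset) = Nat.card D.crossGraph.edgeSet := by
      refine Nat.card_congr (Equiv.ofBijective
        (fun q => ⟨q.1.2, ?_⟩) ⟨?_, ?_⟩)
      · obtain ⟨e, f, h, -, -, hc⟩ := q.2
        rw [h, SimpleGraph.mem_edgeSet]
        exact ⟨_, hc⟩
      · intro q1 q2 h12
        have hqq : q1.1.2 = q2.1.2 := congrArg Subtype.val h12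
        obtain ⟨⟨x, q⟩, e, f, h, _, _, hc⟩ := q1
        obtain ⟨⟨y, q'⟩, e', f', h', _, _, hc'⟩ := q2
        simp only at h h' hc hc' hqq
        subst hqq
        have hxy : x = y := by
          rw [h, Sym2.eq_iff] at h'
          rcases h' with ⟨rfl, rfl⟩ | ⟨rfl, rfl⟩
          · exact hD.cross_once _ _ hc hc'
          · exact hD.cross_once _ _ hc (D.isCrossing_symm hc')
        simp [hxy]
      · rintro ⟨q, hq⟩
        induction q using Sym2.ind with
        | h e f =>
        rw [SimpleGraph.mem_edgeSet] at hq
        obtain ⟨x, hx⟩ := hq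
        exact ⟨⟨(x, s(e, f)), e, f, rfl, by simpa using hx.1, by simpa using hx.2.1, hx⟩, rfl⟩
    rw [this, Nat.card_eq_fintype_card, ← SimpleGraph.edgeFinset_card]
  rw [h1, ← D.crossGraph.dart_card_eq_twice_card_edges, ← Nat.card_eq_fintype_card,
    ← Nat.card_coe_set_eq]
  refine Nat.card_congr ⟨fun p => ⟨p.1, p.2⟩, fun d => ⟨d.toProd, d.adj⟩, fun p => rfl, fun d => rfl⟩

end Drawing

/-- the identification of the two planes -/
noncomputable abbrev toC : (ℝ × ℝ) ≃L[ℝ] ℂ := Complex.equivRealProdCLM.symm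

theorem edgePoints_mk {V : Type*} {G : SimpleGraph V} (D : Drawing G) {a b : V} (h : G.Adj a b) :
    D.edgePoints s(a, b) = D.arc a b '' Set.Icc 0 1 := by
  have hsw : D.arc b a '' Set.Icc 0 1 = D.arc a b '' Set.Icc 0 1 := by
    ext x
    constructor
    · rintro ⟨t, ht, rfl⟩
      exact ⟨1 - t, ⟨by linarith [ht.2], by linarith [ht.1]⟩, (D.arc_symm h t).symm⟩
    · rintro ⟨t, ht, rfl⟩
      exact ⟨1 - t, ⟨by linarith [ht.2], by linarith [ht.1]⟩, by rw [D.arc_symm h]; simp⟩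
  ext x
  constructor
  · rintro ⟨a', b', he, hadj, hx⟩
    rw [Sym2.eq_iff] at he
    rcases he with ⟨rfl, rfl⟩ | ⟨rfl, rfl⟩
    · exact hx
    · rw [← hsw]; exact hx
  · intro hx; exact ⟨a, b, rfl, h, hx⟩

theorem Drawing.vertex_mem {V : Type*} {G : SimpleGraph V} (D : Drawing G) {e : Sym2 V}
    (he : e ∈ G.edgeSet) {v : V} (h : D.pos v ∈ D.edgePoints e) : v ∈ e := by
  induction e using Sym2.ind with
  | h a b =>
  rw [edgePoints_mk D he] at h
  by_contra hv
  rw [Sym2.mem_iff] at hv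
  push Not at hv
  exact D.arc_avoid he v hv.1 hv.2 h

theorem sys_of_good {V : Type*} [Finite V] {G : SimpleGraph V} (D : Drawing G) (hD : D.IsGood) :
    ∃ S : PlaneSys G, S.cr2 = 2 * D.crNum := by
  have vert : ∀ e ∈ G.edgeSet, ∀ f ∈ G.edgeSet, e ≠ f → ∀ x, x ∈ D.edgePoints e →
      x ∈ D.edgePoints f → (∃ v, v ∈ e ∧ v ∈ f ∧ x = D.pos v) ∨ D.IsCrossing e f x := by
    intro e he f hf hef x hx hx'
    by_cases h1 : x ∈ D.ends e
    · obtain ⟨a, ha, rfl⟩ := h1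
      exact Or.inl ⟨a, ha, D.vertex_mem hf hx', rfl⟩
    by_cases h2 : x ∈ D.ends f
    · obtain ⟨a, ha, rfl⟩ := h2
      exact Or.inl ⟨a, D.vertex_mem he hx, ha, rfl⟩
    exact Or.inr ⟨he, hf, hef, hx, hx', h1, h2⟩
  refine ⟨⟨fun v => toC (D.pos v), fun e => toC '' D.edgePoints e, ?_, ?_, ?_, ?_, ?_, ?_⟩, ?_⟩
  · exact toC.injective.comp D.pos_inj
  · intro a b h
    rw [edgePoints_mk D h]
    refine ⟨toC ∘ D.arc a b, toC.continuous.comp_continuousOn (D.arc_cont h),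
      toC.injective.comp_injOn (hD.arc_inj h), by simp [D.arc_zero h], by simp [D.arc_one h],
      Set.image_comp _ _ _⟩
  · rintro e he c hc ⟨x, hx, hxc⟩
    rw [toC.injective hxc] at hx
    exact hc (D.vertex_mem he hx)
  · rintro e he f hf hef v hve hvf _ ⟨⟨x, hx, rfl⟩, ⟨y, hy, hxy⟩⟩
    rw [toC.injective hxy] at hy
    rcases vert e he f hf hef x hx hy with ⟨w, hwe, hwf, rfl⟩ | hc
    · have : w = v := by
        by_contra hne
        exact hef (((Sym2.mem_and_mem_iff hne).1 ⟨hwe, hve⟩).trans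
          ((Sym2.mem_and_mem_iff hne).1 ⟨hwf, hvf⟩).symm)
      rw [this]; rfl
    · exact absurd hc (hD.adj_no_cross e f ⟨v, hve, hvf⟩ x)
  · rintro e he f hf hdis _ ⟨⟨x, hx, rfl⟩, ⟨x', hx', h1⟩⟩ _ ⟨⟨y, hy, rfl⟩, ⟨y', hy', h2⟩⟩
    rw [toC.injective h1] at hx'
    rw [toC.injective h2] at hy'
    have hef : e ≠ f := by
      rintro rfl
      induction e using Sym2.ind with
      | h a b => exact hdis a (Sym2.mem_mk_left _ _) (Sym2.mem_mk_left _ _)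
    rcases vert e he f hf hef x hx hx' with ⟨w, hwe, hwf, rfl⟩ | hc
    · exact absurd hwf (hdis w hwe)
    rcases vert e he f hf hef y hy hy' with ⟨w, hwe, hwf, rfl⟩ | hc'
    · exact absurd hwf (hdis w hwe)
    rw [hD.cross_once e f hc hc']
  · rintro e he f hf g hg hef heg hfg _ ⟨x, hx, rfl⟩ ⟨y, hy, h1⟩ ⟨z, hz, h2⟩
    rw [toC.injective h1] at hy
    rw [toC.injective h2] at hz
    rcases vert e he f hf hef x hx hy with ⟨w, -, -, rfl⟩ | hc
    · exact ⟨w, rfl⟩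
    rcases vert e he g hg heg x hx hz with ⟨w, -, -, rfl⟩ | hc'
    · exact ⟨w, rfl⟩
    rcases vert f hf g hg hfg x hy hz with ⟨w, -, -, rfl⟩ | hc''
    · exact ⟨w, rfl⟩
    exact absurd ⟨hc, hc'', hc'⟩ (hD.no_triple x e f g hef heg hfg)
  · rw [← D.two_crNum hD, PlaneSys.cr2]
    congr 1
    ext ⟨e, f⟩
    simp only [Set.mem_ofPred_eq, PlaneSys.Cross]
    constructor
    · rintro ⟨he, hf, hdis, z, ⟨x, hx, rfl⟩, ⟨y, hy, h1⟩⟩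
      rw [toC.injective h1] at hy
      have hef : e ≠ f := by
        rintro rfl
        induction e using Sym2.ind with
        | h a b => exact hdis a (Sym2.mem_mk_left _ _) (Sym2.mem_mk_left _ _)
      rcases vert e he f hf hef x hx hy with ⟨w, hwe, hwf, rfl⟩ | hc
      · exact absurd hwf (hdis w hwe)
      · exact ⟨x, hc⟩
    · rintro ⟨x, hc⟩
      refine ⟨hc.1, hc.2.1, fun v hve hvf => hD.adj_no_cross e f ⟨v, hve, hvf⟩ x hc,
        toC x, ⟨x, hc.2.2.2.1, rfl⟩, ⟨x, hc.2.2.2.2.1, rfl⟩⟩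

theorem good_of_sys {V : Type*} [Finite V] {G : SimpleGraph V} (S : PlaneSys G) :
    ∃ D : Drawing G, D.IsGood ∧ S.cr2 = 2 * D.crNum := by
  classical
  have hout : ∀ e : Sym2 V, s((Quot.out e).1, (Quot.out e).2) = e := fun e => Quot.out_eq e
  have hch : ∀ e : Sym2 V, ∃ γ : ℝ → ℂ, e ∈ G.edgeSet → ContinuousOn γ (Set.Icc 0 1) ∧
      Set.InjOn γ (Set.Icc 0 1) ∧ γ 0 = S.P (Quot.out e).1 ∧ γ 1 = S.P (Quot.out e).2 ∧
      γ '' Set.Icc 0 1 = S.C e := by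
    intro e
    by_cases he : e ∈ G.edgeSet
    · have h2 : G.Adj (Quot.out e).1 (Quot.out e).2 := by
        rw [← SimpleGraph.mem_edgeSet, hout]; exact he
      have := S.arc _ _ h2
      rw [hout] at this
      obtain ⟨γ, hγ⟩ := this
      exact ⟨γ, fun _ => hγ⟩
    · exact ⟨fun _ => 0, fun h => absurd h he⟩
  choose g hg using hch
  set ar : V → V → ℝ → ℂ := fun a b t =>
    if a = (Quot.out s(a, b)).1 then g s(a, b) t else g s(a, b) (1 - t) with har
  have cases : ∀ a b, G.Adj a b → (a = (Quot.out s(a, b)).1 ∧ b = (Quot.out s(a, b)).2) ∨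
      (a ≠ (Quot.out s(a, b)).1 ∧ b = (Quot.out s(a, b)).1 ∧ a = (Quot.out s(a, b)).2) := by
    intro a b h
    rcases Sym2.eq_iff.1 (hout s(a, b)) with ⟨h1, h2⟩ | ⟨h1, h2⟩
    · exact Or.inl ⟨h1.symm, h2.symm⟩
    · right; refine ⟨?_, h1.symm, h2.symm⟩
      rw [h1]; exact h.ne
  have hm : Set.MapsTo (fun t : ℝ => 1 - t) (Set.Icc 0 1) (Set.Icc 0 1) := by
    rintro t ⟨h0, h1⟩; constructor <;> simp only <;> linarith
  have hsymm : ∀ a b, G.Adj a b → ∀ t, ar b a t = ar a b (1 - t) := by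
    intro a b h t
    simp only [har, Sym2.eq_swap (a := b) (b := a)]
    rcases cases a b h with ⟨h1, h2⟩ | ⟨h1, h2, h3⟩
    · rw [if_pos h1, if_neg]
      rw [← h1]; exact h.ne'
    · rw [if_neg h1, if_pos h2]; simp
  have hprop : ∀ a b, G.Adj a b → ContinuousOn (ar a b) (Set.Icc 0 1) ∧
      Set.InjOn (ar a b) (Set.Icc 0 1) ∧ ar a b 0 = S.P a ∧ ar a b 1 = S.P b ∧
      ar a b '' Set.Icc 0 1 = S.C s(a, b) := by
    intro a b h
    obtain ⟨c1, c2, c3, c4, c5⟩ := hg s(a, b) h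
    rcases cases a b h with ⟨h1, h2⟩ | ⟨h1, h2, h3⟩
    · have : ar a b = g s(a, b) := by funext t; simp only [har]; rw [if_pos h1]
      rw [this]
      rw [← h1] at c3; rw [← h2] at c4
      exact ⟨c1, c2, c3, c4, c5⟩
    · have : ar a b = fun t => g s(a, b) (1 - t) := by
        funext t; simp only [har]; rw [if_neg h1]
      rw [this]
      rw [← h2] at c3; rw [← h3] at c4
      refine ⟨c1.comp (by fun_prop) hm, ?_, by simpa using c4, by simpa using c3, ?_⟩
      · intro s hs t ht hst
        have := c2 (hm hs) (hm ht) hst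
        simp only at this; linarith
      · rw [← c5]
        ext z
        constructor
        · rintro ⟨t, ht, rfl⟩; exact ⟨1 - t, hm ht, rfl⟩
        · rintro ⟨t, ht, rfl⟩; exact ⟨1 - t, hm ht, by simp⟩
  let D : Drawing G :=
    { pos := fun v => toC.symm (S.P v)
      pos_inj := toC.symm.injective.comp S.P_inj
      arc := fun a b t => toC.symm (ar a b t)
      arc_cont := fun a b h => toC.symm.continuous.comp_continuousOn (hprop a b h).1
      arc_zero := fun a b h => by rw [(hprop a b h).2.2.1]
      arc_one := fun a b h => by rw [(hprop a b h).2.2.2.1]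
      arc_symm := fun a b h t => by rw [hsymm a b h]
      arc_avoid := by
        rintro a b h c hca hcb ⟨t, ht, htc⟩
        have h1 := toC.symm.injective htc
        have h2 : S.P c ∈ S.C s(a, b) := by
          rw [← (hprop a b h).2.2.2.2]; exact ⟨t, ht, h1⟩
        exact S.avoid s(a, b) h c (by simp [hca, hcb]) h2 }
  have hEP : ∀ e ∈ G.edgeSet, ∀ x, x ∈ D.edgePoints e ↔ toC x ∈ S.C e := by
    intro e he x
    induction e using Sym2.ind with
    | h a b =>
    rw [edgePoints_mk D he, ← (hprop a b he).2.2.2.2]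
    constructor
    · rintro ⟨t, ht, rfl⟩; exact ⟨t, ht, (toC.apply_symm_apply _).symm⟩
    · rintro ⟨t, ht, h⟩
      exact ⟨t, ht, by simp only [D]; rw [h]; simp⟩
  have hcr : ∀ e f x, D.IsCrossing e f x → S.Cross e f := by
    rintro e f x ⟨he, hf, hef, hxe, hxf, h1, h2⟩
    have hxe' := (hEP e he x).1 hxe
    have hxf' := (hEP f hf x).1 hxf
    refine ⟨he, hf, fun v hve hvf => h1 ⟨v, hve, ?_⟩, toC x, hxe', hxf'⟩
    have h3 : toC x = S.P v := S.adj_inter e he f hf hef v hve hvf ⟨hxe', hxf'⟩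
    simp only [D]; rw [← h3]; simp
  have hgood : D.IsGood := by
    refine ⟨?_, ?_, ?_, ?_⟩
    · intro a b h
      exact toC.symm.injective.comp_injOn (hprop a b h).2.1
    · rintro e f ⟨a, hae, haf⟩ p hc
      exact (hcr e f p hc).2.2.1 a hae haf
    · intro e f p hp q hq
      have h1 := hcr e f p hp
      exact toC.injective (S.once e h1.1 f h1.2.1 h1.2.2.1
        ⟨(hEP e h1.1 p).1 hp.2.2.2.1, (hEP f h1.2.1 p).1 hp.2.2.2.2.1⟩
        ⟨(hEP e h1.1 q).1 hq.2.2.2.1, (hEP f h1.2.1 q).1 hq.2.2.2.2.1⟩)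
    · rintro p e f g' hef heg hfg ⟨h1, h2, h3⟩
      obtain ⟨v, hv⟩ := S.triple e h1.1 f h1.2.1 g' h2.2.1 hef heg hfg (toC p)
        ((hEP e h1.1 p).1 h1.2.2.2.1) ((hEP f h1.2.1 p).1 h1.2.2.2.2.1)
        ((hEP g' h2.2.1 p).1 h2.2.2.2.2.1)
      have hp : p = D.pos v := by simp only [D]; rw [← hv]; simp
      exact h1.2.2.2.2.2.1 ⟨v, D.vertex_mem h1.1 (hp ▸ h1.2.2.2.1), hp⟩
  refine ⟨D, hgood, ?_⟩
  rw [← D.two_crNum hgood, PlaneSys.cr2]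
  congr 1
  ext ⟨e, f⟩
  constructor
  · rintro ⟨he, hf, hdis, x, hx, hx'⟩
    have hef : e ≠ f := by
      rintro rfl
      induction e using Sym2.ind with
      | h a b => exact hdis a (Sym2.mem_mk_left _ _) (Sym2.mem_mk_left _ _)
    have hxe : toC.symm x ∈ D.edgePoints e := (hEP e he _).2 (by rw [toC.apply_symm_apply]; exact hx)
    have hxf : toC.symm x ∈ D.edgePoints f := (hEP f hf _).2 (by rw [toC.apply_symm_apply]; exact hx')
    refine ⟨toC.symm x, he, hf, hef, hxe, hxf, ?_, ?_⟩
    · rintro ⟨v, hv, hxv⟩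
      rw [hxv] at hxf
      exact hdis v hv (D.vertex_mem hf hxf)
    · rintro ⟨v, hv, hxv⟩
      rw [hxv] at hxe
      exact hdis v (D.vertex_mem he hxe) hv
  · rintro ⟨x, hx⟩
    exact hcr e f x hx

theorem crossingNumber_le {V : Type*} [Finite V] {G : SimpleGraph V} (S : PlaneSys G) :
    2 * crossingNumber G ≤ S.cr2 := by
  obtain ⟨D, hD, h⟩ := good_of_sys S
  rw [h]
  exact Nat.mul_le_mul_left 2 (Nat.sInf_le ⟨D, hD, rfl⟩)

theorem crossingNumber_attained {V : Type*} [Finite V] {G : SimpleGraph V} (S : PlaneSys G) :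
    ∃ S' : PlaneSys G, S'.cr2 = 2 * crossingNumber G := by
  obtain ⟨D, hD, h⟩ := good_of_sys S
  obtain ⟨D', hD', h'⟩ := Nat.sInf_mem (s := {n | ∃ D : Drawing G, D.IsGood ∧ D.crNum = n})
    ⟨_, D, hD, rfl⟩
  obtain ⟨S', hS'⟩ := sys_of_good D' hD'
  exact ⟨S', by rw [hS', h']; rfl⟩

/-- Restriction of a system to a subgraph. -/
theorem PlaneSys.comap {V W : Type*} [Finite V] {G : SimpleGraph V} {H : SimpleGraph W}
    (S : PlaneSys G) (φ : W → V) (hφ : Function.Injective φ)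
    (hadj : ∀ a b, H.Adj a b → G.Adj (φ a) (φ b)) :
    ∃ S' : PlaneSys H, S'.cr2 ≤ Set.ncard {p : Sym2 V × Sym2 V | S.Cross p.1 p.2 ∧
      p.1 ∈ Sym2.map φ '' H.edgeSet ∧ p.2 ∈ Sym2.map φ '' H.edgeSet} := by
  have hinj : Function.Injective (Sym2.map φ) := Sym2.map.injective hφ
  have hmem : ∀ e ∈ H.edgeSet, Sym2.map φ e ∈ G.edgeSet := by
    intro e he
    induction e using Sym2.ind with
    | h a b => exact hadj a b he
  have hv : ∀ v (e : Sym2 W), φ v ∈ Sym2.map φ e ↔ v ∈ e := by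
    intro v e
    rw [Sym2.mem_map]
    constructor
    · rintro ⟨a, ha, h⟩; rwa [← hφ h]
    · intro h; exact ⟨v, h, rfl⟩
  have hdis : ∀ e f : Sym2 W, (∀ v, v ∈ e → v ∉ f) →
      ∀ v, v ∈ Sym2.map φ e → v ∉ Sym2.map φ f := by
    intro e f h v hve hvf
    rw [Sym2.mem_map] at hve
    obtain ⟨a, ha, rfl⟩ := hve
    exact h a ha ((hv a f).1 hvf)
  let S' : PlaneSys H :=
    { P := S.P ∘ φ
      C := fun e => S.C (Sym2.map φ e)
      P_inj := S.P_inj.comp hφ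
      arc := fun a b h => S.arc _ _ (hadj a b h)
      avoid := fun e he c hc => S.avoid _ (hmem e he) _ (fun h => hc ((hv c e).1 h))
      adj_inter := fun e he f hf hef v hve hvf =>
        S.adj_inter _ (hmem e he) _ (hmem f hf) (hinj.ne hef) _ ((hv v e).2 hve) ((hv v f).2 hvf)
      once := fun e he f hf h => S.once _ (hmem e he) _ (hmem f hf) (hdis e f h)
      triple := by
        intro e he f hf g hg hef heg hfg x hxe hxf hxg
        obtain ⟨v, rfl⟩ := S.triple _ (hmem e he) _ (hmem f hf) _ (hmem g hg) (hinj.ne hef)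
          (hinj.ne heg) (hinj.ne hfg) x hxe hxf hxg
        have : v ∈ Sym2.map φ e := by
          by_contra h; exact S.avoid _ (hmem e he) v h hxe
        rw [Sym2.mem_map] at this
        obtain ⟨a, -, rfl⟩ := this
        exact ⟨a, rfl⟩ }
  refine ⟨S', ?_⟩
  unfold PlaneSys.cr2
  refine Set.ncard_le_ncard_of_injOn (Prod.map (Sym2.map φ) (Sym2.map φ)) ?_
    ((hinj.prodMap hinj).injOn) (Set.toFinite _)
  rintro ⟨e, f⟩ ⟨he, hf, hd, hne⟩
  exact ⟨⟨hmem e he, hmem f hf, hdis e f hd, hne⟩, ⟨e, he, rfl⟩, ⟨f, hf, rfl⟩⟩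

theorem PlaneSys.comap_le {V W : Type*} [Finite V] {G : SimpleGraph V} {H : SimpleGraph W}
    (S : PlaneSys G) (φ : W → V) (hφ : Function.Injective φ)
    (hadj : ∀ a b, H.Adj a b → G.Adj (φ a) (φ b)) : ∃ S' : PlaneSys H, S'.cr2 ≤ S.cr2 := by
  obtain ⟨S', h⟩ := S.comap φ hφ hadj
  exact ⟨S', h.trans (Set.ncard_le_ncard (fun p hp => hp.1) (Set.toFinite _))⟩



/-! ### Good drawings of complete bipartite graphs -/

/-- A good drawing of the complete bipartite graph with sides `S`, `T`. -/
structure BipSys (S T : Type*) where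
  pS : S → ℂ
  pT : T → ℂ
  R : S → T → Set ℂ
  pS_inj : Function.Injective pS
  pT_inj : Function.Injective pT
  pST : ∀ s t, pS s ≠ pT t
  arc : ∀ s t, IsArc (R s t) (pS s) (pT t)
  avoidS : ∀ s t s', pS s' ∈ R s t → s' = s
  avoidT : ∀ s t t', pT t' ∈ R s t → t' = t
  sameS : ∀ s t t', t ≠ t' → R s t ∩ R s t' ⊆ {pS s}
  sameT : ∀ s s' t, s ≠ s' → R s t ∩ R s' t ⊆ {pT t}
  once : ∀ s t s' t', s ≠ s' → t ≠ t' → (R s t ∩ R s' t').Subsingleton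
  triple : ∀ f g h : S × T, f ≠ g → f ≠ h → g ≠ h → ∀ x, x ∈ R f.1 f.2 → x ∈ R g.1 g.2 →
    x ∈ R h.1 h.2 → (∃ s, x = pS s) ∨ (∃ t, x = pT t)

/-- the crossing relation -/
def BipSys.X {S T : Type*} (B : BipSys S T) (f g : S × T) : Prop :=
  f.1 ≠ g.1 ∧ f.2 ≠ g.2 ∧ (B.R f.1 f.2 ∩ B.R g.1 g.2).Nonempty

theorem BipSys.bound {S T : Type*} [Fintype S] [Fintype T] (B : BipSys S T) :
    2 * crossingNumber (bipK (Fintype.card S) (Fintype.card T)) ≤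
      Set.ncard {p : (S × T) × (S × T) | B.X p.1 p.2} := by
  classical
  let eS := (Fintype.equivFin S).symm
  let eT := (Fintype.equivFin T).symm
  set G := bipK (Fintype.card S) (Fintype.card T) with hG
  have hedge : ∀ e ∈ G.edgeSet, ∃ i j, e = s(Sum.inl i, Sum.inr j) := by
    intro e he
    induction e using Sym2.ind with
    | h a b =>
    rcases a with i | j <;> rcases b with i' | j'
    · simp [hG] at he
    · exact ⟨_, _, rfl⟩
    · exact ⟨_, _, Sym2.eq_swap⟩
    · simp [hG] at he
  let C : Sym2 (Fin (Fintype.card S) ⊕ Fin (Fintype.card T)) → Set ℂ := fun e =>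
    {x | ∃ i j, e = s(Sum.inl i, Sum.inr j) ∧ x ∈ B.R (eS i) (eT j)}
  have hC : ∀ i j, C s(Sum.inl i, Sum.inr j) = B.R (eS i) (eT j) := by
    intro i j
    ext x
    constructor
    · rintro ⟨i', j', he, hx⟩
      simp only [Sym2.eq_iff, Sum.inl.injEq, Sum.inr.injEq, reduceCtorEq, and_self, or_false] at he
      rw [he.1, he.2]; exact hx
    · intro hx; exact ⟨i, j, rfl, hx⟩
  have hnv : ∀ i j i' j', (∀ v, v ∈ s(Sum.inl i, Sum.inr j) →
      v ∉ (s(Sum.inl i', Sum.inr j') : Sym2 (Fin (Fintype.card S) ⊕ Fin (Fintype.card T)))) →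
      i ≠ i' ∧ j ≠ j' := by
    intro i j i' j' h
    constructor
    · rintro rfl; exact h (Sum.inl i) (by simp) (by simp)
    · rintro rfl; exact h (Sum.inr j) (by simp) (by simp)
  let Sys : PlaneSys G :=
    { P := Sum.elim (B.pS ∘ eS) (B.pT ∘ eT)
      C := C
      P_inj := by
        refine Function.Injective.sumElim (B.pS_inj.comp eS.injective)
          (B.pT_inj.comp eT.injective) ?_
        intro i j; exact B.pST _ _
      arc := by
        intro a b h
        rcases a with i | j <;> rcases b with i' | j'
        · simp [hG] at h
        · rw [hC]; exact B.arc _ _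
        · rw [Sym2.eq_swap, hC]; exact (B.arc _ _).symm
        · simp [hG] at h
      avoid := by
        intro e he c hc hx
        obtain ⟨i, j, rfl⟩ := hedge e he
        rw [hC] at hx
        rcases c with i' | j'
        · exact hc (by rw [eS.injective (B.avoidS _ _ _ hx)]; simp)
        · exact hc (by rw [eT.injective (B.avoidT _ _ _ hx)]; simp)
      adj_inter := by
        intro e he f hf hef v hve hvf
        obtain ⟨i, j, rfl⟩ := hedge e he
        obtain ⟨i', j', rfl⟩ := hedge f hf
        rw [hC, hC]
        rcases v with k | k
        · simp only [Sym2.mem_iff, Sum.inl.injEq, reduceCtorEq, or_false] at hve hvf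
          subst hve; subst hvf
          have : j ≠ j' := by rintro rfl; exact hef rfl
          exact B.sameS _ _ _ (eT.injective.ne this)
        · simp only [Sym2.mem_iff, Sum.inr.injEq, reduceCtorEq, false_or] at hve hvf
          subst hve; subst hvf
          have : i ≠ i' := by rintro rfl; exact hef rfl
          exact B.sameT _ _ _ (eS.injective.ne this)
      once := by
        intro e he f hf h
        obtain ⟨i, j, rfl⟩ := hedge e he
        obtain ⟨i', j', rfl⟩ := hedge f hf
        rw [hC, hC]
        obtain ⟨h1, h2⟩ := hnv _ _ _ _ h
        exact B.once _ _ _ _ (eS.injective.ne h1) (eT.injective.ne h2)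
      triple := by
        intro e he f hf g hg hef heg hfg x hxe hxf hxg
        obtain ⟨i, j, rfl⟩ := hedge e he
        obtain ⟨i', j', rfl⟩ := hedge f hf
        obtain ⟨i'', j'', rfl⟩ := hedge g hg
        rw [hC] at hxe hxf hxg
        have key : ∀ a b a' b', (s(Sum.inl a, Sum.inr b) :
            Sym2 (Fin (Fintype.card S) ⊕ Fin (Fintype.card T))) ≠ s(Sum.inl a', Sum.inr b') →
            (eS a, eT b) ≠ (eS a', eT b') := by
          intro a b a' b' h h'
          rw [Prod.mk.injEq] at h'
          exact h (by rw [eS.injective h'.1, eT.injective h'.2])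
        rcases B.triple (eS i, eT j) (eS i', eT j') (eS i'', eT j'') (key _ _ _ _ hef)
          (key _ _ _ _ heg) (key _ _ _ _ hfg) x hxe hxf hxg with ⟨s, rfl⟩ | ⟨t, rfl⟩
        · exact ⟨Sum.inl (eS.symm s), by simp⟩
        · exact ⟨Sum.inr (eT.symm t), by simp⟩ }
  refine (crossingNumber_le Sys).trans ?_
  unfold PlaneSys.cr2
  let φ : S × T → Sym2 (Fin (Fintype.card S) ⊕ Fin (Fintype.card T)) := fun f =>
    s(Sum.inl (eS.symm f.1), Sum.inr (eT.symm f.2))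
  refine (Set.ncard_le_ncard (t := Prod.map φ φ '' {p : (S × T) × (S × T) | B.X p.1 p.2}) ?_
    (Set.toFinite _)).trans (Set.ncard_image_le (Set.toFinite _))
  rintro ⟨e, f⟩ ⟨he, hf, hd, hne⟩
  simp only at he hf hd hne
  obtain ⟨i, j, rfl⟩ := hedge e he
  obtain ⟨i', j', rfl⟩ := hedge f hf
  obtain ⟨h1, h2⟩ := hnv _ _ _ _ hd
  refine ⟨((eS i, eT j), (eS i', eT j')), ⟨eS.injective.ne h1, eT.injective.ne h2, ?_⟩, ?_⟩
  · have := hne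
    simp only [Sys, hC] at this
    exact this
  · simp [φ]

/-- Deleting a vertex. -/
def BipSys.erase {S T : Type*} (B : BipSys S T) (v : T) : BipSys S {t : T // t ≠ v} where
  pS := B.pS
  pT := fun t => B.pT t
  R := fun s t => B.R s t
  pS_inj := B.pS_inj
  pT_inj := B.pT_inj.comp Subtype.val_injective
  pST := fun s t => B.pST s t
  arc := fun s t => B.arc s t
  avoidS := fun s t s' h => B.avoidS s t s' h
  avoidT := fun s t t' h => Subtype.ext (B.avoidT s t t' h)
  sameS := fun s t t' h => B.sameS s t t' (Subtype.val_injective.ne h)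
  sameT := fun s s' t h => B.sameT s s' t h
  once := fun s t s' t' h h' => B.once s t s' t' h (Subtype.val_injective.ne h')
  triple := by
    intro f g h hfg hfh hgh x hf hg hh
    have key : ∀ a b : S × {t : T // t ≠ v}, a ≠ b → (a.1, a.2.1) ≠ (b.1, b.2.1) := by
      intro a b hab h'
      rw [Prod.mk.injEq] at h'
      exact hab (Prod.ext h'.1 (Subtype.ext h'.2))
    rcases B.triple (f.1, f.2.1) (g.1, g.2.1) (h.1, h.2.1) (key _ _ hfg) (key _ _ hfh)
      (key _ _ hgh) x hf hg hh with h1 | ⟨t, ht⟩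
    · exact Or.inl h1
    · refine Or.inr ⟨⟨t, ?_⟩, ht⟩
      rw [ht] at hf
      rw [B.avoidT _ _ _ hf]; exact f.2.2

theorem BipSys.bound_erase {S T : Type*} [Fintype S] [Fintype T] [DecidableEq T]
    (B : BipSys S T) (v : T) :
    2 * crossingNumber (bipK (Fintype.card S) (Fintype.card T - 1)) ≤
      Set.ncard {p : (S × T) × (S × T) | B.X p.1 p.2 ∧ p.1.2 ≠ v ∧ p.2.2 ≠ v} := by
  have h := (B.erase v).bound
  rw [Fintype.card_subtype_compl, Fintype.card_subtype_eq] at h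
  refine h.trans ?_
  refine Set.ncard_le_ncard_of_injOn
    (fun p => ((p.1.1, p.1.2.1), (p.2.1, p.2.2.1))) ?_ ?_ (Set.toFinite _)
  · rintro ⟨⟨s, t, ht⟩, ⟨s', t', ht'⟩⟩ ⟨h1, h2, h3⟩
    exact ⟨⟨h1, fun h => h2 (Subtype.ext h), h3⟩, ht, ht'⟩
  · rintro ⟨⟨s, t, ht⟩, ⟨s', t', ht'⟩⟩ - ⟨⟨s2, t2, ht2⟩, ⟨s2', t2', ht2'⟩⟩ - h
    simp only [Prod.mk.injEq] at h
    obtain ⟨⟨rfl, rfl⟩, rfl, rfl⟩ := h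
    rfl



/-! ### Cyclic order on a circle -/

/-- counterclockwise angle from `x` to `y` -/
noncomputable def gap (x y : ℝ) : ℝ := if x ≤ y then y - x else y - x + 2 * Real.pi

/-- the admissible range of angles -/
def InR (x : ℝ) : Prop := -Real.pi < x ∧ x ≤ Real.pi

/-- cyclic order `w ≤ u < x` -/
def cyc (w u x : ℝ) : Prop := (w ≤ u ∧ u < x) ∨ (w ≤ u ∧ x < w) ∨ (u < x ∧ x < w)

theorem gap_nonneg {x y : ℝ} (hx : InR x) (hy : InR y) : 0 ≤ gap x y := by
  unfold gap; split_ifs <;> linarith [hx.1, hx.2, hy.1, hy.2]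

theorem gap_lt {x y : ℝ} (hx : InR x) (hy : InR y) : gap x y < 2 * Real.pi := by
  unfold gap; split_ifs <;> linarith [hx.1, hx.2, hy.1, hy.2]

theorem gap_pos {x y : ℝ} (hx : InR x) (hy : InR y) (h : x ≠ y) : 0 < gap x y := by
  unfold gap; split_ifs with h1
  · have := lt_of_le_of_ne h1 h; linarith
  · linarith [hx.1, hx.2, hy.1, hy.2]

theorem gap_self (x : ℝ) : gap x x = 0 := by simp [gap]

theorem gap_lt_iff {w u x : ℝ} (hw : InR w) (hu : InR u) (hx : InR x) :
    gap w u < gap w x ↔ cyc w u x := by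
  unfold gap cyc
  have := hw.1; have := hw.2; have := hu.1; have := hu.2; have := hx.1; have := hx.2
  split_ifs with h1 h2 h2
  · constructor
    · intro h; exact Or.inl ⟨h1, by linarith⟩
    · rintro (h | h | h) <;> linarith [h.1, h.2]
  · constructor
    · intro h; exact Or.inr (Or.inl ⟨h1, by linarith⟩)
    · rintro (h | h | h) <;> linarith [h.1, h.2]
  · constructor
    · intro h; linarith
    · rintro (h | h | h) <;> linarith [h.1, h.2]
  · constructor
    · intro h; exact Or.inr (Or.inr ⟨by linarith, by linarith⟩)
    · rintro (h | h | h) <;> linarith [h.1, h.2]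

section
variable {Q : Type*} [Fintype Q]

open Classical in
/-- number of points in the arc from `w` to `x` -/
noncomputable def cnt (β : Q → ℝ) (w : Q) (x : ℝ) : ℕ :=
  (Finset.univ.filter fun u => cyc (β w) (β u) x).card

/-- the local crossing predicate -/
def Lc (β : Q → ℝ) (h : ℕ) (w : Q) (x : ℝ) (u : Q) : Prop :=
  (cnt β w x ≤ cnt β w (β u) ∧ cnt β w (β u) ≤ h) ∨ (h < cnt β w (β u) ∧ cnt β w (β u) < cnt β w x)

theorem cnt_mono {β : Q → ℝ} {w : Q} {x y : ℝ} (h : ∀ u, cyc (β w) (β u) x → cyc (β w) (β u) y) :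
    cnt β w x ≤ cnt β w y := by
  classical
  unfold cnt
  exact Finset.card_le_card (fun u hu => by simp only [Finset.mem_filter, Finset.mem_univ, true_and] at hu ⊢; exact h u hu)

theorem cnt_lt {β : Q → ℝ} {w : Q} {x y : ℝ} (h : ∀ u, cyc (β w) (β u) x → cyc (β w) (β u) y)
    (v : Q) (h1 : ¬ cyc (β w) (β v) x) (h2 : cyc (β w) (β v) y) :
    cnt β w x < cnt β w y := by
  classical
  unfold cnt
  apply Finset.card_lt_card
  rw [Finset.ssubset_iff_of_subset (fun u hu => by simp only [Finset.mem_filter, Finset.mem_univ, true_and] at hu ⊢; exact h u hu)]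
  exact ⟨v, by simpa using h2, by simpa using h1⟩

theorem cyc_gap {β : Q → ℝ} (hβ : ∀ u, InR (β u)) {w u : Q} {x : ℝ} (hx : InR x) :
    cyc (β w) (β u) x ↔ gap (β w) (β u) < gap (β w) x := (gap_lt_iff (hβ w) (hβ u) hx).symm

/-- If the radial at `x` comes before `u`. -/
theorem cnt_before {β : Q → ℝ} (hβ : ∀ u, InR (β u)) {w u : Q} {x : ℝ} (hx : InR x)
    (h : gap (β w) x < gap (β w) (β u)) : cnt β w x ≤ cnt β w (β u) := by
  refine cnt_mono fun v hv => ?_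
  rw [cyc_gap hβ hx] at hv
  rw [cyc_gap hβ (hβ u)]
  linarith

theorem cnt_after {β : Q → ℝ} (hβ : ∀ u, InR (β u)) {w u : Q} {x : ℝ} (hx : InR x)
    (h : gap (β w) (β u) < gap (β w) x) : cnt β w (β u) < cnt β w x := by
  refine cnt_lt (fun v hv => ?_) u ?_ ?_
  · rw [cyc_gap hβ (hβ u)] at hv
    rw [cyc_gap hβ hx]
    linarith
  · rw [cyc_gap hβ (hβ u)]; exact lt_irrefl _
  · rw [cyc_gap hβ hx]; exact h

theorem gap_inj {w x y : ℝ} (hw : InR w) (hx : InR x) (hy : InR y) (h : gap w x = gap w y) :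
    x = y := by
  unfold gap at h
  have := hw.1; have := hw.2; have := hx.1; have := hx.2; have := hy.1; have := hy.2
  split_ifs at h <;> linarith

theorem rk_lt_iff {β : Q → ℝ} (hβ : ∀ u, InR (β u)) {w u v : Q} :
    cnt β w (β u) < cnt β w (β v) ↔ gap (β w) (β u) < gap (β w) (β v) := by
  constructor
  · intro h
    by_contra h'
    push Not at h'
    rcases h'.lt_or_eq with h' | h'
    · exact absurd (cnt_after hβ (hβ u) h') (by omega)
    · rw [gap_inj (hβ w) (hβ v) (hβ u) h'] at h
      omega
  · exact cnt_after hβ (hβ v)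

theorem rk_inj {β : Q → ℝ} (hβ : ∀ u, InR (β u)) (hinj : Function.Injective β) (w : Q) :
    Function.Injective (fun u => cnt β w (β u)) := by
  intro u v huv
  simp only at huv
  rcases lt_trichotomy (gap (β w) (β u)) (gap (β w) (β v)) with h | h | h
  · exact absurd (cnt_after hβ (hβ v) h) (by omega)
  · exact hinj (gap_inj (hβ w) (hβ u) (hβ v) h)
  · exact absurd (cnt_after hβ (hβ u) h) (by omega)

theorem rk_self {β : Q → ℝ} (w : Q) : cnt β w (β w) = 0 := by
  classical
  unfold cnt
  rw [Finset.card_eq_zero, Finset.filter_eq_empty_iff]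
  rintro u - (h | h | h)
  · exact absurd h.1 (not_le.2 h.2)
  · exact lt_irrefl _ h.2
  · exact lt_irrefl _ h.2

theorem rk_lt_card {β : Q → ℝ} (w u : Q) : cnt β w (β u) < Fintype.card Q := by
  classical
  unfold cnt
  rw [← Finset.card_univ]
  apply Finset.card_lt_card
  rw [Finset.ssubset_univ_iff]
  intro h
  have := (Finset.ext_iff.1 h u).2 (Finset.mem_univ u)
  simp only [Finset.mem_filter, Finset.mem_univ, true_and] at this
  rcases this with h | h | h
  · exact lt_irrefl _ h.2
  · exact absurd h.1 (not_le.2 h.2)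
  · exact lt_irrefl _ h.1

theorem cnt_pos {β : Q → ℝ} (w : Q) {x : ℝ} (hx : ∀ u, β u ≠ x) : 1 ≤ cnt β w x := by
  classical
  unfold cnt
  apply Finset.card_pos.2
  refine ⟨w, ?_⟩
  simp only [Finset.mem_filter, Finset.mem_univ, true_and]
  rcases lt_or_gt_of_ne (hx w) with h | h
  · exact Or.inl ⟨le_refl _, h⟩
  · exact Or.inr (Or.inl ⟨le_refl _, h⟩)

theorem cnt_le_card {β : Q → ℝ} (w : Q) (x : ℝ) : cnt β w x ≤ Fintype.card Q := by
  classical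
  exact Finset.card_le_univ _

/-- The count is injective in the starting point. -/
theorem cnt_base_lt {β : Q → ℝ} {w w' : Q} {x : ℝ}
    (h : cyc (β w) (β w') x) (hne : β w ≠ β w') : cnt β w' x < cnt β w x := by
  classical
  unfold cnt
  apply Finset.card_lt_card
  have hw : cyc (β w) (β w) x := by
    rcases h with h | h | h
    · exact Or.inl ⟨le_refl _, h.1.trans_lt h.2⟩
    · exact Or.inr (Or.inl ⟨le_refl _, h.2⟩)
    · exact Or.inr (Or.inl ⟨le_refl _, h.2⟩)
  have hw' : ¬ cyc (β w') (β w) x := by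
    rintro (h' | h' | h') <;> rcases h with h | h | h <;>
      first
      | exact absurd h.1 (not_le.2 h'.2)
      | (obtain ⟨a1, a2⟩ := h; obtain ⟨b1, b2⟩ := h'
         first
         | (exact hne (le_antisymm (by linarith) (by linarith)))
         | linarith)
  rw [Finset.ssubset_iff_of_subset]
  · exact ⟨w, by simpa using hw, by simpa using hw'⟩
  · intro u hu
    simp only [Finset.mem_filter, Finset.mem_univ, true_and] at hu ⊢
    rcases h with ⟨a1, a2⟩ | ⟨a1, a2⟩ | ⟨a1, a2⟩ <;> rcases hu with ⟨b1, b2⟩ | ⟨b1, b2⟩ | ⟨b1, b2⟩ <;>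
      first
      | exact Or.inl ⟨by linarith, by linarith⟩
      | exact Or.inr (Or.inl ⟨by linarith, by linarith⟩)
      | exact Or.inr (Or.inr ⟨by linarith, by linarith⟩)
      | (exfalso; linarith)

theorem cnt_base_inj {β : Q → ℝ} (hinj : Function.Injective β) (x : ℝ)
    : Function.Injective (fun w => cnt β w x) := by
  intro w w' hww
  by_contra hne
  have hne' : β w ≠ β w' := hinj.ne hne
  simp only at hww
  by_cases h1 : cyc (β w) (β w') x
  · exact absurd (cnt_base_lt h1 hne') (by omega)
  by_cases h2 : cyc (β w') (β w) x
  · exact absurd (cnt_base_lt h2 hne'.symm) (by omega)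
  -- then one of them equals x
  unfold cyc at h1 h2
  push Not at h1 h2
  obtain ⟨h11, h12, h13⟩ := h1
  obtain ⟨h21, h22, h23⟩ := h2
  rcases lt_or_gt_of_ne hne' with h | h
  · have e1 := h11 h.le
    have e2 := h12 h.le
    rcases e2.lt_or_eq with e3 | e3
    · rcases e1.lt_or_eq with e4 | e4
      · exact absurd (h23 e3) (not_le.2 e4)
      · subst e4
        have := rk_self (β := β) w'
        rw [this] at hww
        have : 0 < cnt β w (β w') := by
          unfold cnt
          apply Finset.card_pos.2
          exact ⟨w, by classical simp only [Finset.mem_filter, Finset.mem_univ, true_and]; exact Or.inl ⟨le_refl _, h⟩⟩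
        omega
    · subst e3
      have := rk_self (β := β) w
      rw [this] at hww
      have : 0 < cnt β w' (β w) := by
        unfold cnt
        apply Finset.card_pos.2
        exact ⟨w', by classical simp only [Finset.mem_filter, Finset.mem_univ, true_and]; exact Or.inr (Or.inl ⟨le_refl _, h⟩)⟩
      omega
  · have e1 := h21 h.le
    have e2 := h22 h.le
    rcases e2.lt_or_eq with e3 | e3
    · rcases e1.lt_or_eq with e4 | e4
      · exact absurd (h13 e3) (not_le.2 e4)
      · subst e4
        have := rk_self (β := β) w
        rw [this] at hww
        have : 0 < cnt β w' (β w) := by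
          unfold cnt
          apply Finset.card_pos.2
          exact ⟨w', by classical simp only [Finset.mem_filter, Finset.mem_univ, true_and]; exact Or.inl ⟨le_refl _, h⟩⟩
        omega
    · subst e3
      have := rk_self (β := β) w'
      rw [this] at hww
      have : 0 < cnt β w (β w') := by
        unfold cnt
        apply Finset.card_pos.2
        exact ⟨w, by classical simp only [Finset.mem_filter, Finset.mem_univ, true_and]; exact Or.inr (Or.inl ⟨le_refl _, h⟩)⟩
      omega
end



section
variable {Q : Type*} [Fintype Q]

theorem rk_surj {β : Q → ℝ} (hinj : Function.Injective β) (v : Q) {h : ℕ}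
    (hh : h < Fintype.card Q) : ∃ w, cnt β w (β v) = h := by
  let f : Q → Fin (Fintype.card Q) := fun w => ⟨cnt β w (β v), rk_lt_card w v⟩
  have hf : Function.Injective f := by
    intro a b hab
    exact cnt_base_inj hinj (β v) (congrArg Fin.val hab)
  have := (Fintype.bijective_iff_injective_and_card f).2 ⟨hf, by simp⟩
  obtain ⟨w, hw⟩ := this.2 ⟨h, hh⟩
  exact ⟨w, congrArg Fin.val hw⟩

theorem tri_sum (n : ℕ) : 2 * ∑ i ∈ Finset.range n, i = n * n - n := by
  rw [mul_comm, Finset.sum_range_id_mul_two]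
  cases n with
  | zero => rfl
  | succ k => simp only [Nat.add_sub_cancel]; rw [Nat.mul_succ]; omega

/-- `∑_{c=1}^{N} g c`, split at `h`. -/
theorem sum_split (N h : ℕ) (hN : h ≤ N) (g : ℕ → ℕ) :
    ∑ c ∈ Finset.range N, g (c + 1) =
      ∑ c ∈ Finset.range h, g (c + 1) + ∑ c ∈ Finset.range (N - h), g (h + c + 1) := by
  obtain ⟨k, rfl⟩ := Nat.exists_eq_add_of_le hN
  rw [Finset.sum_range_add, Nat.add_sub_cancel_left]

theorem card_rk {β : Q → ℝ} (hβ : ∀ u, InR (β u)) (hinj : Function.Injective β) (w : Q)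
    (p : Q → Prop) [DecidablePred p] (F : Finset ℕ) (h : ∀ u, p u → cnt β w (β u) ∈ F) :
    (Finset.univ.filter fun u => p u).card ≤ F.card := by
  apply Finset.card_le_card_of_injOn (fun u => cnt β w (β u))
  · intro u hu
    simp only [Finset.coe_filter, Finset.mem_univ, true_and] at hu
    exact h u hu
  · exact (rk_inj hβ hinj w).injOn

/-- per-radial count, in general -/
theorem sum_count {β : Q → ℝ} (hinj : Function.Injective β) {x : ℝ}
    (hx : ∀ u, β u ≠ x) (g : ℕ → ℕ) :
    ∑ w, g (cnt β w x) ≤ ∑ c ∈ Finset.range (Fintype.card Q), g (c + 1) := by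
  have h2 : Set.InjOn (fun w => cnt β w x - 1) (Finset.univ : Finset Q) := by
    intro a _ b _ hab
    apply cnt_base_inj hinj x
    have := cnt_pos a hx
    have := cnt_pos b hx
    simp only at hab ⊢
    omega
  have h1 : ∑ w, g (cnt β w x) = ∑ w, g (cnt β w x - 1 + 1) := by
    refine Finset.sum_congr rfl fun w _ => ?_
    rw [Nat.sub_add_cancel (cnt_pos w hx)]
  rw [h1, ← Finset.sum_image (f := fun c => g (c + 1)) h2]
  apply Finset.sum_le_sum_of_subset
  intro c hc
  simp only [Finset.mem_image, Finset.mem_univ, true_and] at hc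
  obtain ⟨w, rfl⟩ := hc
  have := cnt_pos w hx
  have := cnt_le_card (β := β) w x
  rw [Finset.mem_range]; omega

open Classical in
theorem sum_odd {β : Q → ℝ} (hβ : ∀ u, InR (β u)) (hinj : Function.Injective β) {x : ℝ}
    (hx : ∀ u, β u ≠ x) (b : ℕ) (hb : Fintype.card Q = 2 * b + 2) :
    ∑ w, (Finset.univ.filter fun u => Lc β (b + 1) w x u).card ≤ (b + 1) ^ 2 := by
  have h0 : ∀ w, (Finset.univ.filter fun u => Lc β (b + 1) w x u).card ≤
      (fun c => (b + 2 - c) + (c - (b + 2))) (cnt β w x) := by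
    intro w
    refine (card_rk hβ hinj w _ (if cnt β w x ≤ b + 2 then Finset.Ico (cnt β w x) (b + 2) else
      Finset.Ico (b + 2) (cnt β w x)) ?_).trans ?_
    · intro u hu
      unfold Lc at hu
      split_ifs <;> rw [Finset.mem_Ico] <;> omega
    · split_ifs <;> rw [Nat.card_Ico] <;> simp only <;> omega
  refine (Finset.sum_le_sum fun w _ => h0 w).trans ?_
  refine (sum_count hinj hx (fun c => (b + 2 - c) + (c - (b + 2)))).trans ?_
  rw [hb, sum_split _ (b + 1) (by omega) (fun c => (b + 2 - c) + (c - (b + 2)))]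
  have e1 : ∀ c ∈ Finset.range (b + 1), (b + 2 - (c + 1)) + (c + 1 - (b + 2)) =
      (b + 1 - 1 - c) + 1 := by
    intro c hc
    rw [Finset.mem_range] at hc
    omega
  have e2 : ∀ c ∈ Finset.range (2 * b + 2 - (b + 1)),
      (b + 2 - (b + 1 + c + 1)) + (b + 1 + c + 1 - (b + 2)) = c := by
    intro c hc
    omega
  rw [Finset.sum_congr rfl e1, Finset.sum_congr rfl e2,
    Finset.sum_range_reflect (fun i => i + 1) (b + 1), Finset.sum_add_distrib]
  have h3 : 2 * b + 2 - (b + 1) = b + 1 := by omega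
  rw [h3]
  have := tri_sum (b + 1)
  have h4 : b + 1 ≤ (b + 1) * (b + 1) := Nat.le_mul_self _
  simp only [Finset.sum_const, Finset.card_range, smul_eq_mul, mul_one, pow_two]
  omega

open Classical in
theorem sum_even {β : Q → ℝ} (hβ : ∀ u, InR (β u)) (hinj : Function.Injective β) {x : ℝ}
    (hx : ∀ u, β u ≠ x) (b : ℕ) (hb : Fintype.card Q = 2 * b + 1) (w : Q → Q)
    (hw : ∀ v, cnt β (w v) (β v) = b) :
    ∑ v, (Finset.univ.filter fun u => Lc β b (w v) x u ∧ u ≠ v).card ≤ b ^ 2 := by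
  have hwinj : Function.Injective w := by
    intro v v' h
    apply rk_inj hβ hinj (w v)
    simp only
    rw [hw v, h, hw v']
  let W : Q ≃ Q := Equiv.ofBijective w (Finite.injective_iff_bijective.1 hwinj)
  have h0 : ∀ v, (Finset.univ.filter fun u => Lc β b (w v) x u ∧ u ≠ v).card ≤
      (fun c => (b - c) + (c - (b + 1))) (cnt β (w v) x) := by
    intro v
    refine (card_rk hβ hinj (w v) (fun u => Lc β b (w v) x u ∧ u ≠ v) (if cnt β (w v) x ≤ b then Finset.Ico (cnt β (w v) x) b else
      Finset.Ico (b + 1) (cnt β (w v) x)) ?_).trans ?_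
    · rintro u ⟨hu, huv⟩
      have hd : cnt β (w v) (β u) ≠ b := by
        intro hd
        apply huv
        apply rk_inj hβ hinj (w v)
        simp only
        rw [hw v]; exact hd
      unfold Lc at hu
      split_ifs <;> rw [Finset.mem_Ico] <;> omega
    · split_ifs <;> rw [Nat.card_Ico] <;> simp only <;> omega
  refine (Finset.sum_le_sum fun v _ => h0 v).trans ?_
  have h1 := Equiv.sum_comp W (fun v => (fun c => (b - c) + (c - (b + 1))) (cnt β v x))
  have h1' : ∑ v, (fun c => (b - c) + (c - (b + 1))) (cnt β (w v) x) =
    ∑ v, (fun c => (b - c) + (c - (b + 1))) (cnt β v x) := h1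
  rw [h1']
  refine (sum_count hinj hx (fun c => (b - c) + (c - (b + 1)))).trans ?_
  rw [hb, sum_split _ b (by omega) (fun c => (b - c) + (c - (b + 1)))]
  have e1 : ∀ c ∈ Finset.range b, (b - (c + 1)) + (c + 1 - (b + 1)) = b - 1 - c := by
    intro c hc
    rw [Finset.mem_range] at hc
    omega
  have e2 : ∀ c ∈ Finset.range (2 * b + 1 - b),
      (b - (b + c + 1)) + (b + c + 1 - (b + 1)) = c := by
    intro c hc
    omega
  rw [Finset.sum_congr rfl e1, Finset.sum_congr rfl e2, Finset.sum_range_reflect (fun i => i) b]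
  have h3 : 2 * b + 1 - b = b + 1 := by omega
  rw [h3, Finset.sum_range_succ]
  have := tri_sum b
  have h4 : b ≤ b * b := Nat.le_mul_self _
  rw [pow_two]
  omega

/-! #### Exchanging two adjacent points -/

theorem cnt_congr {β β' : Q → ℝ} {w : Q} {x x' : ℝ}
    (h : ∀ u, cyc (β w) (β u) x ↔ cyc (β' w) (β' u) x') : cnt β w x = cnt β' w x' := by
  classical
  unfold cnt
  congr 1
  ext u
  simp only [Finset.mem_filter, Finset.mem_univ, true_and]
  exact h u

theorem cyc_congr {w u x w' u' x' : ℝ} (h2 : u < w ↔ u' < w')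
    (h3 : u < x ↔ u' < x') (h4 : x < w ↔ x' < w') : cyc w u x ↔ cyc w' u' x' := by
  unfold cyc
  rw [← not_lt, ← not_lt, h2, h3, h4]

variable {β β' : Q → ℝ} {e : Q} {ξ ξ' : ℝ}

theorem swap_rk (he : β e = ξ) (he' : β' e = ξ') (hoth : ∀ u, u ≠ e → β' u = β u)
    (hadj : ∀ u, u ≠ e → (β u < ξ ↔ β u < ξ') ∧ (ξ < β u ↔ ξ' < β u)) (w u : Q) :
    cnt β w (β u) = cnt β' w (β' u) := by
  have cmp : ∀ u v, β u < β v ↔ β' u < β' v := by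
    intro u v
    by_cases hu : u = e <;> by_cases hv : v = e
    · subst hu; subst hv; simp
    · subst hu; rw [he, he', hoth v hv]; exact (hadj v hv).2
    · subst hv; rw [he, he', hoth u hu]; exact (hadj u hu).1
    · rw [hoth u hu, hoth v hv]
  exact cnt_congr fun v => cyc_congr (cmp _ _) (cmp _ _) (cmp _ _)

theorem swap_other (he : β e = ξ) (he' : β' e = ξ') (hoth : ∀ u, u ≠ e → β' u = β u)
    (hadj : ∀ u, u ≠ e → (β u < ξ ↔ β u < ξ') ∧ (ξ < β u ↔ ξ' < β u))
    {x : ℝ} (hx : (x < ξ ↔ x < ξ') ∧ (ξ < x ↔ ξ' < x)) (w : Q) :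
    cnt β w x = cnt β' w x := by
  have cmp : ∀ u v, β u < β v ↔ β' u < β' v := by
    intro u v
    by_cases hu : u = e <;> by_cases hv : v = e
    · subst hu; subst hv; simp
    · subst hu; rw [he, he', hoth v hv]; exact (hadj v hv).2
    · subst hv; rw [he, he', hoth u hu]; exact (hadj u hu).1
    · rw [hoth u hu, hoth v hv]
  have cx : ∀ u, β u < x ↔ β' u < x := by
    intro u
    by_cases hu : u = e
    · subst hu; rw [he, he']; exact hx.2
    · rw [hoth u hu]
  have cx' : ∀ u, x < β u ↔ x < β' u := by
    intro u
    by_cases hu : u = e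
    · subst hu; rw [he, he']; exact hx.1
    · rw [hoth u hu]
  exact cnt_congr fun v => cyc_congr (cmp _ _) (cx _) (cx' _)

/-- A point right after `e`. -/
theorem cnt_right_after (hinj : Function.Injective β) (he : β e = ξ) (hlt : ξ < ξ')
    (hadj : ∀ u, u ≠ e → (β u < ξ ↔ β u < ξ') ∧ (ξ < β u ↔ ξ' < β u)) {w : Q} :
    cnt β w ξ' = cnt β w (β e) + 1 := by
  classical
  unfold cnt
  have hne : e ∉ Finset.univ.filter fun u => cyc (β w) (β u) (β e) := by
    simp only [Finset.mem_filter, Finset.mem_univ, true_and]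
    rintro (h | h | h)
    · exact lt_irrefl _ h.2
    · exact absurd h.1 (not_le.2 h.2)
    · exact lt_irrefl _ h.1
  have : (Finset.univ.filter fun u => cyc (β w) (β u) ξ') =
      insert e (Finset.univ.filter fun u => cyc (β w) (β u) (β e)) := by
    ext u
    simp only [Finset.mem_insert, Finset.mem_filter, Finset.mem_univ, true_and]
    by_cases hu : u = e
    · subst hu
      simp only [true_or, iff_true]
      unfold cyc
      by_cases hw : w = u
      · subst hw; exact Or.inl ⟨le_refl _, by linarith⟩
      · have := hadj w hw
        rcases lt_or_gt_of_ne (hinj.ne hw) with h | h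
        · exact Or.inl ⟨h.le, by linarith⟩
        · rw [he] at h
          exact Or.inr (Or.inr ⟨by linarith, this.2.1 h⟩)
    · simp only [hu, false_or]
      have h1 := hadj u hu
      by_cases hw : w = e
      · subst hw
        rw [he]
        unfold cyc
        constructor
        · rintro (h | h | h)
          · exact absurd (h1.1.2 h.2) (not_lt.2 h.1)
          · linarith [h.2]
          · linarith [h.2]
        · rintro (h | h | h)
          · exact absurd h.2 (not_lt.2 h.1)
          · exact absurd h.2 (lt_irrefl _)
          · exact absurd h.2 (lt_irrefl _)
      · have h2 := hadj w hw
        rw [he]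
        exact cyc_congr Iff.rfl h1.1.symm h2.2.symm
  rw [this, Finset.card_insert_of_notMem hne]

/-- A point right before `e`. -/
theorem cnt_right_before (he : β e = ξ) (hlt : ξ' < ξ)
    (hadj : ∀ u, u ≠ e → (β u < ξ ↔ β u < ξ') ∧ (ξ < β u ↔ ξ' < β u)) {w : Q} (hw : w ≠ e) :
    cnt β w ξ' = cnt β w (β e) := by
  apply cnt_congr
  intro u
  rw [he]
  by_cases hu : u = e
  · subst hu
    rw [he]
    have h1 := hadj w hw
    unfold cyc
    constructor
    · rintro (h | h | h)
      · exact absurd h.2 (not_lt.2 hlt.le)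
      · have := h1.2.2 h.2
        linarith [h.1]
      · exact absurd h.1 (not_lt.2 hlt.le)
    · rintro (h | h | h)
      · exact absurd h.2 (lt_irrefl _)
      · linarith [h.1, h.2]
      · exact absurd h.1 (lt_irrefl _)
  · exact cyc_congr Iff.rfl (hadj u hu).1.symm (hadj w hw).2.symm

theorem swap_L (hinj : Function.Injective β) (hinj' : Function.Injective β')
    (he : β e = ξ) (he' : β' e = ξ') (hne : ξ ≠ ξ')
    (hoth : ∀ u, u ≠ e → β' u = β u)
    (hadj : ∀ u, u ≠ e → (β u < ξ ↔ β u < ξ') ∧ (ξ < β u ↔ ξ' < β u)) {h : ℕ} {w : Q}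
    (hX : Lc β h w ξ' e) :
    ¬ Lc β' h w ξ e ∧ ∀ u, u ≠ e → Lc β' h w ξ u → Lc β h w ξ' u := by
  have hwe : w ≠ e := by
    rintro rfl
    have h0 := rk_self (β := β) w
    have h1 : 1 ≤ cnt β w ξ' := by
      apply cnt_pos
      intro u hu
      by_cases huw : u = w
      · subst huw; exact hne (he.symm.trans hu)
      · have := hadj u huw
        rw [hu] at this
        rcases lt_or_gt_of_ne hne with h | h
        · exact absurd (this.2.1 h) (lt_irrefl _)
        · exact absurd (this.1.1 h) (lt_irrefl _)
    rcases hX with h | h <;> omega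
  have hadj' : ∀ u, u ≠ e → (β' u < ξ' ↔ β' u < ξ) ∧ (ξ' < β' u ↔ ξ < β' u) := by
    intro u hu
    rw [hoth u hu]
    exact ⟨(hadj u hu).1.symm, (hadj u hu).2.symm⟩
  have hrk := swap_rk he he' hoth hadj w
  rcases lt_or_gt_of_ne hne with hlt | hlt
  · have h1 := cnt_right_after hinj he hlt hadj (w := w)
    have h2 := cnt_right_before he' hlt hadj' hwe
    unfold Lc at hX ⊢
    constructor
    · rw [h2, ← hrk]
      rw [h1] at hX
      omega
    · intro u hu hL
      rw [h2, ← hrk, ← hrk] at hL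
      rw [h1]
      omega
  · have h1 := cnt_right_before he hlt hadj hwe
    have h2 := cnt_right_after hinj' he' hlt hadj' (w := w)
    unfold Lc at hX ⊢
    constructor
    · rw [h2, ← hrk]
      rw [h1] at hX
      omega
    · intro u hu hL
      rw [h2, ← hrk, ← hrk] at hL
      rw [h1]
      omega
end



/-! ### The gadget inside a disc -/

structure Gadget (c : ℂ) (r : ℝ) {P Q : Type*} (α : P → ℂ) (β : Q → ℂ) (L : P → Q → Prop) where
  z' : ℂ
  RA : P → Set ℂ
  RB : Q → Set ℂ
  RI : Set ℂ
  RA_arc : ∀ s, IsArc (RA s) c (α s)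
  RB_arc : ∀ t, IsArc (RB t) z' (β t)
  RI_arc : IsArc RI c z'
  RA_ball : ∀ s, RA s ⊆ Metric.closedBall c r
  RB_ball : ∀ t, RB t ⊆ Metric.closedBall c r
  RI_ball : RI ⊆ Metric.ball c r
  RA_sphere : ∀ s x, x ∈ RA s → Dist.dist x c = r → x = α s
  RB_sphere : ∀ t x, x ∈ RB t → Dist.dist x c = r → x = β t
  RA_RA : ∀ s s' x, s ≠ s' → x ∈ RA s → x ∈ RA s' → x = c
  RB_RB : ∀ t t' x, t ≠ t' → x ∈ RB t → x ∈ RB t' → x = z'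
  RA_RI : ∀ s x, x ∈ RA s → x ∈ RI → x = c
  RB_RI : ∀ t x, x ∈ RB t → x ∈ RI → x = z'
  RA_RB_sub : ∀ s t, (RA s ∩ RB t).Subsingleton
  RA_RB : ∀ s t x, x ∈ RA s → x ∈ RB t → L s t
  z'_RA : ∀ s, z' ∉ RA s
  c_RB : ∀ t, c ∉ RB t

theorem pol_shift (c d : ℂ) (θ₀ ρ θ : ℝ) :
    pol c (pol c d 1 θ₀ - c) ρ θ = pol c d ρ (θ₀ + θ) := by
  unfold pol
  push_cast
  rw [add_mul, Complex.exp_add]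
  ring

theorem pol_period (c d : ℂ) (ρ θ : ℝ) (n : ℤ) :
    pol c d ρ (θ + n * (2 * Real.pi)) = pol c d ρ θ := by
  unfold pol
  have : ((θ + n * (2 * Real.pi) : ℝ) : ℂ) * Complex.I =
      θ * Complex.I + n * (2 * Real.pi * Complex.I) := by push_cast; ring
  rw [this, Complex.exp_add, Complex.exp_int_mul_two_pi_mul_I, mul_one]

theorem gap_eq (x y : ℝ) : ∃ n : ℤ, x + gap x y = y + n * (2 * Real.pi) := by
  unfold gap
  split_ifs
  · exact ⟨0, by simp⟩
  · exact ⟨1, by push_cast; ring⟩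

theorem exists_gadget {c d : ℂ} (hd : d ≠ 0) {P Q : Type*} [Fintype Q] (a : P → ℝ) (b : Q → ℝ)
    (ha : ∀ s, InR (a s)) (hb : ∀ t, InR (b t)) (hai : Function.Injective a)
    (hbi : Function.Injective b) (hab : ∀ s t, b t ≠ a s) (w : Q) (h : ℕ) :
    Nonempty (Gadget c ‖d‖ (fun s => pol c d 1 (a s)) (fun t => pol c d 1 (b t))
      (fun s t => Lc b h w (a s) t)) := by
  classical
  set d' : ℂ := pol c d 1 (b w) - c with hd'
  have hnd : ‖d'‖ = ‖d‖ := by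
    rw [hd', ← dist_eq_norm, dist_pol c d zero_le_one, mul_one]
  have hd0 : d' ≠ 0 := by
    rw [← norm_pos_iff, hnd]; exact norm_pos_iff.2 hd
  have hsh : ∀ ρ θ, pol c d' ρ θ = pol c d ρ (b w + θ) := by
    intro ρ θ
    exact pol_shift c d (b w) ρ θ
  have hend : ∀ y, pol c d' 1 (gap (b w) y) = pol c d 1 y := by
    intro y
    rw [hsh]
    obtain ⟨n, hn⟩ := gap_eq (b w) y
    rw [hn, pol_period]
  have hend' : ∀ y, pol c d' 1 (gap (b w) y - 2 * Real.pi) = pol c d 1 y := by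
    intro y
    rw [hsh]
    obtain ⟨n, hn⟩ := gap_eq (b w) y
    have : b w + (gap (b w) y - 2 * Real.pi) = y + ((n - 1 : ℤ) : ℝ) * (2 * Real.pi) := by
      push_cast; linarith
    rw [this, pol_period]
  set φ : Q → ℝ := fun t => if cnt b w (b t) ≤ h then gap (b w) (b t) else
    gap (b w) (b t) - 2 * Real.pi with hφ
  have hφend : ∀ t, pol c d' 1 (φ t) = pol c d 1 (b t) := by
    intro t
    simp only [hφ]
    split_ifs
    · exact hend _
    · exact hend' _
  have hpi := Real.pi_pos
  have g0 : ∀ t, -(2 * Real.pi) < φ t := by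
    intro t
    have h1 := gap_nonneg (hb w) (hb t)
    simp only [hφ]
    split_ifs with h2
    · linarith
    · have : 0 < gap (b w) (b t) := by
        apply gap_pos (hb w) (hb t)
        intro h3
        rw [← hbi h3, rk_self] at h2
        omega
      linarith
  have g1 : ∀ t, φ t < 2 * Real.pi := by
    intro t
    have h1 := gap_lt (hb w) (hb t)
    simp only [hφ]
    split_ifs <;> linarith
  have a0 : ∀ s, 0 < gap (b w) (a s) := fun s => gap_pos (hb w) (ha s) (hab s w)
  have a1 : ∀ s, gap (b w) (a s) < 2 * Real.pi := fun s => gap_lt (hb w) (ha s)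
  have hφd : ∀ t t', t ≠ t' → φ t ≠ φ t' ∧ |φ t - φ t'| < 2 * Real.pi := by
    intro t t' htt
    have n1 := gap_nonneg (hb w) (hb t)
    have n2 := gap_nonneg (hb w) (hb t')
    have n3 := gap_lt (hb w) (hb t)
    have n4 := gap_lt (hb w) (hb t')
    have ne : gap (b w) (b t) ≠ gap (b w) (b t') := fun h => htt (hbi (gap_inj (hb w) (hb t) (hb t') h))
    simp only [hφ]
    rw [abs_lt]
    split_ifs with h1 h2 h2
    · exact ⟨ne, by linarith, by linarith⟩
    · have : gap (b w) (b t) < gap (b w) (b t') := (rk_lt_iff hb).1 (by omega)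
      refine ⟨by intro h; linarith, by linarith, by linarith⟩
    · have : gap (b w) (b t') < gap (b w) (b t) := (rk_lt_iff hb).1 (by omega)
      refine ⟨by intro h; linarith, by linarith, by linarith⟩
    · exact ⟨by intro h; apply ne; linarith, by linarith, by linarith⟩
  exact ⟨{
    z' := pol c d' (1 / 2) 0
    RA := fun s => radial c d' (gap (b w) (a s))
    RB := fun t => spiral c d' (φ t)
    RI := innerSeg c d'
    RA_arc := fun s => by
      have := radial_arc (c := c) hd0 (gap (b w) (a s))
      rwa [hend] at this
    RB_arc := fun t => by
      have := spiral_arc (c := c) hd0 (φ t)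
      rwa [hφend] at this
    RI_arc := innerSeg_arc hd0
    RA_ball := fun s => by rw [← hnd]; exact radial_ball
    RB_ball := fun s => by rw [← hnd]; exact spiral_ball
    RI_ball := by rw [← hnd]; exact innerSeg_ball hd0
    RA_sphere := fun s x hx hx' => by
      rw [← hend]; exact radial_sphere hd0 hx (by rw [hnd, hx'])
    RB_sphere := fun s x hx hx' => by
      rw [← hφend]; exact spiral_sphere hd0 hx (by rw [hnd, hx'])
    RA_RA := fun s s' x hss hx hx' => radial_radial hd0 (a0 s) (a1 s) (a0 s') (a1 s')
      (fun h => hss (hai (gap_inj (hb w) (ha s) (ha s') h))) hx hx'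
    RB_RB := fun t t' x htt hx hx' => spiral_spiral hd0 (hφd t t' htt).1 (hφd t t' htt).2 hx hx'
    RA_RI := fun s x hx hx' => radial_inner hd0 (a0 s) (a1 s) hx hx'
    RB_RI := fun t x hx hx' => spiral_inner hd0 hx hx'
    RA_RB_sub := fun s t => radial_spiral_sub hd0 (a0 s) (a1 s) (g0 t) (g1 t)
    RA_RB := fun s t x hx hx' => by
      have ne : gap (b w) (a s) ≠ gap (b w) (b t) :=
        fun h => hab s t (gap_inj (hb w) (hb t) (ha s) h.symm)
      have n1 := gap_nonneg (hb w) (hb t)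
      have n3 := gap_lt (hb w) (hb t)
      have n5 := a0 s
      have n6 := a1 s
      have hp := radial_spiral_pred hd0 (a0 s) (a1 s) (g0 t) (g1 t) (by
        simp only [hφ]; split_ifs
        · exact ne
        · intro h; linarith) (by
        simp only [hφ]; split_ifs
        · intro h; linarith
        · intro h; apply ne; linarith) hx hx'
      unfold Lc
      simp only [hφ] at hp
      split_ifs at hp with h2
      · left
        rcases hp with hp | hp
        · exact ⟨cnt_before hb (ha s) hp.2, h2⟩
        · linarith [hp.1]
      · right
        rcases hp with hp | hp
        · linarith [hp.1]
        · exact ⟨by omega, cnt_after hb (ha s) (by linarith [hp.2])⟩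
    z'_RA := fun s => half_not_radial hd0 (a0 s) (a1 s)
    c_RB := fun t => center_not_spiral hd0 }⟩



/-! ### Assembling a drawing of the bipartite graph -/

/-- inner edges -/
def IsInn {A B : Type*} (s : A ⊕ Bool) (t : B ⊕ Bool) : Prop := ∃ k, s = Sum.inr k ∧ t = Sum.inr k

/-- incidence with disc `k` -/
def Inc {A B : Type*} (k : Bool) (f : (A ⊕ Bool) × (B ⊕ Bool)) : Prop :=
  f.1 = Sum.inr k ∨ f.2 = Sum.inr k

/-- A drawing with the two discs opened. -/
structure Opn (A B : Type*) (X : (A ⊕ Bool) × (B ⊕ Bool) → (A ⊕ Bool) × (B ⊕ Bool) → Prop) where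
  c : Bool → ℂ
  r : Bool → ℝ
  PA : A → ℂ
  PB : B → ℂ
  O : A ⊕ Bool → B ⊕ Bool → Set ℂ
  uS : A ⊕ Bool → B ⊕ Bool → ℂ
  uT : A ⊕ Bool → B ⊕ Bool → ℂ
  r_pos : ∀ k, 0 < r k
  disj : ∀ k k' x, x ∈ Metric.closedBall (c k) (r k) → x ∈ Metric.closedBall (c k') (r k') → k = k'
  PA_inj : Function.Injective PA
  PB_inj : Function.Injective PB
  PAB : ∀ a b, PA a ≠ PB b
  PA_out : ∀ a k, PA a ∉ Metric.closedBall (c k) (r k)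
  PB_out : ∀ b k, PB b ∉ Metric.closedBall (c k) (r k)
  arc : ∀ s t, ¬ IsInn s t → IsArc (O s t) (uS s t) (uT s t)
  uS_inl : ∀ a t, uS (Sum.inl a) t = PA a
  uT_inl : ∀ s b, uT s (Sum.inl b) = PB b
  ball : ∀ s t k x, ¬ IsInn s t → x ∈ O s t → x ∈ Metric.closedBall (c k) (r k) →
    (s = Sum.inr k ∧ x = uS s t) ∨ (t = Sum.inr k ∧ x = uT s t)
  uS_sphere : ∀ k t, t ≠ Sum.inr k → Dist.dist (uS (Sum.inr k) t) (c k) = r k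
  uT_sphere : ∀ k s, s ≠ Sum.inr k → Dist.dist (uT s (Sum.inr k)) (c k) = r k
  avoidA : ∀ a s t, ¬ IsInn s t → PA a ∈ O s t → Sum.inl a = s
  avoidB : ∀ b s t, ¬ IsInn s t → PB b ∈ O s t → Sum.inl b = t
  cross : ∀ f g : (A ⊕ Bool) × (B ⊕ Bool), ¬ IsInn f.1 f.2 → ¬ IsInn g.1 g.2 → f ≠ g → ∀ x, x ∈ O f.1 f.2 → x ∈ O g.1 g.2 →
    (∃ a, f.1 = Sum.inl a ∧ g.1 = Sum.inl a ∧ x = PA a) ∨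
    (∃ b, f.2 = Sum.inl b ∧ g.2 = Sum.inl b ∧ x = PB b) ∨ X f g
  X_ne : ∀ f g, X f g → f.1 ≠ g.1 ∧ f.2 ≠ g.2 ∧ ∀ k, ¬ (Inc k f ∧ Inc k g)
  once : ∀ f g : (A ⊕ Bool) × (B ⊕ Bool), ¬ IsInn f.1 f.2 → ¬ IsInn g.1 g.2 → X f g → (O f.1 f.2 ∩ O g.1 g.2).Subsingleton
  triple : ∀ f g h : (A ⊕ Bool) × (B ⊕ Bool), ¬ IsInn f.1 f.2 → ¬ IsInn g.1 g.2 → ¬ IsInn h.1 h.2 → f ≠ g → f ≠ h → g ≠ h →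
    ∀ x, x ∈ O f.1 f.2 → x ∈ O g.1 g.2 → x ∈ O h.1 h.2 → (∃ a, x = PA a) ∨ (∃ b, x = PB b)

namespace Opn

variable {A B : Type*} {X : (A ⊕ Bool) × (B ⊕ Bool) → (A ⊕ Bool) × (B ⊕ Bool) → Prop}
  (W : Opn A B X)

/-- A-type ends at disc `k` -/
def al (k : Bool) (s : {s : A ⊕ Bool // s ≠ Sum.inr k}) : ℂ := W.uT s (Sum.inr k)

/-- B-type ends at disc `k` -/
def be (k : Bool) (t : {t : B ⊕ Bool // t ≠ Sum.inr k}) : ℂ := W.uS (Sum.inr k) t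

/-- local crossings -/
def Loc {A B : Type*}
    (L : ∀ k : Bool, {s : A ⊕ Bool // s ≠ Sum.inr k} → {t : B ⊕ Bool // t ≠ Sum.inr k} → Prop)
    (k : Bool) (f g : (A ⊕ Bool) × (B ⊕ Bool)) : Prop :=
  ∃ s t, f = (s.1, Sum.inr k) ∧ g = (Sum.inr k, t.1) ∧ L k s t

variable {L : ∀ k : Bool, {s : A ⊕ Bool // s ≠ Sum.inr k} → {t : B ⊕ Bool // t ≠ Sum.inr k} → Prop}
  (Γ : ∀ k, Gadget (W.c k) (W.r k) (W.al k) (W.be k) (L k))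

/-- the part of an edge inside a disc -/
inductive InD (k : Bool) (x : ℂ) : (A ⊕ Bool) × (B ⊕ Bool) → Prop
  | inner : x ∈ (Γ k).RI → InD k x (Sum.inr k, Sum.inr k)
  | bt (t : {t : B ⊕ Bool // t ≠ Sum.inr k}) : x ∈ (Γ k).RB t → InD k x (Sum.inr k, t.1)
  | atp (s : {s : A ⊕ Bool // s ≠ Sum.inr k}) : x ∈ (Γ k).RA s → InD k x (s.1, Sum.inr k)

/-- the edges of the assembled drawing -/
def RR (s : A ⊕ Bool) (t : B ⊕ Bool) : Set ℂ :=
  {x | (¬ IsInn s t ∧ x ∈ W.O s t) ∨ ∃ k, InD W Γ k x (s, t)}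


theorem c_ball (k : Bool) : W.c k ∈ Metric.closedBall (W.c k) (W.r k) :=
  Metric.mem_closedBall_self (W.r_pos k).le

theorem inD_ball {k : Bool} {x : ℂ} {f : (A ⊕ Bool) × (B ⊕ Bool)} (h : InD W Γ k x f) :
    x ∈ Metric.closedBall (W.c k) (W.r k) := by
  cases h with
  | inner h => exact Metric.ball_subset_closedBall ((Γ k).RI_ball h)
  | bt t h => exact (Γ k).RB_ball t h
  | atp s h => exact (Γ k).RA_ball s h

theorem rr_ball {k : Bool} {x : ℂ} {s : A ⊕ Bool} {t : B ⊕ Bool} (h : x ∈ W.RR Γ s t)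
    (hx : x ∈ Metric.closedBall (W.c k) (W.r k)) : InD W Γ k x (s, t) := by
  rcases h with ⟨hi, hO⟩ | ⟨k', h⟩
  · rcases W.ball s t k x hi hO hx with ⟨rfl, rfl⟩ | ⟨rfl, rfl⟩
    · have ht : t ≠ Sum.inr k := fun h => hi ⟨k, rfl, h⟩
      exact InD.bt ⟨t, ht⟩ ((Γ k).RB_arc ⟨t, ht⟩).right_mem
    · have hs : s ≠ Sum.inr k := fun h => hi ⟨k, h, rfl⟩
      exact InD.atp ⟨s, hs⟩ ((Γ k).RA_arc ⟨s, hs⟩).right_mem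
  · have := W.disj k k' x hx (W.inD_ball Γ h)
    subst this; exact h

theorem rr_out {x : ℂ} {s : A ⊕ Bool} {t : B ⊕ Bool} (h : x ∈ W.RR Γ s t)
    (hx : ∀ k, x ∉ Metric.closedBall (W.c k) (W.r k)) : ¬ IsInn s t ∧ x ∈ W.O s t := by
  rcases h with h | ⟨k', h⟩
  · exact h
  · exact absurd (W.inD_ball Γ h) (hx k')

/-- vertices -/
def vS : A ⊕ Bool → ℂ := Sum.elim W.PA (fun k => (Γ k).z')
def vT : B ⊕ Bool → ℂ := Sum.elim W.PB W.c

theorem inD_inter {k : Bool} {x : ℂ} {f g : (A ⊕ Bool) × (B ⊕ Bool)} (hfg : f ≠ g)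
    (hf : InD W Γ k x f) (hg : InD W Γ k x g) :
    (f.1 = g.1 ∧ x = W.vS Γ f.1) ∨ (f.2 = g.2 ∧ x = W.vT f.2) ∨ Loc L k f g ∨ Loc L k g f := by
  cases hf with
  | inner hf =>
    cases hg with
    | inner hg => exact absurd rfl hfg
    | bt t hg => exact Or.inl ⟨rfl, (Γ k).RB_RI t x hg hf⟩
    | atp s hg => exact Or.inr (Or.inl ⟨rfl, (Γ k).RA_RI s x hg hf⟩)
  | bt t hf =>
    cases hg with
    | inner hg => exact Or.inl ⟨rfl, (Γ k).RB_RI t x hf hg⟩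
    | bt t' hg =>
      exact Or.inl ⟨rfl, (Γ k).RB_RB t t' x (fun h => hfg (by rw [h])) hf hg⟩
    | atp s hg => exact Or.inr (Or.inr (Or.inr ⟨s, t, rfl, rfl, (Γ k).RA_RB s t x hg hf⟩))
  | atp s hf =>
    cases hg with
    | inner hg => exact Or.inr (Or.inl ⟨rfl, (Γ k).RA_RI s x hf hg⟩)
    | bt t hg => exact Or.inr (Or.inr (Or.inl ⟨s, t, rfl, rfl, (Γ k).RA_RB s t x hf hg⟩))
    | atp s' hg =>
      exact Or.inr (Or.inl ⟨rfl, (Γ k).RA_RA s s' x (fun h => hfg (by rw [h])) hf hg⟩)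

theorem loc_ne {k : Bool} {f g : (A ⊕ Bool) × (B ⊕ Bool)} (h : Loc L k f g) :
    f.1 ≠ g.1 ∧ f.2 ≠ g.2 ∧ Inc k f ∧ Inc k g := by
  obtain ⟨s, t, rfl, rfl, -⟩ := h
  exact ⟨s.2, t.2.symm, Or.inr rfl, Or.inl rfl⟩

theorem master {x : ℂ} {f g : (A ⊕ Bool) × (B ⊕ Bool)} (hfg : f ≠ g)
    (hf : x ∈ W.RR Γ f.1 f.2) (hg : x ∈ W.RR Γ g.1 g.2) :
    (f.1 = g.1 ∧ x = W.vS Γ f.1) ∨ (f.2 = g.2 ∧ x = W.vT f.2) ∨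
    (f.1 ≠ g.1 ∧ f.2 ≠ g.2 ∧ (((∀ k, x ∉ Metric.closedBall (W.c k) (W.r k)) ∧ X f g) ∨
      ∃ k, x ∈ Metric.closedBall (W.c k) (W.r k) ∧ (Loc L k f g ∨ Loc L k g f))) := by
  by_cases hx : ∃ k, x ∈ Metric.closedBall (W.c k) (W.r k)
  · obtain ⟨k, hx⟩ := hx
    rcases W.inD_inter Γ hfg (W.rr_ball Γ hf hx) (W.rr_ball Γ hg hx) with h | h | h | h
    · exact Or.inl h
    · exact Or.inr (Or.inl h)
    · exact Or.inr (Or.inr ⟨(loc_ne h).1, (loc_ne h).2.1, Or.inr ⟨k, hx, Or.inl h⟩⟩)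
    · exact Or.inr (Or.inr ⟨(loc_ne h).1.symm, (loc_ne h).2.1.symm, Or.inr ⟨k, hx, Or.inr h⟩⟩)
  · push Not at hx
    obtain ⟨hf1, hf2⟩ := W.rr_out Γ hf hx
    obtain ⟨hg1, hg2⟩ := W.rr_out Γ hg hx
    rcases W.cross f g hf1 hg1 hfg x hf2 hg2 with ⟨a, h1, h2, rfl⟩ | ⟨b, h1, h2, rfl⟩ | h
    · left; rw [h1, h2]; exact ⟨rfl, rfl⟩
    · right; left; rw [h1, h2]; exact ⟨rfl, rfl⟩
    · exact Or.inr (Or.inr ⟨(W.X_ne f g h).1, (W.X_ne f g h).2.1, Or.inl ⟨hx, h⟩⟩)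

theorem rr_arc (s : A ⊕ Bool) (t : B ⊕ Bool) : IsArc (W.RR Γ s t) (W.vS Γ s) (W.vT t) := by
  rcases s with a | k
  · rcases t with b | k
    · have hi : ¬ IsInn (Sum.inl a : A ⊕ Bool) (Sum.inl b : B ⊕ Bool) := by
        rintro ⟨k, h, -⟩; cases h
      have : W.RR Γ (Sum.inl a) (Sum.inl b) = W.O (Sum.inl a) (Sum.inl b) := by
        ext x
        constructor
        · rintro (h | ⟨k, h⟩)
          · exact h.2
          · generalize hf : ((Sum.inl a : A ⊕ Bool), (Sum.inl b : B ⊕ Bool)) = f at h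
            cases h <;> simp [Prod.ext_iff] at hf
        · intro h; exact Or.inl ⟨hi, h⟩
      rw [this]
      have := W.arc _ _ hi
      rwa [W.uS_inl, W.uT_inl] at this
    · have hi : ¬ IsInn (Sum.inl a : A ⊕ Bool) (Sum.inr k : B ⊕ Bool) := by
        rintro ⟨k, h, -⟩; cases h
      let s : {s : A ⊕ Bool // s ≠ Sum.inr k} := ⟨Sum.inl a, by simp⟩
      have : W.RR Γ (Sum.inl a) (Sum.inr k) = W.O (Sum.inl a) (Sum.inr k) ∪ (Γ k).RA s := by
        ext x
        constructor
        · rintro (h | ⟨k', h⟩)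
          · exact Or.inl h.2
          · right
            generalize hf : ((Sum.inl a : A ⊕ Bool), (Sum.inr k : B ⊕ Bool)) = f at h
            cases h with
            | inner h => simp [Prod.ext_iff] at hf
            | bt t h => simp [Prod.ext_iff] at hf
            | atp s' h =>
              simp only [Prod.mk.injEq, Sum.inr.injEq] at hf
              obtain ⟨h1, rfl⟩ := hf
              have : s = s' := Subtype.ext h1
              rw [this]; exact h
        · rintro (h | h)
          · exact Or.inl ⟨hi, h⟩
          · exact Or.inr ⟨k, InD.atp s h⟩
      rw [this]
      have h1 := W.arc _ _ hi
      rw [W.uS_inl] at h1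
      refine h1.trans ((Γ k).RA_arc s).symm ?_
      rintro x ⟨hx, hx'⟩
      rcases W.ball _ _ k x hi hx ((Γ k).RA_ball s hx') with ⟨h, -⟩ | ⟨-, h⟩
      · cases h
      · exact h
  · rcases t with b | k'
    · have hi : ¬ IsInn (Sum.inr k : A ⊕ Bool) (Sum.inl b : B ⊕ Bool) := by
        rintro ⟨k, -, h⟩; cases h
      let t : {t : B ⊕ Bool // t ≠ Sum.inr k} := ⟨Sum.inl b, by simp⟩
      have : W.RR Γ (Sum.inr k) (Sum.inl b) = (Γ k).RB t ∪ W.O (Sum.inr k) (Sum.inl b) := by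
        ext x
        constructor
        · rintro (h | ⟨k', h⟩)
          · exact Or.inr h.2
          · left
            generalize hf : ((Sum.inr k : A ⊕ Bool), (Sum.inl b : B ⊕ Bool)) = f at h
            cases h with
            | inner h => simp [Prod.ext_iff] at hf
            | atp t h => simp [Prod.ext_iff] at hf
            | bt t' h =>
              simp only [Prod.mk.injEq, Sum.inr.injEq] at hf
              obtain ⟨rfl, h1⟩ := hf
              have : t = t' := Subtype.ext h1
              rw [this]; exact h
        · rintro (h | h)
          · exact Or.inr ⟨k, InD.bt t h⟩
          · exact Or.inl ⟨hi, h⟩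
      rw [this]
      have h1 := W.arc _ _ hi
      rw [W.uT_inl] at h1
      refine ((Γ k).RB_arc t).trans h1 ?_
      rintro x ⟨hx', hx⟩
      rcases W.ball _ _ k x hi hx ((Γ k).RB_ball t hx') with ⟨-, h⟩ | ⟨h, -⟩
      · exact h
      · cases h
    · by_cases hk : k = k'
      · subst hk
        have : W.RR Γ (Sum.inr k) (Sum.inr k) = (Γ k).RI := by
          ext x
          constructor
          · rintro (h | ⟨k', h⟩)
            · exact absurd ⟨k, rfl, rfl⟩ h.1
            · generalize hf : ((Sum.inr k : A ⊕ Bool), (Sum.inr k : B ⊕ Bool)) = f at h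
              cases h with
              | inner h =>
                simp only [Prod.mk.injEq, Sum.inr.injEq, and_self] at hf
                subst hf; exact h
              | atp t h =>
                simp only [Prod.mk.injEq, Sum.inr.injEq] at hf
                obtain ⟨h1, rfl⟩ := hf
                exact absurd h1.symm t.2
              | bt t' h =>
                simp only [Prod.mk.injEq, Sum.inr.injEq] at hf
                obtain ⟨rfl, h1⟩ := hf
                exact absurd h1.symm t'.2
          · intro h; exact Or.inr ⟨k, InD.inner h⟩
        rw [this]
        exact (Γ k).RI_arc.symm
      · have hi : ¬ IsInn (Sum.inr k : A ⊕ Bool) (Sum.inr k' : B ⊕ Bool) := by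
          rintro ⟨j, h, h'⟩
          exact hk ((Sum.inr.inj h).trans (Sum.inr.inj h').symm)
        let t : {t : B ⊕ Bool // t ≠ Sum.inr k} :=
          ⟨Sum.inr k', fun h => hk (Sum.inr.inj h).symm⟩
        let s : {s : A ⊕ Bool // s ≠ Sum.inr k'} := ⟨Sum.inr k, fun h => hk (Sum.inr.inj h)⟩
        have : W.RR Γ (Sum.inr k) (Sum.inr k') =
            ((Γ k).RB t ∪ W.O (Sum.inr k) (Sum.inr k')) ∪ (Γ k').RA s := by
          ext x
          constructor
          · rintro (h | ⟨j, h⟩)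
            · exact Or.inl (Or.inr h.2)
            · generalize hf : ((Sum.inr k : A ⊕ Bool), (Sum.inr k' : B ⊕ Bool)) = f at h
              cases h with
              | inner h =>
                simp only [Prod.mk.injEq, Sum.inr.injEq] at hf
                exact absurd (hf.1.trans hf.2.symm) hk
              | atp s' h =>
                simp only [Prod.mk.injEq, Sum.inr.injEq] at hf
                obtain ⟨h1, rfl⟩ := hf
                right
                have : s = s' := Subtype.ext h1
                rw [this]; exact h
              | bt t' h =>
                simp only [Prod.mk.injEq, Sum.inr.injEq] at hf
                obtain ⟨rfl, h1⟩ := hf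
                left; left
                have : t = t' := Subtype.ext h1
                rw [this]; exact h
          · rintro ((h | h) | h)
            · exact Or.inr ⟨k, InD.bt t h⟩
            · exact Or.inl ⟨hi, h⟩
            · exact Or.inr ⟨k', InD.atp s h⟩
        rw [this]
        have h1 := W.arc _ _ hi
        refine (((Γ k).RB_arc t).trans h1 ?_).trans ((Γ k').RA_arc s).symm ?_
        · rintro x ⟨hx', hx⟩
          rcases W.ball _ _ k x hi hx ((Γ k).RB_ball t hx') with ⟨-, h⟩ | ⟨h, -⟩
          · exact h
          · exact absurd (Sum.inr.inj h).symm hk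
        · rintro x ⟨hx | hx, hx'⟩
          · exact absurd (W.disj k k' x ((Γ k).RB_ball t hx) ((Γ k').RA_ball s hx')) hk
          · rcases W.ball _ _ k' x hi hx ((Γ k').RA_ball s hx') with ⟨h, -⟩ | ⟨-, h⟩
            · exact absurd (Sum.inr.inj h) hk
            · exact h

theorem z'_ball (k : Bool) : (Γ k).z' ∈ Metric.closedBall (W.c k) (W.r k) :=
  Metric.ball_subset_closedBall ((Γ k).RI_ball (Γ k).RI_arc.right_mem)

theorem loc_sub {k : Bool} {f g : (A ⊕ Bool) × (B ⊕ Bool)} (h : Loc L k f g) {x y : ℂ}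
    (hx : x ∈ W.RR Γ f.1 f.2) (hx' : x ∈ W.RR Γ g.1 g.2)
    (hy : y ∈ W.RR Γ f.1 f.2) (hy' : y ∈ W.RR Γ g.1 g.2)
    (hxb : x ∈ Metric.closedBall (W.c k) (W.r k))
    (hyb : y ∈ Metric.closedBall (W.c k) (W.r k)) : x = y := by
  obtain ⟨s, t, rfl, rfl, -⟩ := h
  have key1 : ∀ x, x ∈ W.RR Γ s.1 (Sum.inr k) → x ∈ Metric.closedBall (W.c k) (W.r k) →
      x ∈ (Γ k).RA s := by
    intro x hx hxb
    have h := W.rr_ball Γ hx hxb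
    generalize hf : (s.1, (Sum.inr k : B ⊕ Bool)) = f at h
    cases h with
    | inner h => exact absurd (Prod.ext_iff.1 hf).1 s.2
    | atp s' h => rw [Subtype.ext (Prod.ext_iff.1 hf).1]; exact h
    | bt t' h => exact absurd (Prod.ext_iff.1 hf).1 s.2
  have key2 : ∀ x, x ∈ W.RR Γ (Sum.inr k) t.1 → x ∈ Metric.closedBall (W.c k) (W.r k) →
      x ∈ (Γ k).RB t := by
    intro x hx hxb
    have h := W.rr_ball Γ hx hxb
    generalize hf : ((Sum.inr k : A ⊕ Bool), t.1) = f at h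
    cases h with
    | inner h => exact absurd (Prod.ext_iff.1 hf).2 t.2
    | atp s' h => exact absurd (Prod.ext_iff.1 hf).2 t.2
    | bt t' h => rw [Subtype.ext (Prod.ext_iff.1 hf).2]; exact h
  exact (Γ k).RA_RB_sub s t ⟨key1 x hx hxb, key2 x hx' hxb⟩ ⟨key1 y hy hyb, key2 y hy' hyb⟩

/-- No double crossing of the two copies of the middle edge. -/
def NoDouble (L : ∀ k : Bool, {s : A ⊕ Bool // s ≠ Sum.inr k} →
    {t : B ⊕ Bool // t ≠ Sum.inr k} → Prop) : Prop :=
  ∀ k k' f g, k ≠ k' → Loc L k f g → ¬ Loc L k' g f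

theorem once_aux (hno : NoDouble L) {f g : (A ⊕ Bool) × (B ⊕ Bool)} (h1 : f.1 ≠ g.1)
    (h2 : f.2 ≠ g.2) : (W.RR Γ f.1 f.2 ∩ W.RR Γ g.1 g.2).Subsingleton := by
  have hfg : f ≠ g := fun h => h1 (by rw [h])
  rintro x ⟨hx, hx'⟩ y ⟨hy, hy'⟩
  have loc2 : ∀ k k', Loc L k f g → Loc L k' f g → k = k' := by
    rintro k k' ⟨s, t, h1, -⟩ ⟨s', t', h1', -⟩
    rw [h1] at h1'
    exact Sum.inr.inj (Prod.ext_iff.1 h1').2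
  have loc2' : ∀ k k', Loc L k g f → Loc L k' g f → k = k' := by
    rintro k k' ⟨s, t, h1, -⟩ ⟨s', t', h1', -⟩
    rw [h1] at h1'
    exact Sum.inr.inj (Prod.ext_iff.1 h1').2
  have nomix : ∀ k k', Loc L k f g → Loc L k' g f → False := by
    intro k k' hk hk'
    by_cases hkk : k = k'
    · subst hkk
      obtain ⟨s, t, a1, a2, -⟩ := hk
      obtain ⟨s', t', a1', a2', -⟩ := hk'
      rw [a1] at a2'
      exact s.2 (Prod.ext_iff.1 a2').1
    · exact hno k k' f g hkk hk hk'
  have noX : X f g → ∀ k, ¬ Loc L k f g ∧ ¬ Loc L k g f := by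
    intro hX k
    exact ⟨fun h => (W.X_ne f g hX).2.2 k (loc_ne h).2.2,
      fun h => (W.X_ne f g hX).2.2 k (loc_ne h).2.2.symm⟩
  rcases W.master Γ hfg hx hx' with h | h | ⟨-, -, ⟨hxb, hX⟩ | ⟨k, hk, hkl⟩⟩
  · exact absurd h.1 h1
  · exact absurd h.1 h2
  · rcases W.master Γ hfg hy hy' with h | h | ⟨-, -, ⟨hyb, -⟩ | ⟨k, hk, hkl⟩⟩
    · exact absurd h.1 h1
    · exact absurd h.1 h2
    · have f1 := W.rr_out Γ hx hxb
      have g1 := W.rr_out Γ hx' hxb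
      exact W.once f g f1.1 g1.1 hX ⟨f1.2, g1.2⟩ ⟨(W.rr_out Γ hy hyb).2, (W.rr_out Γ hy' hyb).2⟩
    · rcases hkl with h | h
      · exact absurd h (noX hX k).1
      · exact absurd h (noX hX k).2
  · rcases W.master Γ hfg hy hy' with h | h | ⟨-, -, ⟨hyb, hX⟩ | ⟨k', hk', hkl'⟩⟩
    · exact absurd h.1 h1
    · exact absurd h.1 h2
    · rcases hkl with h | h
      · exact absurd h (noX hX k).1
      · exact absurd h (noX hX k).2
    · rcases hkl with h | h <;> rcases hkl' with h' | h'
      · have := loc2 k k' h h'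
        subst this
        exact W.loc_sub Γ h hx hx' hy hy' hk hk'
      · exact (nomix _ _ h h').elim
      · exact (nomix _ _ h' h).elim
      · have := loc2' k k' h h'
        subst this
        exact W.loc_sub Γ h hx' hx hy' hy hk hk'

/-- The assembled drawing. -/
def toBip (hno : NoDouble L) : BipSys (A ⊕ Bool) (B ⊕ Bool) where
  pS := W.vS Γ
  pT := W.vT
  R := W.RR Γ
  pS_inj := by
    rintro (a | k) (a' | k') h
    · rw [W.PA_inj h]
    · have h : W.PA a = (Γ k').z' := h
      exact absurd (by rw [h]; exact W.z'_ball Γ k') (W.PA_out a k')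
    · have h : (Γ k).z' = W.PA a' := h
      exact absurd (by rw [← h]; exact W.z'_ball Γ k) (W.PA_out a' k)
    · have h : (Γ k).z' = (Γ k').z' := h
      rw [W.disj k k' _ (W.z'_ball Γ k) (h ▸ W.z'_ball Γ k')]
  pT_inj := by
    rintro (a | k) (a' | k') h
    · rw [W.PB_inj h]
    · have h : W.PB a = W.c k' := h
      exact absurd (by rw [h]; exact W.c_ball k') (W.PB_out a k')
    · have h : W.c k = W.PB a' := h
      exact absurd (by rw [← h]; exact W.c_ball k) (W.PB_out a' k)
    · have h : W.c k = W.c k' := h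
      rw [W.disj k k' _ (W.c_ball k) (by rw [h]; exact W.c_ball k')]
  pST := by
    intro s t
    exact (W.rr_arc Γ s t).ne
  arc := W.rr_arc Γ
  avoidS := by
    intro s t s' h
    rcases s' with a | k
    · obtain ⟨h1, h2⟩ := W.rr_out Γ h (W.PA_out a)
      exact W.avoidA a s t h1 h2
    · have h3 := W.rr_ball Γ h (W.z'_ball Γ k)
      have h3 : InD W Γ k (Γ k).z' (s, t) := h3
      generalize hf : (s, t) = f at h3
      cases h3 with
      | inner _ => exact (Prod.ext_iff.1 hf).1.symm
      | bt _ _ => exact (Prod.ext_iff.1 hf).1.symm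
      | atp s' h3 => exact absurd h3 ((Γ k).z'_RA s')
  avoidT := by
    intro s t t' h
    rcases t' with b | k
    · obtain ⟨h1, h2⟩ := W.rr_out Γ h (W.PB_out b)
      exact W.avoidB b s t h1 h2
    · have h3 := W.rr_ball Γ h (W.c_ball k)
      have h3 : InD W Γ k (W.c k) (s, t) := h3
      generalize hf : (s, t) = f at h3
      cases h3 with
      | inner _ => exact (Prod.ext_iff.1 hf).2.symm
      | atp _ _ => exact (Prod.ext_iff.1 hf).2.symm
      | bt t' h3 => exact absurd h3 ((Γ k).c_RB t')
  sameS := by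
    rintro s t t' htt x ⟨hx, hx'⟩
    rcases W.master Γ (f := (s, t)) (g := (s, t')) (fun h => htt (Prod.ext_iff.1 h).2) hx hx' with
      h | h | h
    · exact h.2
    · exact absurd h.1 htt
    · exact absurd rfl h.1
  sameT := by
    rintro s s' t hss x ⟨hx, hx'⟩
    rcases W.master Γ (f := (s, t)) (g := (s', t)) (fun h => hss (Prod.ext_iff.1 h).1) hx hx' with
      h | h | h
    · exact absurd h.1 hss
    · exact h.2
    · exact absurd rfl h.2.1
  once := fun s t s' t' hs ht => W.once_aux Γ hno (f := (s, t)) (g := (s', t')) hs ht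
  triple := by
    intro f g h hfg hfh hgh x hf hg hh
    rcases W.master Γ hfg hf hg with h1 | h1 | ⟨-, -, h1⟩
    · exact Or.inl ⟨_, h1.2⟩
    · exact Or.inr ⟨_, h1.2⟩
    rcases W.master Γ hfh hf hh with h2 | h2 | ⟨-, -, h2⟩
    · exact Or.inl ⟨_, h2.2⟩
    · exact Or.inr ⟨_, h2.2⟩
    rcases W.master Γ hgh hg hh with h3 | h3 | ⟨-, -, h3⟩
    · exact Or.inl ⟨_, h3.2⟩
    · exact Or.inr ⟨_, h3.2⟩
    by_cases hx : ∃ k, x ∈ Metric.closedBall (W.c k) (W.r k)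
    · exfalso
      obtain ⟨k, hk⟩ := hx
      have fin : ∀ f g, (((∀ k, x ∉ Metric.closedBall (W.c k) (W.r k)) ∧ X f g) ∨
          ∃ k, x ∈ Metric.closedBall (W.c k) (W.r k) ∧ (Loc L k f g ∨ Loc L k g f)) →
          Loc L k f g ∨ Loc L k g f := by
        rintro f g (h | ⟨k', hk', h⟩)
        · exact absurd hk (h.1 k)
        · rw [W.disj k k' x hk hk']; exact h
      have inc : ∀ f g h, Loc L k f g → Loc L k f h → (Loc L k g h ∨ Loc L k h g) → False := by
        rintro f g h ⟨s, t, a1, a2, -⟩ ⟨s', t', b1, b2, -⟩ (⟨s'', t'', c1, c2, -⟩ | ⟨s'', t'', c1, c2, -⟩)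
        · rw [a2] at c1; exact s''.2 (Prod.ext_iff.1 c1).1.symm
        · rw [b2] at c1; exact s''.2 (Prod.ext_iff.1 c1).1.symm
      have mid : ∀ f g h, Loc L k f g → ¬ Loc L k g h := by
        rintro f g h ⟨s, t, a1, a2, -⟩ ⟨s'', t'', c1, c2, -⟩
        rw [a2] at c1; exact s''.2 (Prod.ext_iff.1 c1).1.symm
      rcases fin _ _ h1 with e1 | e1 <;> rcases fin _ _ h2 with e2 | e2 <;>
        rcases fin _ _ h3 with e3 | e3
      · exact mid _ _ _ e1 e3
      · exact mid _ _ _ e2 e3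
      · exact mid _ _ _ e1 e3
      · exact mid _ _ _ e2 e1
      · exact mid _ _ _ e1 e2
      · exact mid _ _ _ e1 e2
      · exact mid _ _ _ e3 e2
      · exact mid _ _ _ e3 e1
    · push Not at hx
      have a1 := W.rr_out Γ hf hx
      have a2 := W.rr_out Γ hg hx
      have a3 := W.rr_out Γ hh hx
      rcases W.triple f g h a1.1 a2.1 a3.1 hfg hfh hgh x a1.2 a2.2 a3.2 with ⟨a, ha⟩ | ⟨b, hb⟩
      · exact Or.inl ⟨Sum.inl a, ha⟩
      · exact Or.inr ⟨Sum.inl b, hb⟩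

theorem toBip_X (hno : NoDouble L) {f g : (A ⊕ Bool) × (B ⊕ Bool)} (h : (W.toBip Γ hno).X f g) :
    X f g ∨ ∃ k, Loc L k f g ∨ Loc L k g f := by
  obtain ⟨h1, h2, x, hx, hx'⟩ := h
  rcases W.master Γ (fun h => h1 (by rw [h])) hx hx' with h | h | ⟨-, -, ⟨-, h⟩ | ⟨k, -, h⟩⟩
  · exact absurd h.1 h1
  · exact absurd h.1 h2
  · exact Or.inl h
  · exact Or.inr ⟨k, h⟩

end Opn



/-! ### The two labellings of the threads -/

/-- the angle of a point -/
noncomputable def angl (c d z : ℂ) : ℝ := Complex.arg ((z - c) / d)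

theorem angl_InR (c d z : ℂ) : InR (angl c d z) :=
  ⟨Complex.neg_pi_lt_arg _, Complex.arg_le_pi _⟩

theorem pol_angl {c d z : ℂ} (hd : d ≠ 0) (hz : Dist.dist z c = ‖d‖) : pol c d 1 (angl c d z) = z := by
  have h1 : ‖(z - c) / d‖ = 1 := by
    rw [norm_div, ← dist_eq_norm, hz, div_self (norm_ne_zero_iff.2 hd)]
  have h2 := Complex.norm_mul_exp_arg_mul_I ((z - c) / d)
  rw [h1] at h2
  unfold pol angl
  simp only [Complex.ofReal_one, one_mul] at h2 ⊢
  rw [h2]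
  field_simp
  ring

/-- `z` and `z'` are adjacent as seen from `o` -/
def AdjAng (o z z' : ℝ) : Prop := (o < z ↔ o < z') ∧ (z < o ↔ z' < o)

theorem AdjAng.symm {o z z' : ℝ} (h : AdjAng o z z') : AdjAng o z' z := ⟨h.1.symm, h.2.symm⟩

/-- Two opened drawings which differ by exchanging the names of the two threads. -/
structure OpnPair (A B : Type*) (X : (A ⊕ Bool) × (B ⊕ Bool) → (A ⊕ Bool) × (B ⊕ Bool) → Prop) where
  W : Bool → Opn A B X
  d : Bool → ℂ
  c_eq : (W true).c = (W false).c
  r_eq : (W true).r = (W false).r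
  d_norm : ∀ k, ‖d k‖ = (W false).r k
  uS_eq : ∀ k b, (W true).uS (Sum.inr k) (Sum.inl b) = (W false).uS (Sum.inr k) (Sum.inl b)
  uT_eq : ∀ k a, (W true).uT (Sum.inl a) (Sum.inr k) = (W false).uT (Sum.inl a) (Sum.inr k)
  swS : ∀ k, (W true).uS (Sum.inr k) (Sum.inr !k) = (W false).uT (Sum.inr !k) (Sum.inr k)
  swT : ∀ k, (W true).uT (Sum.inr !k) (Sum.inr k) = (W false).uS (Sum.inr k) (Sum.inr !k)
  adjS : ∀ k b, AdjAng (angl ((W false).c k) (d k) ((W false).uS (Sum.inr k) (Sum.inl b)))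
    (angl ((W false).c k) (d k) ((W false).uS (Sum.inr k) (Sum.inr !k)))
    (angl ((W false).c k) (d k) ((W false).uT (Sum.inr !k) (Sum.inr k)))
  adjT : ∀ k a, AdjAng (angl ((W false).c k) (d k) ((W false).uT (Sum.inl a) (Sum.inr k)))
    (angl ((W false).c k) (d k) ((W false).uS (Sum.inr k) (Sum.inr !k)))
    (angl ((W false).c k) (d k) ((W false).uT (Sum.inr !k) (Sum.inr k)))

namespace Opn

variable {A B : Type*} {X : (A ⊕ Bool) × (B ⊕ Bool) → (A ⊕ Bool) × (B ⊕ Bool) → Prop}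
  (W : Opn A B X)

theorem al_sphere (k : Bool) (s : {s : A ⊕ Bool // s ≠ Sum.inr k}) :
    Dist.dist (W.al k s) (W.c k) = W.r k := W.uT_sphere k s s.2

theorem be_sphere (k : Bool) (t : {t : B ⊕ Bool // t ≠ Sum.inr k}) :
    Dist.dist (W.be k t) (W.c k) = W.r k := W.uS_sphere k t t.2

theorem end_ne {k : Bool} {f g : (A ⊕ Bool) × (B ⊕ Bool)} (hf : ¬ IsInn f.1 f.2)
    (hg : ¬ IsInn g.1 g.2) (hfg : f ≠ g) (hkf : Inc k f) (hkg : Inc k g) {x : ℂ}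
    (hx : Dist.dist x (W.c k) = W.r k) (h1 : x ∈ W.O f.1 f.2) (h2 : x ∈ W.O g.1 g.2) : False := by
  have hb : x ∈ Metric.closedBall (W.c k) (W.r k) := Metric.mem_closedBall.2 hx.le
  rcases W.cross f g hf hg hfg x h1 h2 with ⟨a, -, -, rfl⟩ | ⟨b, -, -, rfl⟩ | h
  · exact W.PA_out a k hb
  · exact W.PB_out b k hb
  · exact (W.X_ne f g h).2.2 k ⟨hkf, hkg⟩

theorem notInn_al {k : Bool} (s : {s : A ⊕ Bool // s ≠ Sum.inr k}) :
    ¬ IsInn s.1 (Sum.inr k : B ⊕ Bool) := by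
  rintro ⟨j, h, h'⟩
  exact s.2 (by rw [h, ← Sum.inr.inj h'])

theorem notInn_be {k : Bool} (t : {t : B ⊕ Bool // t ≠ Sum.inr k}) :
    ¬ IsInn (Sum.inr k : A ⊕ Bool) t.1 := by
  rintro ⟨j, h, h'⟩
  exact t.2 (by rw [h', ← Sum.inr.inj h])

theorem al_inj (k : Bool) : Function.Injective (W.al k) := by
  intro s s' h
  by_contra hne
  refine W.end_ne (k := k) (f := (s.1, Sum.inr k)) (g := (s'.1, Sum.inr k)) (notInn_al s)
    (notInn_al s') (fun h => hne (Subtype.ext (Prod.ext_iff.1 h).1)) (Or.inr rfl) (Or.inr rfl)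
    (W.al_sphere k s) (W.arc _ _ (notInn_al s)).right_mem ?_
  rw [h]; exact (W.arc _ _ (notInn_al s')).right_mem

theorem be_inj (k : Bool) : Function.Injective (W.be k) := by
  intro s s' h
  by_contra hne
  refine W.end_ne (k := k) (f := (Sum.inr k, s.1)) (g := (Sum.inr k, s'.1)) (notInn_be s)
    (notInn_be s') (fun h => hne (Subtype.ext (Prod.ext_iff.1 h).2)) (Or.inl rfl) (Or.inl rfl)
    (W.be_sphere k s) (W.arc _ _ (notInn_be s)).left_mem ?_
  rw [h]; exact (W.arc _ _ (notInn_be s')).left_mem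

theorem be_ne_al (k : Bool) (s : {s : A ⊕ Bool // s ≠ Sum.inr k})
    (t : {t : B ⊕ Bool // t ≠ Sum.inr k}) : W.be k t ≠ W.al k s := by
  intro h
  refine W.end_ne (k := k) (f := (Sum.inr k, t.1)) (g := (s.1, Sum.inr k)) (notInn_be t)
    (notInn_al s) (fun h => s.2 (Prod.ext_iff.1 h).1.symm) (Or.inl rfl) (Or.inr rfl)
    (W.be_sphere k t) (W.arc _ _ (notInn_be t)).left_mem ?_
  rw [h]; exact (W.arc _ _ (notInn_al s)).right_mem

end Opn

namespace OpnPair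
variable {A B : Type*} {X : (A ⊕ Bool) × (B ⊕ Bool) → (A ⊕ Bool) × (B ⊕ Bool) → Prop}
  (P : OpnPair A B X)

/-- A-type angles -/
noncomputable def aa (σ k : Bool) (s : {s : A ⊕ Bool // s ≠ Sum.inr k}) : ℝ :=
  angl ((P.W false).c k) (P.d k) ((P.W σ).al k s)

/-- B-type angles -/
noncomputable def bb (σ k : Bool) (t : {t : B ⊕ Bool // t ≠ Sum.inr k}) : ℝ :=
  angl ((P.W false).c k) (P.d k) ((P.W σ).be k t)

theorem c_eq' (σ : Bool) : (P.W σ).c = (P.W false).c := by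
  cases σ; rfl; exact P.c_eq

theorem r_eq' (σ : Bool) : (P.W σ).r = (P.W false).r := by
  cases σ; rfl; exact P.r_eq

theorem d_ne (k : Bool) : P.d k ≠ 0 := by
  rw [← norm_pos_iff, P.d_norm]; exact (P.W false).r_pos k

theorem pol_aa (σ k : Bool) (s) : pol ((P.W σ).c k) (P.d k) 1 (P.aa σ k s) = (P.W σ).al k s := by
  rw [aa, ← P.c_eq' σ]
  apply pol_angl (P.d_ne k)
  rw [P.d_norm, ← P.r_eq' σ]
  exact (P.W σ).al_sphere k s

theorem pol_bb (σ k : Bool) (s) : pol ((P.W σ).c k) (P.d k) 1 (P.bb σ k s) = (P.W σ).be k s := by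
  rw [bb, ← P.c_eq' σ]
  apply pol_angl (P.d_ne k)
  rw [P.d_norm, ← P.r_eq' σ]
  exact (P.W σ).be_sphere k s

theorem aa_InR (σ k : Bool) (s) : InR (P.aa σ k s) := angl_InR _ _ _
theorem bb_InR (σ k : Bool) (s) : InR (P.bb σ k s) := angl_InR _ _ _

theorem aa_inj (σ k : Bool) : Function.Injective (P.aa σ k) := by
  intro s s' h
  apply (P.W σ).al_inj k
  rw [← P.pol_aa, ← P.pol_aa, h]

theorem bb_inj (σ k : Bool) : Function.Injective (P.bb σ k) := by
  intro s s' h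
  apply (P.W σ).be_inj k
  rw [← P.pol_bb, ← P.pol_bb, h]

theorem bb_ne_aa (σ k : Bool) (s t) : P.bb σ k t ≠ P.aa σ k s := by
  intro h
  apply (P.W σ).be_ne_al k s t
  rw [← P.pol_bb, ← P.pol_aa, h]

variable [Fintype B]

open Classical in
/-- the local crossing predicate -/
def LL (σ : Bool) (h : ℕ) (w : ∀ k : Bool, {t : B ⊕ Bool // t ≠ Sum.inr k}) (k : Bool)
    (s : {s : A ⊕ Bool // s ≠ Sum.inr k}) (t : {t : B ⊕ Bool // t ≠ Sum.inr k}) : Prop :=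
  Lc (P.bb σ k) h (w k) (P.aa σ k s) t

theorem bip_of_noDouble (σ : Bool) (h : ℕ) (w : ∀ k : Bool, {t : B ⊕ Bool // t ≠ Sum.inr k})
    (hno : Opn.NoDouble (P.LL σ h w)) :
    ∃ Bp : BipSys (A ⊕ Bool) (B ⊕ Bool), ∀ f g, Bp.X f g →
      X f g ∨ ∃ k, Opn.Loc (P.LL σ h w) k f g ∨ Opn.Loc (P.LL σ h w) k g f := by
  classical
  have hg : ∀ k, Nonempty (Gadget ((P.W σ).c k) ((P.W σ).r k) ((P.W σ).al k) ((P.W σ).be k)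
      (P.LL σ h w k)) := by
    intro k
    have := exists_gadget (c := (P.W σ).c k) (P.d_ne k) (P.aa σ k) (P.bb σ k) (P.aa_InR σ k)
      (P.bb_InR σ k) (P.aa_inj σ k) (P.bb_inj σ k) (P.bb_ne_aa σ k) (w k) h
    rw [P.d_norm, ← P.r_eq' σ] at this
    simp only [pol_aa, pol_bb] at this
    exact this
  let Γ := fun k => (hg k).some
  exact ⟨(P.W σ).toBip Γ hno, fun f g h => (P.W σ).toBip_X Γ hno h⟩

/-- the thread as an A-type end -/
def eS (A : Type*) (k : Bool) : {s : A ⊕ Bool // s ≠ Sum.inr k} :=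
  ⟨Sum.inr !k, fun h => by simpa using Sum.inr.inj h⟩

theorem eS_cases {k : Bool} (s : {s : A ⊕ Bool // s ≠ Sum.inr k}) :
    s = eS A k ∨ ∃ a, s = ⟨Sum.inl a, by simp⟩ := by
  obtain ⟨a | j, h⟩ := s
  · exact Or.inr ⟨a, rfl⟩
  · left
    apply Subtype.ext
    have : j ≠ k := fun e => h (by rw [e])
    show Sum.inr j = Sum.inr !k
    rw [Bool.eq_not.2 this]

theorem double_loc {L : ∀ k : Bool, {s : A ⊕ Bool // s ≠ Sum.inr k} →
    {t : B ⊕ Bool // t ≠ Sum.inr k} → Prop} {k k' : Bool} {f g : (A ⊕ Bool) × (B ⊕ Bool)}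
    (h1 : Opn.Loc L k f g) (h2 : Opn.Loc L k' g f) (hk : k ≠ k') :
    ∀ j, L j (eS A j) (eS B j) := by
  obtain ⟨s, t, a1, a2, a3⟩ := h1
  obtain ⟨s', t', b1, b2, b3⟩ := h2
  have e1 : s = eS A k := by
    rcases eS_cases s with h | ⟨a, rfl⟩
    · exact h
    · rw [a1] at b2; exact absurd (Prod.ext_iff.1 b2).1 (by simp)
  have e2 : t = eS B k := by
    rcases eS_cases t with h | ⟨a, rfl⟩
    · exact h
    · rw [a2] at b1; exact absurd (Prod.ext_iff.1 b1).2 (by simp)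
  have e3 : s' = eS A k' := by
    rcases eS_cases s' with h | ⟨a, rfl⟩
    · exact h
    · rw [a2] at b1; exact absurd (Prod.ext_iff.1 b1).1 (by simp)
  have e4 : t' = eS B k' := by
    rcases eS_cases t' with h | ⟨a, rfl⟩
    · exact h
    · rw [a1] at b2; exact absurd (Prod.ext_iff.1 b2).2 (by simp)
  intro j
  by_cases hj : j = k
  · subst hj; rw [← e1, ← e2]; exact a3
  · have : j = k' := by
      cases j <;> cases k <;> cases k' <;> simp_all
    subst this; rw [← e3, ← e4]; exact b3

theorem main_gamma (h : ℕ) (w : ∀ k : Bool, {t : B ⊕ Bool // t ≠ Sum.inr k}) :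
    ∃ Bp : BipSys (A ⊕ Bool) (B ⊕ Bool), ∀ f g, Bp.X f g →
      X f g ∨ ∃ k, Opn.Loc (P.LL false h w) k f g ∨ Opn.Loc (P.LL false h w) k g f := by
  classical
  by_cases hno : Opn.NoDouble (P.LL false h w)
  · exact P.bip_of_noDouble false h w hno
  have hL : ∀ j, P.LL false h w j (eS A j) (eS B j) := by
    unfold Opn.NoDouble at hno
    push Not at hno
    obtain ⟨k, k', f, g, hk, h1, h2⟩ := hno
    exact double_loc h1 h2 hk
  have e1 : ∀ k, P.bb true k (eS B k) = P.aa false k (eS A k) := by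
    intro k; unfold bb aa; congr 1; exact P.swS k
  have e2 : ∀ k, P.aa true k (eS A k) = P.bb false k (eS B k) := by
    intro k; unfold bb aa; congr 1; exact P.swT k
  have hoth : ∀ k u, u ≠ eS B k → P.bb true k u = P.bb false k u := by
    intro k u hu
    rcases eS_cases u with h | ⟨b, rfl⟩
    · exact absurd h hu
    · unfold bb; congr 1; exact P.uS_eq k b
  have hadj : ∀ k u, u ≠ eS B k → AdjAng (P.bb false k u) (P.bb false k (eS B k))
      (P.aa false k (eS A k)) := by
    intro k u hu
    rcases eS_cases u with h | ⟨b, rfl⟩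
    · exact absurd h hu
    · exact P.adjS k b
  have sw : ∀ k, ¬ P.LL true h w k (eS A k) (eS B k) ∧
      ∀ u, u ≠ eS B k → P.LL true h w k (eS A k) u → P.LL false h w k (eS A k) u := by
    intro k
    have := swap_L (P.bb_inj false k) (P.bb_inj true k) rfl (e1 k) (P.bb_ne_aa false k _ _)
      (hoth k) (hadj k) (hL k)
    unfold LL
    rw [e2]
    exact this
  have imp : ∀ k s t, P.LL true h w k s t → P.LL false h w k s t := by
    intro k s t hst
    rcases eS_cases s with rfl | ⟨a, rfl⟩
    · by_cases ht : t = eS B k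
      · subst ht; exact absurd hst (sw k).1
      · exact (sw k).2 t ht hst
    · have ea : P.aa true k ⟨Sum.inl a, by simp⟩ = P.aa false k ⟨Sum.inl a, by simp⟩ := by
        unfold aa; congr 1; exact P.uT_eq k a
      have r1 := fun u => swap_rk rfl (e1 k) (hoth k) (hadj k) (w k) u
      have r2 := swap_other rfl (e1 k) (hoth k) (hadj k)
        (x := P.aa false k ⟨Sum.inl a, by simp⟩) (P.adjT k a) (w k)
      unfold LL Lc at hst ⊢
      rw [ea, ← r1, ← r2] at hst
      exact hst
  have impL : ∀ k f g, Opn.Loc (P.LL true h w) k f g → Opn.Loc (P.LL false h w) k f g := by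
    rintro k f g ⟨s, t, a1, a2, a3⟩
    exact ⟨s, t, a1, a2, imp k s t a3⟩
  have hno' : Opn.NoDouble (P.LL true h w) := by
    intro k k' f g hk h1 h2
    exact (sw true).1 (double_loc h1 h2 hk true)
  obtain ⟨Bp, hB⟩ := P.bip_of_noDouble true h w hno'
  refine ⟨Bp, fun f g hf => ?_⟩
  rcases hB f g hf with h | ⟨k, h | h⟩
  · exact Or.inl h
  · exact Or.inr ⟨k, Or.inl (impL _ _ _ h)⟩
  · exact Or.inr ⟨k, Or.inr (impL _ _ _ h)⟩

end OpnPair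



/-! ### Opening the two discs -/

/-- the two copies of the middle edge -/
def Thr {A B : Type*} (f : (A ⊕ Bool) × (B ⊕ Bool)) : Prop := ∃ k, f = (Sum.inr k, Sum.inr !k)

/-- A good drawing of the complete 4-partite graph, with the middle edge listed twice. -/
structure QD (A B : Type*) (X : (A ⊕ Bool) × (B ⊕ Bool) → (A ⊕ Bool) × (B ⊕ Bool) → Prop) where
  z : Bool → ℂ
  PA : A → ℂ
  PB : B → ℂ
  C : A ⊕ Bool → B ⊕ Bool → Set ℂ
  C_symm : ∀ k, C (Sum.inr k) (Sum.inr !k) = C (Sum.inr false) (Sum.inr true)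
  z_ne : z false ≠ z true
  PA_inj : Function.Injective PA
  PB_inj : Function.Injective PB
  PAB : ∀ a b, PA a ≠ PB b
  PAz : ∀ a k, PA a ≠ z k
  PBz : ∀ b k, PB b ≠ z k
  arc : ∀ s t, ¬ IsInn s t → IsArc (C s t) (Sum.elim PA z s) (Sum.elim PB z t)
  avoidA : ∀ a s t, ¬ IsInn s t → PA a ∈ C s t → Sum.inl a = s
  avoidB : ∀ b s t, ¬ IsInn s t → PB b ∈ C s t → Sum.inl b = t
  avoidz : ∀ k s t, ¬ IsInn s t → z k ∈ C s t → Inc k (s, t)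
  cross : ∀ f g : (A ⊕ Bool) × (B ⊕ Bool), ¬ IsInn f.1 f.2 → ¬ IsInn g.1 g.2 → f ≠ g →
    ¬ (Thr f ∧ Thr g) → ∀ x, x ∈ C f.1 f.2 → x ∈ C g.1 g.2 →
    (∃ a, f.1 = Sum.inl a ∧ g.1 = Sum.inl a ∧ x = PA a) ∨
    (∃ b, f.2 = Sum.inl b ∧ g.2 = Sum.inl b ∧ x = PB b) ∨ (∃ k, x = z k) ∨ X f g
  X_ne : ∀ f g, X f g → f.1 ≠ g.1 ∧ f.2 ≠ g.2 ∧ ∀ k, ¬ (Inc k f ∧ Inc k g)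
  once : ∀ f g : (A ⊕ Bool) × (B ⊕ Bool), ¬ IsInn f.1 f.2 → ¬ IsInn g.1 g.2 → X f g →
    (C f.1 f.2 ∩ C g.1 g.2).Subsingleton
  triple : ∀ f g h : (A ⊕ Bool) × (B ⊕ Bool), ¬ IsInn f.1 f.2 → ¬ IsInn g.1 g.2 → ¬ IsInn h.1 h.2 →
    f ≠ g → f ≠ h → g ≠ h → ¬ (Thr f ∧ Thr g) → ¬ (Thr f ∧ Thr h) → ¬ (Thr g ∧ Thr h) →
    ∀ x, x ∈ C f.1 f.2 → x ∈ C g.1 g.2 → x ∈ C h.1 h.2 →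
    (∃ a, x = PA a) ∨ (∃ b, x = PB b) ∨ ∃ k, x = z k

namespace QD
variable {A B : Type*} {X : (A ⊕ Bool) × (B ⊕ Bool) → (A ⊕ Bool) × (B ⊕ Bool) → Prop}
  (Q : QD A B X)

theorem not_inn_thr (k : Bool) : ¬ IsInn (Sum.inr k : A ⊕ Bool) (Sum.inr !k : B ⊕ Bool) := by
  rintro ⟨j, h1, h2⟩
  have h1 := Sum.inr.inj h1
  have h2 := Sum.inr.inj h2
  subst h1; simp at h2

/-- admissible radii -/
structure Rad (r : ℝ) : Prop where
  pos : 0 < r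
  disj : ∀ k k' x, x ∈ Metric.closedBall (Q.z k) r → x ∈ Metric.closedBall (Q.z k') r → k = k'
  PA : ∀ a k, Q.PA a ∉ Metric.closedBall (Q.z k) r
  PB : ∀ b k, Q.PB b ∉ Metric.closedBall (Q.z k) r
  C : ∀ s t k, ¬ IsInn s t → ¬ Inc k (s, t) → Disjoint (Q.C s t) (Metric.closedBall (Q.z k) r)

theorem exists_rad [Finite A] [Finite B] : ∃ r, Q.Rad r := by
  have small : ∀ (k : Bool) (S : Set ℂ), IsClosed S → Q.z k ∉ S →
      ∀ᶠ r in nhdsWithin (0 : ℝ) (Set.Ioi 0), Disjoint S (Metric.closedBall (Q.z k) r) := by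
    intro k S hS hz
    obtain ⟨ε, hε, h⟩ := Metric.isOpen_iff.1 hS.isOpen_compl (Q.z k) hz
    filter_upwards [Ioo_mem_nhdsGT hε] with r hr
    rw [Set.disjoint_left]
    intro x hx hx'
    exact h (Metric.closedBall_subset_ball hr.2 hx') hx
  have hpos : ∀ᶠ r in nhdsWithin (0 : ℝ) (Set.Ioi 0), 0 < r := self_mem_nhdsWithin
  have hd : ∀ᶠ r in nhdsWithin (0 : ℝ) (Set.Ioi 0), r < Dist.dist (Q.z false) (Q.z true) / 2 := by
    have : 0 < Dist.dist (Q.z false) (Q.z true) / 2 := half_pos (dist_pos.2 Q.z_ne)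
    filter_upwards [Ioo_mem_nhdsGT this] with r hr using hr.2
  have hA : ∀ᶠ r in nhdsWithin (0 : ℝ) (Set.Ioi 0), ∀ a k, Disjoint {Q.PA a}
      (Metric.closedBall (Q.z k) r) :=
    Filter.eventually_all.2 fun a => Filter.eventually_all.2 fun k =>
      small k _ isClosed_singleton (fun h => Q.PAz a k h.symm)
  have hB : ∀ᶠ r in nhdsWithin (0 : ℝ) (Set.Ioi 0), ∀ a k, Disjoint {Q.PB a}
      (Metric.closedBall (Q.z k) r) :=
    Filter.eventually_all.2 fun a => Filter.eventually_all.2 fun k =>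
      small k _ isClosed_singleton (fun h => Q.PBz a k h.symm)
  have hC : ∀ᶠ r in nhdsWithin (0 : ℝ) (Set.Ioi 0), ∀ s t k, ¬ IsInn s t → ¬ Inc k (s, t) →
      Disjoint (Q.C s t) (Metric.closedBall (Q.z k) r) := by
    refine Filter.eventually_all.2 fun s => Filter.eventually_all.2 fun t =>
      Filter.eventually_all.2 fun k => ?_
    by_cases h1 : IsInn s t
    · exact Filter.Eventually.of_forall fun r h => absurd h1 h
    by_cases h2 : Inc k (s, t)
    · exact Filter.Eventually.of_forall fun r _ h => absurd h2 h
    filter_upwards [small k _ (Q.arc s t h1).isClosed (fun h => h2 (Q.avoidz k s t h1 h))] with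
      r hr _ _ using hr
  obtain ⟨r, h1, h2, h3, h4, h5⟩ := (hpos.and (hd.and (hA.and (hB.and hC)))).exists
  refine ⟨r, h1, ?_, fun a k h => Set.disjoint_left.1 (h3 a k) rfl h,
    fun a k h => Set.disjoint_left.1 (h4 a k) rfl h, h5⟩
  have key : ∀ x, x ∈ Metric.closedBall (Q.z false) r → x ∉ Metric.closedBall (Q.z true) r := by
    intro x hx hx'
    rw [Metric.mem_closedBall] at hx hx'
    have := dist_triangle_left (Q.z false) (Q.z true) x
    linarith
  rintro (_ | _) (_ | _) x hx hx'
  · rfl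
  · exact absurd hx' (key x hx)
  · exact absurd hx (key x hx')
  · rfl

variable {r : ℝ}

/-- truncated arcs -/
structure Trunc (r : ℝ) (f : (A ⊕ Bool) × (B ⊕ Bool)) (O : Set ℂ) (u v : ℂ) : Prop where
  sub : O ⊆ Q.C f.1 f.2
  arc : IsArc O u v
  inl1 : ∀ a, f.1 = Sum.inl a → u = Q.PA a
  inl2 : ∀ b, f.2 = Sum.inl b → v = Q.PB b
  ball : ∀ k x, x ∈ O → x ∈ Metric.closedBall (Q.z k) r →
    (f.1 = Sum.inr k ∧ x = u) ∨ (f.2 = Sum.inr k ∧ x = v)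
  sph1 : ∀ k, f.1 = Sum.inr k → Dist.dist u (Q.z k) = r
  sph2 : ∀ k, f.2 = Sum.inr k → Dist.dist v (Q.z k) = r

theorem exists_trunc (hr : Q.Rad r) (f : (A ⊕ Bool) × (B ⊕ Bool)) (hi : ¬ IsInn f.1 f.2)
    (ht : ¬ Thr f) : ∃ O u v, Q.Trunc r f O u v := by
  obtain ⟨s, t⟩ := f
  rcases s with a | k <;> rcases t with b | k'
  · refine ⟨Q.C (Sum.inl a) (Sum.inl b), Q.PA a, Q.PB b, subset_rfl, Q.arc _ _ hi, ?_, ?_, ?_, ?_, ?_⟩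
    · rintro a' h; rw [Sum.inl.inj h]
    · rintro a' h; rw [Sum.inl.inj h]
    · intro k x hx hx'
      exact absurd hx' (Set.disjoint_left.1 (hr.C _ _ k hi (by simp [Inc])) hx)
    · rintro k h; cases h
    · rintro k h; cases h
  · have h1 := Q.arc _ _ hi
    have hb : Q.z k' ∈ Metric.closedBall (Q.z k') r := Metric.mem_closedBall_self hr.pos.le
    obtain ⟨u, S, hS, hu, hK, -⟩ := h1.first_hit Metric.isClosed_closedBall (hr.PA a k')
      ⟨_, h1.right_mem, hb⟩
    refine ⟨S, Q.PA a, u, hS, hu, ?_, ?_, ?_, ?_, ?_⟩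
    · rintro a' h; rw [Sum.inl.inj h]
    · rintro b h; cases h
    · intro k x hx hx'
      by_cases hk : k = k'
      · subst hk; exact Or.inr ⟨rfl, sing_eq hK hx hx'⟩
      · exact absurd hx' (Set.disjoint_left.1 (hr.C _ _ k hi (by simp [Inc, Ne.symm hk])) (hS hx))
    · rintro k h; cases h
    · rintro k h
      rw [← Sum.inr.inj h]
      exact hu.mem_sphere hr.pos.ne' hK
  · have h1 := (Q.arc _ _ hi).symm
    have hb : Q.z k ∈ Metric.closedBall (Q.z k) r := Metric.mem_closedBall_self hr.pos.le
    obtain ⟨u, S, hS, hu, hK, -⟩ := h1.first_hit Metric.isClosed_closedBall (hr.PB b k)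
      ⟨_, h1.right_mem, hb⟩
    refine ⟨S, u, Q.PB b, hS, hu.symm, ?_, ?_, ?_, ?_, ?_⟩
    · rintro b h; cases h
    · rintro a' h; rw [Sum.inl.inj h]
    · intro k' x hx hx'
      by_cases hk : k' = k
      · subst hk; exact Or.inl ⟨rfl, sing_eq hK hx hx'⟩
      · exact absurd hx' (Set.disjoint_left.1 (hr.C _ _ k' hi (by simp [Inc, Ne.symm hk])) (hS hx))
    · rintro k h
      rw [← Sum.inr.inj h]
      exact hu.mem_sphere hr.pos.ne' hK
    · rintro k h; cases h
  · exfalso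
    by_cases h : k = k'
    · exact hi ⟨k, rfl, by rw [h]⟩
    · exact ht ⟨k, by rw [Bool.eq_not.2 (Ne.symm h)]⟩

end QD

theorem angl_self {c d : ℂ} (hd : d ≠ 0) : angl c d (c + d) = 0 := by
  unfold angl; simp [hd]

theorem angl_ne_zero {c d z : ℂ} (hd : d ≠ 0) (hz : Dist.dist z c = ‖d‖) (h : z ≠ c + d) :
    angl c d z ≠ 0 := by
  intro h0
  apply h
  rw [← pol_angl hd hz, h0]
  simp [pol]

theorem angl_near {c d : ℂ} (hd : d ≠ 0) {o : ℝ} (ho : o ≠ 0) :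
    ∀ᶠ z in nhds (c + d), AdjAng o (angl c d z) 0 := by
  have hc : Filter.Tendsto (fun z => angl c d z) (nhds (c + d)) (nhds 0) := by
    have h1 : ContinuousAt (fun z : ℂ => (z - c) / d) (c + d) := by fun_prop
    have h2 : ContinuousAt Complex.arg ((c + d - c) / d) := by
      apply Complex.continuousAt_arg
      simp [hd]
    have h3 : ContinuousAt (fun z => angl c d z) (c + d) :=
      ContinuousAt.comp (f := fun z : ℂ => (z - c) / d) (g := Complex.arg) h2 h1
    have := h3.tendsto
    rwa [angl_self hd] at this
  rcases lt_or_gt_of_ne ho with h | h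
  · filter_upwards [hc.eventually (lt_mem_nhds h)] with z hz
    exact ⟨iff_of_true hz h, iff_of_false hz.not_gt h.not_gt⟩
  · filter_upwards [hc.eventually (gt_mem_nhds h)] with z hz
    exact ⟨iff_of_false hz.not_gt h.not_gt, iff_of_true hz h⟩



/-- The data obtained by truncating and doubling. -/
structure OpData {A B : Type*} {X : (A ⊕ Bool) × (B ⊕ Bool) → (A ⊕ Bool) × (B ⊕ Bool) → Prop}
    (Q : QD A B X) where
  r : ℝ
  hr : Q.Rad r
  O0 : (A ⊕ Bool) × (B ⊕ Bool) → Set ℂ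
  u : (A ⊕ Bool) × (B ⊕ Bool) → ℂ
  v : (A ⊕ Bool) × (B ⊕ Bool) → ℂ
  hT : ∀ f, ¬ IsInn f.1 f.2 → ¬ Thr f → Q.Trunc r f (O0 f) (u f) (v f)
  I : Finset (A × B)
  Ω : Set ℂ
  E : Bool → Set ℂ
  en : Bool → Bool → ℂ
  F' : A × B → Set ℂ
  N : A × B → Set ℂ
  hD : Doubled I (fun i => O0 (Sum.inl i.1, Sum.inl i.2)) (fun i => Q.PA i.1) (fun i => Q.PB i.2)
    Ω (Metric.closedBall (Q.z false) r) (Metric.closedBall (Q.z true) r) E (fun j => en j false)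
    (fun j => en j true) F' N
  hΩ : ∀ f, ¬ IsInn f.1 f.2 → ¬ Thr f → (∀ i ∈ I, f ≠ (Sum.inl i.1, Sum.inl i.2)) →
    Disjoint (O0 f) Ω
  hI : ∀ i ∈ I, ∀ k, X (Sum.inl i.1, Sum.inl i.2) (Sum.inr k, Sum.inr !k) ∧
    X (Sum.inr k, Sum.inr !k) (Sum.inl i.1, Sum.inl i.2)
  d : Bool → ℂ
  d_norm : ∀ k, ‖d k‖ = r
  adjS : ∀ k b j, AdjAng (angl (Q.z k) (d k) (u (Sum.inr k, Sum.inl b)))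
    (angl (Q.z k) (d k) (en j k)) 0
  adjT : ∀ k a j, AdjAng (angl (Q.z k) (d k) (v (Sum.inl a, Sum.inr k)))
    (angl (Q.z k) (d k) (en j k)) 0

theorem exists_opData {A B : Type*} [Finite A] [Finite B]
    {X : (A ⊕ Bool) × (B ⊕ Bool) → (A ⊕ Bool) × (B ⊕ Bool) → Prop}
    (Q : QD A B X) : Nonempty (OpData Q) := by
  classical
  have := Fintype.ofFinite A
  have := Fintype.ofFinite B
  obtain ⟨r, hr⟩ := Q.exists_rad
  have hex : ∀ f : (A ⊕ Bool) × (B ⊕ Bool), ∃ O u v, ¬ IsInn f.1 f.2 → ¬ Thr f →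
      Q.Trunc r f O u v := by
    intro f
    by_cases h1 : IsInn f.1 f.2
    · exact ⟨∅, 0, 0, fun h => absurd h1 h⟩
    by_cases h2 : Thr f
    · exact ⟨∅, 0, 0, fun _ h => absurd h2 h⟩
    obtain ⟨O, u, v, h⟩ := Q.exists_trunc hr f h1 h2
    exact ⟨O, u, v, fun _ _ => h⟩
  choose O0 u v hT using hex
  have hdis : Disjoint (Metric.closedBall (Q.z false) r) (Metric.closedBall (Q.z true) r) := by
    rw [Set.disjoint_left]
    intro x hx hx'
    simpa using hr.disj _ _ x hx hx'
  have hie : ¬ IsInn (Sum.inr false : A ⊕ Bool) (Sum.inr true : B ⊕ Bool) := QD.not_inn_thr false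
  obtain ⟨p0, p1, E, hEC, hE, hE0, hE1⟩ := (Q.arc _ _ hie).between
    (Metric.isClosed_closedBall (x := Q.z false) (ε := r))
    (Metric.isClosed_closedBall (x := Q.z true) (ε := r)) hdis
    (Metric.mem_closedBall_self hr.pos.le) (Metric.mem_closedBall_self hr.pos.le)
  let p : Bool → ℂ := fun k => bif k then p1 else p0
  have hEk : ∀ k, E ∩ Metric.closedBall (Q.z k) r = {p k} := by
    rintro (_ | _); exact hE0; exact hE1
  have hpk : ∀ k, Dist.dist (p k) (Q.z k) = r := by
    rintro (_ | _)
    · exact hE.symm.mem_sphere hr.pos.ne' hE0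
    · exact hE.mem_sphere hr.pos.ne' hE1
  have hpz : ∀ k, p k ≠ Q.z k := by
    intro k h
    have := hpk k
    rw [h, _root_.dist_self] at this
    exact hr.pos.ne this
  have hEz : ∀ k, Q.z k ∉ E := by
    intro k h
    exact hpz k (sing_eq (hEk k) h (Metric.mem_closedBall_self hr.pos.le)).symm
  have hthr : ∀ k, Thr ((Sum.inr k, Sum.inr !k) : (A ⊕ Bool) × (B ⊕ Bool)) := fun k => ⟨k, rfl⟩
  -- a point of `E` on another edge is a crossing
  have hEX : ∀ f : (A ⊕ Bool) × (B ⊕ Bool), ¬ IsInn f.1 f.2 → ¬ Thr f → ∀ x, x ∈ E →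
      x ∈ Q.C f.1 f.2 → ∀ k, X f (Sum.inr k, Sum.inr !k) ∧ X (Sum.inr k, Sum.inr !k) f := by
    intro f hf ht x hx hxf k
    have hx' : x ∈ Q.C (Sum.inr k) (Sum.inr !k) := by rw [Q.C_symm]; exact hEC hx
    constructor
    · rcases Q.cross f (Sum.inr k, Sum.inr !k) hf (QD.not_inn_thr k)
        (fun h => ht (h ▸ hthr k)) (fun h => ht h.1) x hxf hx' with
        ⟨a, -, h, -⟩ | ⟨b, -, h, -⟩ | ⟨j, rfl⟩ | h
      · cases h
      · cases h
      · exact absurd hx (hEz j)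
      · exact h
    · rcases Q.cross (Sum.inr k, Sum.inr !k) f (QD.not_inn_thr k) hf
        (fun h => ht (h ▸ hthr k)) (fun h => ht h.2) x hx' hxf with
        ⟨a, h, -, -⟩ | ⟨b, h, -, -⟩ | ⟨j, rfl⟩ | h
      · cases h
      · cases h
      · exact absurd hx (hEz j)
      · exact h
  -- ends are not p
  let d : Bool → ℂ := fun k => p k - Q.z k
  have hdn : ∀ k, ‖d k‖ = r := by
    intro k; rw [← hpk k, dist_eq_norm]
  have hd0 : ∀ k, d k ≠ 0 := fun k => sub_ne_zero.2 (hpz k)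
  have hzd : ∀ k, Q.z k + d k = p k := fun k => by simp [d]
  have hpE : ∀ k, p k ∈ E := fun k => (eq_sing_mem (hEk k)).1
  have hincE : ∀ f : (A ⊕ Bool) × (B ⊕ Bool), ¬ IsInn f.1 f.2 → ¬ Thr f → ∀ k, Inc k f → ∀ x,
      x ∈ E → x ∉ O0 f := by
    intro f hf ht k hk x hx hxO
    have := (hEX f hf ht x hx ((hT f hf ht).sub hxO) k).1
    exact (Q.X_ne _ _ this).2.2 k ⟨hk, Or.inl rfl⟩
  have nS : ∀ k b, ¬ IsInn (Sum.inr k : A ⊕ Bool) (Sum.inl b : B ⊕ Bool) := by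
    rintro k b ⟨j, -, h⟩; cases h
  have tS : ∀ k b, ¬ Thr ((Sum.inr k, Sum.inl b) : (A ⊕ Bool) × (B ⊕ Bool)) := by
    rintro k b ⟨j, h⟩; simp at h
  have nT : ∀ k b, ¬ IsInn (Sum.inl b : A ⊕ Bool) (Sum.inr k : B ⊕ Bool) := by
    rintro k b ⟨j, h, -⟩; cases h
  have tT : ∀ k b, ¬ Thr ((Sum.inl b, Sum.inr k) : (A ⊕ Bool) × (B ⊕ Bool)) := by
    rintro k b ⟨j, h⟩; simp at h
  have nAB : ∀ (a : A) (b : B), ¬ IsInn (Sum.inl a : A ⊕ Bool) (Sum.inl b : B ⊕ Bool) := by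
    rintro k b ⟨j, h, -⟩; cases h
  have tAB : ∀ a b, ¬ Thr ((Sum.inl a, Sum.inl b) : (A ⊕ Bool) × (B ⊕ Bool)) := by
    rintro k b ⟨j, h⟩; simp at h
  have hev : ∀ k, ∀ᶠ x in nhds (p k),
      (∀ b, AdjAng (angl (Q.z k) (d k) (u (Sum.inr k, Sum.inl b))) (angl (Q.z k) (d k) x) 0) ∧
      (∀ a, AdjAng (angl (Q.z k) (d k) (v (Sum.inl a, Sum.inr k))) (angl (Q.z k) (d k) x) 0) := by
    intro k
    refine Filter.Eventually.and (Filter.eventually_all.2 fun b => ?_)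
      (Filter.eventually_all.2 fun a => ?_)
    · rw [← hzd]
      apply angl_near (hd0 k)
      have h1 := hT _ (nS k b) (tS k b)
      apply angl_ne_zero (hd0 k)
      · rw [hdn]; exact h1.sph1 k rfl
      · rw [hzd]; intro h
        exact hincE _ (nS k b) (tS k b) k (Or.inl rfl) _ (hpE k) (h ▸ h1.arc.left_mem)
    · rw [← hzd]
      apply angl_near (hd0 k)
      have h1 := hT _ (nT k a) (tT k a)
      apply angl_ne_zero (hd0 k)
      · rw [hdn]; exact h1.sph2 k rfl
      · rw [hzd]; intro h
        exact hincE _ (nT k a) (tT k a) k (Or.inr rfl) _ (hpE k) (h ▸ h1.arc.right_mem)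
  have hδ : ∀ k, ∃ δ > 0, ∀ x, Dist.dist x (p k) < δ →
      (∀ b, AdjAng (angl (Q.z k) (d k) (u (Sum.inr k, Sum.inl b))) (angl (Q.z k) (d k) x) 0) ∧
      (∀ a, AdjAng (angl (Q.z k) (d k) (v (Sum.inl a, Sum.inr k))) (angl (Q.z k) (d k) x) 0) := by
    intro k
    obtain ⟨δ, h1, h2⟩ := Metric.eventually_nhds_iff.1 (hev k)
    exact ⟨δ, h1, fun x hx => h2 hx⟩
  choose δ hδ0 hδ using hδ
  let I : Finset (A × B) := Finset.univ.filter
    fun i => (O0 (Sum.inl i.1, Sum.inl i.2) ∩ E).Nonempty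
  let Bad : Set ℂ := (⋃ f : {f : (A ⊕ Bool) × (B ⊕ Bool) // ¬ IsInn f.1 f.2 ∧ ¬ Thr f ∧
      ∀ i ∈ I, f ≠ (Sum.inl i.1, Sum.inl i.2)}, O0 f.1) ∪
      ⋃ k : Bool, (Metric.closedBall (Q.z k) r ∩ {x | δ k ≤ Dist.dist x (p k)})
  have hBad : IsClosed Bad := by
    apply IsClosed.union
    · exact isClosed_iUnion_of_finite fun f => (hT f.1 f.2.1 f.2.2.1).arc.isClosed
    · exact isClosed_iUnion_of_finite fun k => Metric.isClosed_closedBall.inter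
        (isClosed_le continuous_const (continuous_id.dist continuous_const))
  have hEB : E ⊆ Badᶜ := by
    intro x hx hxB
    rcases hxB with h | h
    · obtain ⟨⟨f, h1, h2, h3⟩, hxf⟩ := Set.mem_iUnion.1 h
      have hxf : x ∈ O0 f := hxf
      obtain ⟨s, t⟩ := f
      rcases s with a | k
      · rcases t with b | k
        · exact h3 (a, b) (Finset.mem_filter.2 ⟨Finset.mem_univ _, x, hxf, hx⟩) rfl
        · exact hincE _ h1 h2 k (Or.inr rfl) x hx hxf
      · exact hincE _ h1 h2 k (Or.inl rfl) x hx hxf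
    · obtain ⟨k, hk, hkδ⟩ := Set.mem_iUnion.1 h
      rw [sing_eq (hEk k) hx hk] at hkδ
      have hkδ : δ k ≤ Dist.dist (p k) (p k) := hkδ
      rw [_root_.dist_self] at hkδ
      exact absurd (hδ0 k) hkδ.not_gt
  have hFb : ∀ i : A × B, ∀ k, Disjoint (O0 (Sum.inl i.1, Sum.inl i.2))
      (Metric.closedBall (Q.z k) r) := by
    intro i k
    exact (hr.C _ _ k (nAB i.1 i.2) (by simp [Inc])).mono_left (hT _ (nAB i.1 i.2) (tAB i.1 i.2)).sub
  obtain ⟨E', p', q', F', N, hD⟩ := doubling (fun i : A × B => O0 (Sum.inl i.1, Sum.inl i.2))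
    (fun i => Q.PA i.1) (fun i => Q.PB i.2) I (Q.z false) (Q.z true) r r Badᶜ E p0 p1 hr.pos hr.pos
    hdis hBad.isOpen_compl hE hEB hE0 hE1
    (by
      intro i _
      have h1 := hT _ (nAB i.1 i.2) (tAB i.1 i.2)
      have h2 := h1.arc
      rwa [h1.inl1 i.1 rfl, h1.inl2 i.2 rfl] at h2)
    (fun i _ => hFb i false) (fun i _ => hFb i true)
    (by
      intro i hi
      obtain ⟨x, hx, hxE⟩ := (Finset.mem_filter.1 hi).2
      have h1 := hT _ (nAB i.1 i.2) (tAB i.1 i.2)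
      refine ⟨x, ?_, ?_, ?_, ?_⟩
      · refine Set.eq_singleton_iff_unique_mem.2 ⟨⟨hx, hxE⟩, ?_⟩
        rintro y ⟨hy, hyE⟩
        have hX := (hEX _ (nAB i.1 i.2) (tAB i.1 i.2) x hxE (h1.sub hx) false).1
        exact Q.once _ _ (nAB i.1 i.2) hie hX ⟨h1.sub hy, hEC hyE⟩ ⟨h1.sub hx, hEC hxE⟩
      · rintro rfl
        have := Q.avoidA i.1 _ _ hie (hEC hxE)
        cases this
      · rintro rfl
        have := Q.avoidB i.2 _ _ hie (hEC hxE)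
        cases this
      · intro j hj hji hxj
        have h2 := hT _ (nAB j.1 j.2) (tAB j.1 j.2)
        rcases Q.triple (Sum.inl i.1, Sum.inl i.2) (Sum.inl j.1, Sum.inl j.2)
          (Sum.inr false, Sum.inr true) (nAB i.1 i.2) (nAB j.1 j.2) hie
          (fun h => hji (by simpa [Prod.ext_iff, eq_comm] using h)) (by simp) (by simp)
          (fun h => tAB _ _ h.1) (fun h => tAB _ _ h.1) (fun h => tAB _ _ h.1) x
          (h1.sub hx) (h2.sub hxj) (hEC hxE) with ⟨a, rfl⟩ | ⟨b, rfl⟩ | ⟨k, rfl⟩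
        · have := Q.avoidA a _ _ hie (hEC hxE)
          cases this
        · have := Q.avoidB b _ _ hie (hEC hxE)
          cases this
        · exact hEz k hxE)
  let en : Bool → Bool → ℂ := fun j k => bif k then q' j else p' j
  have hen : ∀ j k, Dist.dist (en j k) (p k) < δ k := by
    intro j k
    have hm : en j k ∈ E' j ∧ en j k ∈ Metric.closedBall (Q.z k) r := by
      cases k
      · exact eq_sing_mem (hD.EK j)
      · exact eq_sing_mem (hD.EL j)
    by_contra hc
    exact hD.E_sub j hm.1 (Or.inr (Set.mem_iUnion.2 ⟨k, hm.2, not_lt.1 hc⟩))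
  exact ⟨{
    r := r
    hr := hr
    O0 := O0
    u := u
    v := v
    hT := hT
    I := I
    Ω := Badᶜ
    E := E'
    en := en
    F' := F'
    N := N
    hD := hD
    hΩ := by
      intro f h1 h2 h3
      rw [Set.disjoint_left]
      intro x hx hxB
      exact hxB (Or.inl (Set.mem_iUnion.2 ⟨⟨f, h1, h2, h3⟩, hx⟩))
    hI := by
      intro i hi k
      obtain ⟨x, hx, hxE⟩ := (Finset.mem_filter.1 hi).2
      exact hEX _ (nAB i.1 i.2) (tAB i.1 i.2) x hxE ((hT _ (nAB i.1 i.2) (tAB i.1 i.2)).sub hx) k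
    d := d
    d_norm := hdn
    adjS := fun k b j => (hδ k _ (hen j k)).1 b
    adjT := fun k a j => (hδ k _ (hen j k)).2 a }⟩



namespace OpData
variable {A B : Type*} {X : (A ⊕ Bool) × (B ⊕ Bool) → (A ⊕ Bool) × (B ⊕ Bool) → Prop}
  {Q : QD A B X} (D : OpData Q)

open Classical in
/-- outer edges -/
noncomputable def OO (σ : Bool) : A ⊕ Bool → B ⊕ Bool → Set ℂ
  | Sum.inl a, Sum.inl b => if (a, b) ∈ D.I then D.F' (a, b) else D.O0 (Sum.inl a, Sum.inl b)
  | Sum.inl a, Sum.inr k => D.O0 (Sum.inl a, Sum.inr k)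
  | Sum.inr k, Sum.inl b => D.O0 (Sum.inr k, Sum.inl b)
  | Sum.inr k, Sum.inr _ => D.E (xor σ k)

/-- first ends -/
def oS (σ : Bool) : A ⊕ Bool → B ⊕ Bool → ℂ
  | Sum.inl a, _ => Q.PA a
  | Sum.inr k, Sum.inl b => D.u (Sum.inr k, Sum.inl b)
  | Sum.inr k, Sum.inr _ => D.en (xor σ k) k

/-- second ends -/
def oT (σ : Bool) : A ⊕ Bool → B ⊕ Bool → ℂ
  | _, Sum.inl b => Q.PB b
  | Sum.inl a, Sum.inr k => D.v (Sum.inl a, Sum.inr k)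
  | Sum.inr k, Sum.inr k' => D.en (xor σ k) k'

/-- new parts -/
def Nw (f : (A ⊕ Bool) × (B ⊕ Bool)) (x : ℂ) : Prop :=
  ∃ i ∈ D.I, f = (Sum.inl i.1, Sum.inl i.2) ∧ x ∈ D.N i

theorem V0 (σ : Bool) (g : (A ⊕ Bool) × (B ⊕ Bool)) (hi : ¬ IsInn g.1 g.2) (ht : ¬ Thr g) :
    (∃ i ∈ D.I, g = (Sum.inl i.1, Sum.inl i.2) ∧ D.OO σ g.1 g.2 = D.F' i) ∨
    ((∀ i ∈ D.I, g ≠ (Sum.inl i.1, Sum.inl i.2)) ∧ D.OO σ g.1 g.2 = D.O0 g) := by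
  obtain ⟨s, t⟩ := g
  rcases s with a | k <;> rcases t with b | k'
  · by_cases h : (a, b) ∈ D.I
    · left; exact ⟨(a, b), h, rfl, by simp [OO, h]⟩
    · right
      refine ⟨?_, by simp [OO, h]⟩
      rintro ⟨a', b'⟩ hi e
      simp only [Prod.mk.injEq, Sum.inl.injEq] at e
      rw [e.1, e.2] at h; exact h hi
  · right; exact ⟨by simp, rfl⟩
  · right; exact ⟨by simp, rfl⟩
  · exfalso
    by_cases h : k = k'
    · exact hi ⟨k, rfl, by rw [h]⟩
    · exact ht ⟨k, by rw [Bool.eq_not.2 (Ne.symm h)]⟩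

theorem V1 {σ : Bool} {g : (A ⊕ Bool) × (B ⊕ Bool)} (hi : ¬ IsInn g.1 g.2) (ht : ¬ Thr g) {x : ℂ}
    (hx : x ∈ D.OO σ g.1 g.2) : x ∈ D.O0 g ∨ D.Nw g x := by
  rcases D.V0 σ g hi ht with ⟨i, h1, h2, h3⟩ | ⟨h1, h2⟩
  · rw [h3] at hx
    rcases D.hD.F_sub i h1 hx with h | h
    · left; rw [h2]; exact h
    · right; exact ⟨i, h1, h2, h⟩
  · left; rw [← h2]; exact hx

theorem Nw_Ω {f : (A ⊕ Bool) × (B ⊕ Bool)} {x : ℂ} (h : D.Nw f x) : x ∈ D.Ω := by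
  obtain ⟨i, h1, -, h3⟩ := h
  exact D.hD.N_sub i h1 h3

theorem Nw_ball {f : (A ⊕ Bool) × (B ⊕ Bool)} {x : ℂ} (h : D.Nw f x) (k : Bool) :
    x ∉ Metric.closedBall (Q.z k) D.r := by
  obtain ⟨i, h1, -, h3⟩ := h
  cases k
  · exact Set.disjoint_left.1 (D.hD.NK i h1) h3
  · exact Set.disjoint_left.1 (D.hD.NL i h1) h3

theorem V2 {σ : Bool} {f g : (A ⊕ Bool) × (B ⊕ Bool)} {x : ℂ} (hf : D.Nw f x) (hfg : f ≠ g)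
    (hi : ¬ IsInn g.1 g.2) (ht : ¬ Thr g) (hx : x ∈ D.OO σ g.1 g.2) : False := by
  rcases D.V1 hi ht hx with h | h
  · by_cases hg : ∀ i ∈ D.I, g ≠ (Sum.inl i.1, Sum.inl i.2)
    · exact Set.disjoint_left.1 (D.hΩ g hi ht hg) h (D.Nw_Ω hf)
    · push Not at hg
      obtain ⟨j, hj, rfl⟩ := hg
      obtain ⟨i, h1, h2, h3⟩ := hf
      refine Set.disjoint_left.1 (D.hD.NF i h1 j hj ?_) h3 h
      rintro rfl; exact hfg h2
  · obtain ⟨i, h1, h2, h3⟩ := hf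
    obtain ⟨j, h1', h2', h3'⟩ := h
    refine Set.disjoint_left.1 (D.hD.NN i h1 j h1' ?_) h3 h3'
    rintro rfl; exact hfg (h2.trans h2'.symm)

theorem V3 {σ : Bool} {f g : (A ⊕ Bool) × (B ⊕ Bool)} {x : ℂ} (hf : Thr f)
    (hi : ¬ IsInn g.1 g.2) (ht : ¬ Thr g) (hxf : x ∈ D.OO σ f.1 f.2) (hx : x ∈ D.OO σ g.1 g.2) :
    D.Nw g x := by
  obtain ⟨k, rfl⟩ := hf
  have hxf : x ∈ D.E (xor σ k) := hxf
  rcases D.V0 σ g hi ht with ⟨i, h1, h2, h3⟩ | ⟨h1, h2⟩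
  · rw [h3] at hx
    exact ⟨i, h1, h2, D.hD.EF _ i h1 ⟨hxf, hx⟩⟩
  · rw [h2] at hx
    exact absurd (D.hD.E_sub _ hxf) (Set.disjoint_left.1 (D.hΩ g hi ht h1) hx)

theorem V4 {σ : Bool} {f g : (A ⊕ Bool) × (B ⊕ Bool)} {x : ℂ} (hf : Thr f) (hg : Thr g)
    (hfg : f ≠ g) (hxf : x ∈ D.OO σ f.1 f.2) (hx : x ∈ D.OO σ g.1 g.2) : False := by
  obtain ⟨k, rfl⟩ := hf
  obtain ⟨l, rfl⟩ := hg
  have hkl : xor σ k ≠ xor σ l := by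
    intro h
    rw [Bool.xor_right_inj] at h
    exact hfg (by rw [h])
  exact Set.disjoint_left.1 (disj_bool D.hD.disj hkl) hxf hx

theorem O0_z {f : (A ⊕ Bool) × (B ⊕ Bool)} (hi : ¬ IsInn f.1 f.2) (ht : ¬ Thr f) (k : Bool) :
    Q.z k ∉ D.O0 f := by
  intro h
  have hT := D.hT f hi ht
  have hpos := D.hr.pos
  rcases hT.ball k _ h (Metric.mem_closedBall_self hpos.le) with ⟨h1, h2⟩ | ⟨h1, h2⟩
  · have := hT.sph1 k h1
    rw [← h2, _root_.dist_self] at this; exact hpos.ne this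
  · have := hT.sph2 k h1
    rw [← h2, _root_.dist_self] at this; exact hpos.ne this

theorem en_mem (j k : Bool) : en D j k ∈ Metric.closedBall (Q.z k) D.r := by
  cases k
  · exact (eq_sing_mem (D.hD.EK j)).2
  · exact (eq_sing_mem (D.hD.EL j)).2

theorem E_ball (j k : Bool) : D.E j ∩ Metric.closedBall (Q.z k) D.r = {D.en j k} := by
  cases k
  · exact D.hD.EK j
  · exact D.hD.EL j

theorem E_arc (j k : Bool) : IsArc (D.E j) (D.en j k) (D.en j !k) := by
  cases k
  · exact D.hD.arc j
  · exact (D.hD.arc j).symm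

theorem en_sphere (j k : Bool) : Dist.dist (D.en j k) (Q.z k) = D.r :=
  (D.E_arc j k).symm.mem_sphere D.hr.pos.ne' (D.E_ball j k)

theorem PA_Ω (a : A) : Q.PA a ∉ D.Ω := by
  have hi : ¬ IsInn (Sum.inl a : A ⊕ Bool) (Sum.inr false : B ⊕ Bool) := by
    rintro ⟨j, h, -⟩; cases h
  have ht : ¬ Thr ((Sum.inl a, Sum.inr false) : (A ⊕ Bool) × (B ⊕ Bool)) := by
    rintro ⟨j, h⟩; simp at h
  have hT := D.hT _ hi ht
  apply Set.disjoint_left.1 (D.hΩ _ hi ht (by simp))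
  rw [← hT.inl1 a rfl]; exact hT.arc.left_mem

theorem PB_Ω (b : B) : Q.PB b ∉ D.Ω := by
  have hi : ¬ IsInn (Sum.inr false : A ⊕ Bool) (Sum.inl b : B ⊕ Bool) := by
    rintro ⟨j, -, h⟩; cases h
  have ht : ¬ Thr ((Sum.inr false, Sum.inl b) : (A ⊕ Bool) × (B ⊕ Bool)) := by
    rintro ⟨j, h⟩; simp at h
  have hT := D.hT _ hi ht
  apply Set.disjoint_left.1 (D.hΩ _ hi ht (by simp))
  rw [← hT.inl2 b rfl]; exact hT.arc.right_mem

theorem O0_v {f : (A ⊕ Bool) × (B ⊕ Bool)} (hi : ¬ IsInn f.1 f.2) (ht : ¬ Thr f) :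
    D.OO true f.1 f.2 = D.OO false f.1 f.2 := by
  obtain ⟨s, t⟩ := f
  rcases s with a | k <;> rcases t with b | k'
  · rfl
  · rfl
  · rfl
  · exfalso
    by_cases h : k = k'
    · exact hi ⟨k, rfl, by rw [h]⟩
    · exact ht ⟨k, by rw [Bool.eq_not.2 (Ne.symm h)]⟩

theorem oo_arc (σ : Bool) (f : (A ⊕ Bool) × (B ⊕ Bool)) (hi : ¬ IsInn f.1 f.2) :
    IsArc (D.OO σ f.1 f.2) (D.oS σ f.1 f.2) (D.oT σ f.1 f.2) := by
  by_cases ht : Thr f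
  · obtain ⟨k, rfl⟩ := ht
    exact D.E_arc _ k
  have hT := D.hT f hi ht
  rcases D.V0 σ f hi ht with ⟨i, h1, h2, h3⟩ | ⟨h1, h2⟩
  · rw [h3, h2]; exact D.hD.F_arc i h1
  · rw [h2]
    have := hT.arc
    obtain ⟨s, t⟩ := f
    rcases s with a | k <;> rcases t with b | k'
    · rwa [hT.inl1 a rfl, hT.inl2 b rfl] at this
    · rwa [hT.inl1 a rfl] at this
    · rwa [hT.inl2 b rfl] at this
    · exfalso
      by_cases h : k = k'
      · exact hi ⟨k, rfl, by rw [h]⟩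
      · exact ht ⟨k, by rw [Bool.eq_not.2 (Ne.symm h)]⟩

/-- The opened drawing. -/
noncomputable def toOpn (σ : Bool) : Opn A B X where
  c := Q.z
  r := fun _ => D.r
  PA := Q.PA
  PB := Q.PB
  O := D.OO σ
  uS := D.oS σ
  uT := D.oT σ
  r_pos := fun _ => D.hr.pos
  disj := D.hr.disj
  PA_inj := Q.PA_inj
  PB_inj := Q.PB_inj
  PAB := Q.PAB
  PA_out := D.hr.PA
  PB_out := D.hr.PB
  arc := fun s t hi => D.oo_arc σ (s, t) hi
  uS_inl := by
    rintro a (b | k) <;> rfl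
  uT_inl := by
    rintro (a | k) b <;> rfl
  ball := by
    intro s t k x hi hx hb
    by_cases ht : Thr (s, t)
    · obtain ⟨l, h⟩ := ht
      obtain ⟨rfl, rfl⟩ := Prod.ext_iff.1 h
      have hx : x ∈ D.E (xor σ l) := hx
      have := sing_eq (D.E_ball _ k) hx hb
      by_cases hk : l = k
      · subst hk; exact Or.inl ⟨rfl, this⟩
      · have : k = !l := Bool.eq_not.2 (Ne.symm hk)
        subst this
        exact Or.inr ⟨rfl, this⟩
    · have hT := D.hT (s, t) hi ht
      rcases D.V1 (g := (s, t)) hi ht hx with h | h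
      · rcases s with a | k1 <;> rcases t with b | k2
        · rcases hT.ball k x h hb with ⟨h1, h2⟩ | ⟨h1, h2⟩
          · cases h1
          · cases h1
        · rcases hT.ball k x h hb with ⟨h1, h2⟩ | ⟨h1, h2⟩
          · cases h1
          · exact Or.inr ⟨h1, h2⟩
        · rcases hT.ball k x h hb with ⟨h1, h2⟩ | ⟨h1, h2⟩
          · exact Or.inl ⟨h1, h2⟩
          · cases h1
        · exfalso
          by_cases h : k1 = k2
          · exact hi ⟨k1, rfl, by rw [h]⟩
          · exact ht ⟨k1, by rw [Bool.eq_not.2 (Ne.symm h)]⟩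
      · exact absurd hb (D.Nw_ball h k)
  uS_sphere := by
    rintro k (b | k') h
    · have hi : ¬ IsInn (Sum.inr k : A ⊕ Bool) (Sum.inl b : B ⊕ Bool) := by
        rintro ⟨j, -, h⟩; cases h
      have ht : ¬ Thr ((Sum.inr k, Sum.inl b) : (A ⊕ Bool) × (B ⊕ Bool)) := by
        rintro ⟨j, h⟩; simp at h
      exact (D.hT _ hi ht).sph1 k rfl
    · exact D.en_sphere _ _
  uT_sphere := by
    rintro k (b | k') h
    · have hi : ¬ IsInn (Sum.inl b : A ⊕ Bool) (Sum.inr k : B ⊕ Bool) := by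
        rintro ⟨j, h, -⟩; cases h
      have ht : ¬ Thr ((Sum.inl b, Sum.inr k) : (A ⊕ Bool) × (B ⊕ Bool)) := by
        rintro ⟨j, h⟩; simp at h
      exact (D.hT _ hi ht).sph2 k rfl
    · exact D.en_sphere _ _
  avoidA := by
    intro a s t hi hx
    by_cases ht : Thr (s, t)
    · obtain ⟨l, h⟩ := ht
      obtain ⟨rfl, rfl⟩ := Prod.ext_iff.1 h
      exact absurd (D.hD.E_sub _ hx) (D.PA_Ω a)
    · rcases D.V1 (g := (s, t)) hi ht hx with h | h
      · exact Q.avoidA a s t hi ((D.hT (s, t) hi ht).sub h)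
      · exact absurd (D.Nw_Ω h) (D.PA_Ω a)
  avoidB := by
    intro a s t hi hx
    by_cases ht : Thr (s, t)
    · obtain ⟨l, h⟩ := ht
      obtain ⟨rfl, rfl⟩ := Prod.ext_iff.1 h
      exact absurd (D.hD.E_sub _ hx) (D.PB_Ω a)
    · rcases D.V1 (g := (s, t)) hi ht hx with h | h
      · exact Q.avoidB a s t hi ((D.hT (s, t) hi ht).sub h)
      · exact absurd (D.Nw_Ω h) (D.PB_Ω a)
  cross := by
    intro f g hf hg hfg x hxf hxg
    by_cases htf : Thr f <;> by_cases htg : Thr g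
    · exact (D.V4 htf htg hfg hxf hxg).elim
    · obtain ⟨i, h1, h2, -⟩ := D.V3 htf hg htg hxf hxg
      obtain ⟨k, rfl⟩ := htf
      right; right; rw [h2]; exact (D.hI i h1 k).2
    · obtain ⟨i, h1, h2, -⟩ := D.V3 htg hf htf hxg hxf
      obtain ⟨k, rfl⟩ := htg
      right; right; rw [h2]; exact (D.hI i h1 k).1
    · rcases D.V1 hf htf hxf with h | h
      · rcases D.V1 hg htg hxg with h' | h'
        · rcases Q.cross f g hf hg hfg (fun h => htf h.1) x ((D.hT f hf htf).sub h)
            ((D.hT g hg htg).sub h') with h1 | h1 | ⟨k, rfl⟩ | h1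
          · exact Or.inl h1
          · exact Or.inr (Or.inl h1)
          · exact absurd h (D.O0_z hf htf k)
          · exact Or.inr (Or.inr h1)
        · exact (D.V2 h' hfg.symm hf htf hxf).elim
      · exact (D.V2 h hfg hg htg hxg).elim
  X_ne := Q.X_ne
  once := by
    intro f g hf hg hX
    have hfg : f ≠ g := by rintro rfl; exact (Q.X_ne _ _ hX).1 rfl
    by_cases htf : Thr f <;> by_cases htg : Thr g
    · rintro x ⟨hxf, hxg⟩
      exact (D.V4 htf htg hfg hxf hxg).elim
    · rintro x ⟨hxf, hxg⟩ y ⟨hyf, hyg⟩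
      obtain ⟨i, h1, h2, -⟩ := D.V3 htf hg htg hxf hxg
      obtain ⟨k, rfl⟩ := htf
      subst h2
      have e : D.OO σ (Sum.inl i.1) (Sum.inl i.2) = D.F' i := by simp [OO, h1]
      exact D.hD.once (xor σ k) i h1 ⟨hxf, e ▸ hxg⟩ ⟨hyf, e ▸ hyg⟩
    · rintro x ⟨hxg, hxf⟩ y ⟨hyg, hyf⟩
      obtain ⟨i, h1, h2, -⟩ := D.V3 htg hf htf hxf hxg
      obtain ⟨k, rfl⟩ := htg
      subst h2
      have e : D.OO σ (Sum.inl i.1) (Sum.inl i.2) = D.F' i := by simp [OO, h1]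
      exact D.hD.once (xor σ k) i h1 ⟨hxf, e ▸ hxg⟩ ⟨hyf, e ▸ hyg⟩
    · have key : ∀ x, x ∈ D.OO σ f.1 f.2 → x ∈ D.OO σ g.1 g.2 →
          x ∈ Q.C f.1 f.2 ∩ Q.C g.1 g.2 := by
        intro x hxf hxg
        rcases D.V1 hf htf hxf with h | h
        · rcases D.V1 hg htg hxg with h' | h'
          · exact ⟨(D.hT f hf htf).sub h, (D.hT g hg htg).sub h'⟩
          · exact (D.V2 h' hfg.symm hf htf hxf).elim
        · exact (D.V2 h hfg hg htg hxg).elim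
      rintro x ⟨hxf, hxg⟩ y ⟨hyf, hyg⟩
      exact Q.once f g hf hg hX (key x hxf hxg) (key y hyf hyg)
  triple := by
    have two : ∀ f g h : (A ⊕ Bool) × (B ⊕ Bool), ¬ IsInn g.1 g.2 → ¬ IsInn h.1 h.2 →
        f ≠ g → f ≠ h → g ≠ h → Thr f → ∀ x, x ∈ D.OO σ f.1 f.2 → x ∈ D.OO σ g.1 g.2 →
        x ∈ D.OO σ h.1 h.2 → False := by
      intro f g h hg hh hfg hfh hgh htf x hxf hxg hxh
      by_cases htg : Thr g
      · exact D.V4 htf htg hfg hxf hxg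
      by_cases hth : Thr h
      · exact D.V4 htf hth hfh hxf hxh
      exact D.V2 (D.V3 htf hg htg hxf hxg) hgh hh hth hxh
    intro f g h hf hg hh hfg hfh hgh x hxf hxg hxh
    by_cases htf : Thr f
    · exact (two f g h hg hh hfg hfh hgh htf x hxf hxg hxh).elim
    by_cases htg : Thr g
    · exact (two g f h hf hh hfg.symm hgh hfh htg x hxg hxf hxh).elim
    by_cases hth : Thr h
    · exact (two h f g hf hg hfh.symm hgh.symm hfg hth x hxh hxf hxg).elim
    rcases D.V1 hf htf hxf with h1 | h1
    · rcases D.V1 hg htg hxg with h2 | h2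
      · rcases D.V1 hh hth hxh with h3 | h3
        · rcases Q.triple f g h hf hg hh hfg hfh hgh (fun h => htf h.1) (fun h => htf h.1)
            (fun h => htg h.1) x ((D.hT f hf htf).sub h1) ((D.hT g hg htg).sub h2)
            ((D.hT h hh hth).sub h3) with h4 | h4 | ⟨k, rfl⟩
          · exact Or.inl h4
          · exact Or.inr h4
          · exact absurd h1 (D.O0_z hf htf k)
        · exact (D.V2 h3 hfh.symm hf htf hxf).elim
      · exact (D.V2 h2 hfg.symm hf htf hxf).elim
    · exact (D.V2 h1 hfg hg htg hxg).elim

/-- The pair of opened drawings. -/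
noncomputable def toPair : OpnPair A B X where
  W := D.toOpn
  d := D.d
  c_eq := rfl
  r_eq := rfl
  d_norm := D.d_norm
  uS_eq := fun _ _ => rfl
  uT_eq := fun _ _ => rfl
  swS := by
    intro k
    show D.en (xor true k) k = D.en (xor false !k) k
    simp
  swT := by
    intro k
    show D.en (xor true !k) k = D.en (xor false k) k
    simp
  adjS := by
    intro k b
    have h1 := D.adjS k b (xor false k)
    have h2 := D.adjS k b (xor false !k)
    exact ⟨h1.1.trans h2.1.symm, h1.2.trans h2.2.symm⟩
  adjT := by
    intro k b
    have h1 := D.adjT k b (xor false k)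
    have h2 := D.adjT k b (xor false !k)
    exact ⟨h1.1.trans h2.1.symm, h1.2.trans h2.2.symm⟩

end OpData

theorem exists_opnPair {A B : Type*} [Finite A] [Finite B]
    {X : (A ⊕ Bool) × (B ⊕ Bool) → (A ⊕ Bool) × (B ⊕ Bool) → Prop}
    (Q : QD A B X) : Nonempty (OpnPair A B X) :=
  (exists_opData Q).map OpData.toPair



/-! ### The 4-partite graph -/

section G4
variable {A B : Type*}

/-- the part of a vertex -/
def cls : Bool ⊕ (A ⊕ B) → Fin 4
  | Sum.inl false => 0
  | Sum.inl true => 1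
  | Sum.inr (Sum.inl _) => 2
  | Sum.inr (Sum.inr _) => 3

/-- the complete 4-partite graph with two singleton parts -/
def G4 (A B : Type*) : SimpleGraph (Bool ⊕ (A ⊕ B)) where
  Adj u v := cls u ≠ cls v
  symm := ⟨fun _ _ h => Ne.symm h⟩
  loopless := ⟨fun _ h => h rfl⟩

/-- vertices as left vertices -/
def hvS : A ⊕ Bool → Bool ⊕ (A ⊕ B)
  | Sum.inl a => Sum.inr (Sum.inl a)
  | Sum.inr k => Sum.inl k

/-- vertices as right vertices -/
def hvT : B ⊕ Bool → Bool ⊕ (A ⊕ B)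
  | Sum.inl a => Sum.inr (Sum.inr a)
  | Sum.inr k => Sum.inl k

/-- edge of the 4-partite graph associated to a pair -/
def hat (f : (A ⊕ Bool) × (B ⊕ Bool)) : Sym2 (Bool ⊕ (A ⊕ B)) := s(hvS f.1, hvT f.2)

theorem hat_adj {s : A ⊕ Bool} {t : B ⊕ Bool} (h : ¬ IsInn s t) : (G4 A B).Adj (hvS s) (hvT t) := by
  rcases s with a | (_ | _) <;> rcases t with b | (_ | _) <;> simp [G4, cls, hvS, hvT] <;>
    exact h ⟨_, rfl, rfl⟩

theorem hat_mem {f : (A ⊕ Bool) × (B ⊕ Bool)} (h : ¬ IsInn f.1 f.2) : hat f ∈ (G4 A B).edgeSet :=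
  hat_adj h

theorem hat_inn {f : (A ⊕ Bool) × (B ⊕ Bool)} (h : hat f ∈ (G4 A B).edgeSet) : ¬ IsInn f.1 f.2 := by
  rintro ⟨k, h1, h2⟩
  rw [hat, h1, h2] at h
  exact (G4 A B).loopless.irrefl _ h

theorem hat_A {f : (A ⊕ Bool) × (B ⊕ Bool)} {a : A} :
    (Sum.inr (Sum.inl a) : Bool ⊕ (A ⊕ B)) ∈ hat f ↔ f.1 = Sum.inl a := by
  obtain ⟨s, t⟩ := f
  rcases s with a | k <;> rcases t with b | j <;> simp [hat, hvS, hvT, eq_comm]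

theorem hat_B {f : (A ⊕ Bool) × (B ⊕ Bool)} {b : B} :
    (Sum.inr (Sum.inr b) : Bool ⊕ (A ⊕ B)) ∈ hat f ↔ f.2 = Sum.inl b := by
  obtain ⟨s, t⟩ := f
  rcases s with a | k <;> rcases t with b | j <;> simp [hat, hvS, hvT, eq_comm]

theorem hat_z {f : (A ⊕ Bool) × (B ⊕ Bool)} {k : Bool} :
    (Sum.inl k : Bool ⊕ (A ⊕ B)) ∈ hat f ↔ Inc k f := by
  obtain ⟨s, t⟩ := f
  rcases s with a | k <;> rcases t with b | j <;> simp [hat, hvS, hvT, Inc, eq_comm]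

theorem hat_thr {f : (A ⊕ Bool) × (B ⊕ Bool)} (h : Thr f) :
    hat f = s(Sum.inl false, Sum.inl true) := by
  obtain ⟨k, rfl⟩ := h
  cases k
  · rfl
  · exact Sym2.eq_swap

theorem hat_eq_thr {f : (A ⊕ Bool) × (B ⊕ Bool)} (h : hat f = s(Sum.inl false, Sum.inl true)) :
    Thr f := by
  obtain ⟨s, t⟩ := f
  rcases s with a | (_ | _) <;> rcases t with b | (_ | _) <;>
    simp [hat, hvS, hvT] at h
  · exact ⟨false, rfl⟩
  · exact ⟨true, rfl⟩

theorem hat_inj {f g : (A ⊕ Bool) × (B ⊕ Bool)} (hg : ¬ IsInn g.1 g.2)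
    (h : hat f = hat g) (ht : ¬ (Thr f ∧ Thr g)) : f = g := by
  have hg : ∀ k, g ≠ (Sum.inr k, Sum.inr k) := fun k hk => hg ⟨k, by rw [hk], by rw [hk]⟩
  by_cases hT : Thr f
  · exact absurd ⟨hT, hat_eq_thr (h ▸ hat_thr hT)⟩ ht
  by_cases hT' : Thr g
  · exact absurd (hat_eq_thr (h.trans (hat_thr hT'))) hT
  have e1 : ∀ a, f.1 = Sum.inl a ↔ g.1 = Sum.inl a := fun a => by rw [← hat_A, ← hat_A, h]
  have e2 : ∀ a, f.2 = Sum.inl a ↔ g.2 = Sum.inl a := fun a => by rw [← hat_B, ← hat_B, h]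
  have e3 : ∀ k, Inc k f ↔ Inc k g := fun a => by rw [← hat_z, ← hat_z, h]
  obtain ⟨s, t⟩ := f
  obtain ⟨s', t'⟩ := g
  simp only [Inc] at e1 e2 e3
  rcases s with a | k
  · have := (e1 a).1 rfl
    subst this
    rcases t with b | j
    · have := (e2 b).1 rfl
      subst this; rfl
    · rcases t' with b | j'
      · simp at e2
      · have := e3 j
        simp at this
        rw [this]
  · rcases s' with a' | k'
    · simp at e1
    · rcases t with b | j
      · have := (e2 b).1 rfl
        subst this
        have := e3 k
        simp at this
        rw [this]
      · rcases t' with b | j'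
        · simp at e2
        · exfalso
          apply hT'
          refine ⟨k', ?_⟩
          have := hg k'
          simp only [ne_eq, Prod.mk.injEq, Sum.inr.injEq, true_and] at this
          rw [Bool.eq_not_of_ne this]

variable (D : PlaneSys (G4 A B))

/-- crossing of associated edges -/
def XX (f g : (A ⊕ Bool) × (B ⊕ Bool)) : Prop := D.Cross (hat f) (hat g)

/-- the listed drawing -/
def PlaneSys.toQD : QD A B (XX D) where
  z k := D.P (Sum.inl k)
  PA a := D.P (Sum.inr (Sum.inl a))
  PB b := D.P (Sum.inr (Sum.inr b))
  C s t := D.C (hat (s, t))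
  C_symm k := by rw [hat_thr ⟨k, rfl⟩]; rfl
  z_ne h := by simpa using D.P_inj h
  PA_inj a b h := by simpa using D.P_inj h
  PB_inj a b h := by simpa using D.P_inj h
  PAB a b h := by simpa using D.P_inj h
  PAz a b h := by simpa using D.P_inj h
  PBz a b h := by simpa using D.P_inj h
  arc s t h := by
    have := D.arc _ _ (hat_adj h)
    rcases s with a | k <;> rcases t with b | j <;> exact this
  avoidA a s t h hm := by
    by_contra hc
    exact D.avoid _ (hat_mem (f := (s, t)) h) _ (fun h' => hc (hat_A.1 h').symm) hm
  avoidB a s t h hm := by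
    by_contra hc
    exact D.avoid _ (hat_mem (f := (s, t)) h) _ (fun h' => hc (hat_B.1 h').symm) hm
  avoidz a s t h hm := by
    by_contra hc
    exact D.avoid _ (hat_mem (f := (s, t)) h) _ (fun h' => hc (hat_z.1 h')) hm
  cross f g hf hg hne ht x hx hx' := by
    by_cases hv : ∃ v, v ∈ hat f ∧ v ∈ hat g
    · obtain ⟨v, h1, h2⟩ := hv
      have := D.adj_inter _ (hat_mem hf) _ (hat_mem hg) (fun h => hne (hat_inj hg h ht)) v h1 h2 ⟨hx, hx'⟩
      have : x = D.P v := this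
      rcases v with k | a | b
      · exact Or.inr (Or.inr (Or.inl ⟨k, this⟩))
      · exact Or.inl ⟨a, hat_A.1 h1, hat_A.1 h2, this⟩
      · exact Or.inr (Or.inl ⟨b, hat_B.1 h1, hat_B.1 h2, this⟩)
    · push Not at hv
      exact Or.inr (Or.inr (Or.inr ⟨hat_mem hf, hat_mem hg, hv, ⟨x, hx, hx'⟩⟩))
  X_ne f g h := by
    obtain ⟨h1, h2, h3, -⟩ := h
    refine ⟨fun h => ?_, fun h => ?_, fun k hk => h3 _ (hat_z.2 hk.1) (hat_z.2 hk.2)⟩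
    · refine h3 (hvS f.1) (Sym2.mem_mk_left _ _) ?_
      rw [h]; exact Sym2.mem_mk_left _ _
    · refine h3 (hvT f.2) (Sym2.mem_mk_right _ _) ?_
      rw [h]; exact Sym2.mem_mk_right _ _
  once f g hf hg h := D.once _ (hat_mem hf) _ (hat_mem hg) h.2.2.1
  triple f g h hf hg hh h1 h2 h3 t1 t2 t3 x hx1 hx2 hx3 := by
    obtain ⟨v, hv⟩ := D.triple _ (hat_mem hf) _ (hat_mem hg) _ (hat_mem hh)
      (fun h => h1 (hat_inj hg h t1)) (fun h => h2 (hat_inj hh h t2)) (fun h => h3 (hat_inj hh h t3))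
      x hx1 hx2 hx3
    rcases v with k | a | b
    · exact Or.inr (Or.inr ⟨k, hv⟩)
    · exact Or.inl ⟨a, hv⟩
    · exact Or.inr (Or.inl ⟨b, hv⟩)

end G4



/-! ### Counting -/

section Counting
variable {A B : Type*} [Fintype A] [Fintype B]

open Classical in
theorem loc_count {L : ∀ k : Bool, {s : A ⊕ Bool // s ≠ Sum.inr k} →
      {t : B ⊕ Bool // t ≠ Sum.inr k} → Prop} (k : Bool) (r : B ⊕ Bool → Prop) :
    Set.ncard {p : ((A ⊕ Bool) × (B ⊕ Bool)) × ((A ⊕ Bool) × (B ⊕ Bool)) |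
      Opn.Loc L k p.1 p.2 ∧ r p.1.2 ∧ r p.2.2} ≤
    if r (Sum.inr k) then ∑ s, (Finset.univ.filter fun t => L k s t ∧ r t.1).card else 0 := by
  split_ifs with hr
  · have h1 : {p : ((A ⊕ Bool) × (B ⊕ Bool)) × ((A ⊕ Bool) × (B ⊕ Bool)) |
        Opn.Loc L k p.1 p.2 ∧ r p.1.2 ∧ r p.2.2} ⊆
        (fun q : {s : A ⊕ Bool // s ≠ Sum.inr k} × {t : B ⊕ Bool // t ≠ Sum.inr k} =>
          ((q.1.1, Sum.inr k), (Sum.inr k, q.2.1))) ''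
          ((Finset.univ.filter fun q : {s : A ⊕ Bool // s ≠ Sum.inr k} ×
            {t : B ⊕ Bool // t ≠ Sum.inr k} => L k q.1 q.2 ∧ r q.2.1 : Finset _) : Set _) := by
      rintro ⟨f, g⟩ ⟨⟨s, t, hf, hg, hL⟩, -, h2⟩
      refine ⟨(s, t), ?_, ?_⟩
      · simp only [Finset.coe_filter, Finset.mem_univ, true_and, Set.mem_ofPred_eq]
        simp only at hg h2
        rw [hg] at h2
        exact ⟨hL, h2⟩
      · simp only at hf hg
        simp only [hf, hg]
    refine (Set.ncard_le_ncard h1 (Set.toFinite _)).trans ((Set.ncard_image_le (Set.toFinite _)).trans ?_)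
    rw [Set.ncard_coe_finset, Finset.card_filter, Fintype.sum_prod_type]
    refine le_of_eq (Finset.sum_congr rfl fun s _ => ?_)
    rw [Finset.card_filter]
  · rw [Nat.le_zero, Set.ncard_eq_zero (Set.toFinite _)]
    rw [Set.eq_empty_iff_forall_notMem]
    rintro ⟨f, g⟩ ⟨⟨s, t, hf, hg, hL⟩, h1, -⟩
    simp only at hf h1
    rw [hf] at h1
    exact hr h1

theorem loc_count' {L : ∀ k : Bool, {s : A ⊕ Bool // s ≠ Sum.inr k} →
      {t : B ⊕ Bool // t ≠ Sum.inr k} → Prop} (k : Bool) (r : B ⊕ Bool → Prop) :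
    Set.ncard {p : ((A ⊕ Bool) × (B ⊕ Bool)) × ((A ⊕ Bool) × (B ⊕ Bool)) |
      Opn.Loc L k p.2 p.1 ∧ r p.1.2 ∧ r p.2.2} =
    Set.ncard {p : ((A ⊕ Bool) × (B ⊕ Bool)) × ((A ⊕ Bool) × (B ⊕ Bool)) |
      Opn.Loc L k p.1 p.2 ∧ r p.1.2 ∧ r p.2.2} := by
  rw [← Set.ncard_image_of_injective _ Prod.swap_injective]
  congr 1
  ext ⟨f, g⟩
  constructor
  · rintro ⟨⟨f', g'⟩, ⟨h1, h2, h3⟩, h⟩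
    simp only [Prod.swap_prod_mk, Prod.mk.injEq] at h
    obtain ⟨rfl, rfl⟩ := h
    exact ⟨h1, h3, h2⟩
  · rintro ⟨h1, h2, h3⟩
    exact ⟨(g, f), ⟨h1, h3, h2⟩, rfl⟩

open Classical in
theorem main_count {X : (A ⊕ Bool) × (B ⊕ Bool) → (A ⊕ Bool) × (B ⊕ Bool) → Prop}
    (P : OpnPair A B X) (h : ℕ) (w : ∀ k : Bool, {t : B ⊕ Bool // t ≠ Sum.inr k}) :
    ∃ Bp : BipSys (A ⊕ Bool) (B ⊕ Bool), ∀ r : B ⊕ Bool → Prop,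
      Set.ncard {p : ((A ⊕ Bool) × (B ⊕ Bool)) × ((A ⊕ Bool) × (B ⊕ Bool)) |
        Bp.X p.1 p.2 ∧ r p.1.2 ∧ r p.2.2} ≤
      Set.ncard {p : ((A ⊕ Bool) × (B ⊕ Bool)) × ((A ⊕ Bool) × (B ⊕ Bool)) |
        X p.1 p.2 ∧ r p.1.2 ∧ r p.2.2} +
      2 * ∑ k, if r (Sum.inr k) then ∑ s, (Finset.univ.filter fun t =>
        Lc (P.bb false k) h (w k) (P.aa false k s) t ∧ r t.1).card else 0 := by
  obtain ⟨Bp, hB⟩ := P.main_gamma h w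
  refine ⟨Bp, fun r => ?_⟩
  have hl : ∀ k : Bool, Set.ncard {p : ((A ⊕ Bool) × (B ⊕ Bool)) × ((A ⊕ Bool) × (B ⊕ Bool)) |
      Opn.Loc (P.LL false h w) k p.1 p.2 ∧ r p.1.2 ∧ r p.2.2} ≤
      if r (Sum.inr k) then ∑ s, (Finset.univ.filter fun t =>
        Lc (P.bb false k) h (w k) (P.aa false k s) t ∧ r t.1).card else 0 :=
    fun k => loc_count (L := P.LL false h w) k r
  have hl' := fun k => (loc_count' (L := P.LL false h w) k r).le.trans (hl k)
  rw [Fintype.sum_bool]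
  have hsub : {p : ((A ⊕ Bool) × (B ⊕ Bool)) × ((A ⊕ Bool) × (B ⊕ Bool)) |
        Bp.X p.1 p.2 ∧ r p.1.2 ∧ r p.2.2} ⊆
      {p | X p.1 p.2 ∧ r p.1.2 ∧ r p.2.2} ∪
      (({p | Opn.Loc (P.LL false h w) true p.1 p.2 ∧ r p.1.2 ∧ r p.2.2} ∪
        {p | Opn.Loc (P.LL false h w) true p.2 p.1 ∧ r p.1.2 ∧ r p.2.2}) ∪
      ({p | Opn.Loc (P.LL false h w) false p.1 p.2 ∧ r p.1.2 ∧ r p.2.2} ∪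
        {p | Opn.Loc (P.LL false h w) false p.2 p.1 ∧ r p.1.2 ∧ r p.2.2})) := by
    rintro ⟨f, g⟩ ⟨h1, h2⟩
    rcases hB f g h1 with h | ⟨k, h⟩
    · exact Or.inl ⟨h, h2⟩
    · cases k
      · rcases h with h | h
        · exact Or.inr (Or.inr (Or.inl ⟨h, h2⟩))
        · exact Or.inr (Or.inr (Or.inr ⟨h, h2⟩))
      · rcases h with h | h
        · exact Or.inr (Or.inl (Or.inl ⟨h, h2⟩))
        · exact Or.inr (Or.inl (Or.inr ⟨h, h2⟩))
  refine (Set.ncard_le_ncard hsub (Set.toFinite _)).trans ((Set.ncard_union_le _ _).trans ?_)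
  have e1 := Set.ncard_union_le {p : ((A ⊕ Bool) × (B ⊕ Bool)) × ((A ⊕ Bool) × (B ⊕ Bool)) |
      Opn.Loc (P.LL false h w) true p.1 p.2 ∧ r p.1.2 ∧ r p.2.2}
        {p | Opn.Loc (P.LL false h w) true p.2 p.1 ∧ r p.1.2 ∧ r p.2.2}
  have e2 := Set.ncard_union_le {p : ((A ⊕ Bool) × (B ⊕ Bool)) × ((A ⊕ Bool) × (B ⊕ Bool)) |
      Opn.Loc (P.LL false h w) false p.1 p.2 ∧ r p.1.2 ∧ r p.2.2}
        {p | Opn.Loc (P.LL false h w) false p.2 p.1 ∧ r p.1.2 ∧ r p.2.2}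
  have e3 := Set.ncard_union_le ({p : ((A ⊕ Bool) × (B ⊕ Bool)) × ((A ⊕ Bool) × (B ⊕ Bool)) |
      Opn.Loc (P.LL false h w) true p.1 p.2 ∧ r p.1.2 ∧ r p.2.2} ∪
        {p | Opn.Loc (P.LL false h w) true p.2 p.1 ∧ r p.1.2 ∧ r p.2.2})
      ({p : ((A ⊕ Bool) × (B ⊕ Bool)) × ((A ⊕ Bool) × (B ⊕ Bool)) |
      Opn.Loc (P.LL false h w) false p.1 p.2 ∧ r p.1.2 ∧ r p.2.2} ∪
        {p | Opn.Loc (P.LL false h w) false p.2 p.1 ∧ r p.1.2 ∧ r p.2.2})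
  have f1 := hl true
  have f2 := hl false
  have f3 := hl' true
  have f4 := hl' false
  omega

theorem card_ne (k : Bool) [Fintype {t : B ⊕ Bool // t ≠ Sum.inr k}] :
    Fintype.card {t : B ⊕ Bool // t ≠ Sum.inr k} = Fintype.card B + 1 := by
  classical
  have : Fintype.card {t : B ⊕ Bool // t ≠ Sum.inr k} = Fintype.card (B ⊕ Bool) - 1 := by
    rw [← Fintype.card_subtype_eq (Sum.inr k : B ⊕ Bool), ← Fintype.card_subtype_compl]
  rw [this]; simp

theorem count_odd {X : (A ⊕ Bool) × (B ⊕ Bool) → (A ⊕ Bool) × (B ⊕ Bool) → Prop}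
    (P : OpnPair A B X) (b : ℕ) (hb : Fintype.card B = 2 * b + 1) :
    2 * crossingNumber (bipK (Fintype.card A + 2) (Fintype.card B + 2)) ≤
      Set.ncard {p : ((A ⊕ Bool) × (B ⊕ Bool)) × ((A ⊕ Bool) × (B ⊕ Bool)) | X p.1 p.2} +
      2 * (Fintype.card A + 1) * (b + 1) := by
  classical
  have hF : ∀ k : Bool, ∃ w : {t : B ⊕ Bool // t ≠ Sum.inr k},
      2 * (∑ s, (Finset.univ.filter fun t =>
        Lc (P.bb false k) (b + 1) w (P.aa false k s) t).card) ≤ (Fintype.card A + 1) * (b + 1) := by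
    intro k
    have hc := card_ne (B := B) k
    by_contra hcon
    push Not at hcon
    have h1 : ∑ w : {t : B ⊕ Bool // t ≠ Sum.inr k}, (Fintype.card A + 1) * (b + 1) <
        ∑ w, 2 * (∑ s, (Finset.univ.filter fun t =>
        Lc (P.bb false k) (b + 1) w (P.aa false k s) t).card) := by
      refine Finset.sum_lt_sum_of_nonempty ?_ fun w _ => hcon w
      rw [Finset.univ_nonempty_iff, ← Fintype.card_pos_iff]; omega
    rw [Finset.sum_const, ← Finset.mul_sum, Finset.sum_comm, Finset.card_univ, hc] at h1
    have h2 : ∑ s : {s : A ⊕ Bool // s ≠ Sum.inr k}, ∑ w, (Finset.univ.filter fun t =>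
        Lc (P.bb false k) (b + 1) w (P.aa false k s) t).card ≤
        ∑ s : {s : A ⊕ Bool // s ≠ Sum.inr k}, (b + 1) ^ 2 := by
      refine Finset.sum_le_sum fun s _ => ?_
      exact sum_odd (P.bb_InR false k) (P.bb_inj false k) (fun t => P.bb_ne_aa false k s t) b
        (by rw [hc, hb])
    rw [Finset.sum_const, Finset.card_univ, card_ne (B := A) k, smul_eq_mul] at h2
    rw [smul_eq_mul, hb] at h1
    nlinarith
  choose w hw using hF
  obtain ⟨Bp, hB⟩ := main_count P (b + 1) w
  have h1 := hB (fun _ => True)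
  have h2 := Bp.bound
  simp only [and_true, if_true, Fintype.sum_bool] at h1
  rw [Fintype.card_sum, Fintype.card_sum, Fintype.card_bool] at h2
  have := hw true
  have := hw false
  nlinarith

theorem count_even {X : (A ⊕ Bool) × (B ⊕ Bool) → (A ⊕ Bool) × (B ⊕ Bool) → Prop}
    (P : OpnPair A B X) (b : ℕ) (hb : Fintype.card B = 2 * b)
    (hX : ∀ f g, X f g → f.2 ≠ g.2) :
    (2 * b + 2) * (2 * crossingNumber (bipK (Fintype.card A + 2) (Fintype.card B + 1))) ≤
      2 * b * Set.ncard {p : ((A ⊕ Bool) × (B ⊕ Bool)) × ((A ⊕ Bool) × (B ⊕ Bool)) | X p.1 p.2} +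
      4 * ((Fintype.card A + 1) * b ^ 2) := by
  classical
  have hw : ∀ v : B ⊕ Bool, ∃ w : ∀ k : Bool, {t : B ⊕ Bool // t ≠ Sum.inr k}, ∀ k,
      ∀ h : v ≠ Sum.inr k, cnt (P.bb false k) (w k) (P.bb false k ⟨v, h⟩) = b := by
    intro v
    have : ∀ k : Bool, ∃ w : {t : B ⊕ Bool // t ≠ Sum.inr k},
      ∀ h : v ≠ Sum.inr k, cnt (P.bb false k) w (P.bb false k ⟨v, h⟩) = b := by
      intro k
      by_cases h : v ≠ Sum.inr k
      · obtain ⟨w, hw⟩ := rk_surj (P.bb_inj false k) ⟨v, h⟩ (h := b)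
          (by rw [card_ne, hb]; omega)
        exact ⟨w, fun _ => hw⟩
      · exact ⟨⟨Sum.inr !k, by simp⟩, fun h' => absurd h' h⟩
    choose w hw using this
    exact ⟨w, hw⟩
  choose w hw using hw
  have hb1 : ∀ v : B ⊕ Bool, 2 * crossingNumber (bipK (Fintype.card A + 2) (Fintype.card B + 1)) ≤
      Set.ncard {p : ((A ⊕ Bool) × (B ⊕ Bool)) × ((A ⊕ Bool) × (B ⊕ Bool)) |
        X p.1 p.2 ∧ p.1.2 ≠ v ∧ p.2.2 ≠ v} +
      2 * ∑ k : Bool, if Sum.inr k ≠ v then ∑ s, (Finset.univ.filter fun t =>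
        Lc (P.bb false k) b (w v k) (P.aa false k s) t ∧ t.1 ≠ v).card else 0 := by
    intro v
    obtain ⟨Bp, hB⟩ := main_count P b (w v)
    have h1 := hB (fun t => t ≠ v)
    have h2 := Bp.bound_erase v
    rw [Fintype.card_sum, Fintype.card_sum, Fintype.card_bool] at h2
    rw [show Fintype.card B + 2 - 1 = Fintype.card B + 1 by omega] at h2
    refine h2.trans (h1.trans (le_of_eq ?_))
    refine congrArg₂ _ rfl (congrArg _ (Finset.sum_congr rfl fun k _ => ?_))
    split_ifs
    · refine Finset.sum_congr rfl fun s _ => ?_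
      congr
    · rfl
  have hsum := Finset.sum_le_sum fun v (_ : v ∈ (Finset.univ : Finset (B ⊕ Bool))) => hb1 v
  rw [Finset.sum_const, Finset.card_univ, Finset.sum_add_distrib, ← Finset.mul_sum,
    Finset.sum_comm, smul_eq_mul] at hsum
  simp only [Fintype.card_sum, Fintype.card_bool] at hsum
  have hA : ∑ v : B ⊕ Bool, Set.ncard {p : ((A ⊕ Bool) × (B ⊕ Bool)) × ((A ⊕ Bool) × (B ⊕ Bool)) |
        X p.1 p.2 ∧ p.1.2 ≠ v ∧ p.2.2 ≠ v} = 2 * b *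
      Set.ncard {p : ((A ⊕ Bool) × (B ⊕ Bool)) × ((A ⊕ Bool) × (B ⊕ Bool)) | X p.1 p.2} := by
    have e1 : ∀ R : ((A ⊕ Bool) × (B ⊕ Bool)) × ((A ⊕ Bool) × (B ⊕ Bool)) → Prop,
        Set.ncard {p | R p} = (Finset.univ.filter R).card := by
      intro R
      rw [← Set.ncard_coe_finset]
      congr 1
      ext p; simp
    simp only [e1, Finset.card_filter]
    rw [Finset.sum_comm, Finset.mul_sum]
    refine Finset.sum_congr rfl fun p _ => ?_
    by_cases hp : X p.1 p.2
    · simp only [hp, true_and, if_true, mul_one]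
      rw [← Finset.card_filter]
      have : (Finset.univ.filter fun v => p.1.2 ≠ v ∧ p.2.2 ≠ v) =
          Finset.univ \ {p.1.2, p.2.2} := by
        ext v; simp [eq_comm]
      rw [this, Finset.card_univ_sdiff, Finset.card_pair (hX _ _ hp), Fintype.card_sum,
        Fintype.card_bool, hb]
      omega
    · simp [hp]
  have hL : ∀ k : Bool, ∑ v : B ⊕ Bool, (if Sum.inr k ≠ v then ∑ s, (Finset.univ.filter fun t =>
        Lc (P.bb false k) b (w v k) (P.aa false k s) t ∧ t.1 ≠ v).card else 0) ≤
        (Fintype.card A + 1) * b ^ 2 := by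
    intro k
    rw [← Finset.sum_filter]
    rw [Finset.sum_subtype (p := fun v => v ≠ Sum.inr k) _ (by intro x; simp [eq_comm]),
      Finset.sum_comm]
    have hs : ∀ s : {s : A ⊕ Bool // s ≠ Sum.inr k},
        ∑ v : {t : B ⊕ Bool // t ≠ Sum.inr k}, (Finset.univ.filter fun t =>
        Lc (P.bb false k) b (w v.1 k) (P.aa false k s) t ∧ t.1 ≠ v.1).card ≤ b ^ 2 := by
      intro s
      have := sum_even (P.bb_InR false k) (P.bb_inj false k) (fun t => P.bb_ne_aa false k s t) b
        (by rw [card_ne, hb]) (fun v => w v.1 k) (fun v => hw v.1 k v.2)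
      refine le_trans (le_of_eq ?_) this
      refine Finset.sum_congr rfl fun v _ => ?_
      congr 1
      ext t
      simp [Subtype.ext_iff]
    refine (Finset.sum_le_sum fun s _ => hs s).trans ?_
    rw [Finset.sum_const, Finset.card_univ, card_ne, smul_eq_mul]
  have h1 := hL true
  have h2 := hL false
  rw [Fintype.sum_bool, hA, hb] at hsum
  rw [hb]
  nlinarith
end Counting



/-! ### The lower bound -/

section Lower
variable {A B : Type*} [Finite A] [Finite B]

/-- ordered crossings on the middle edge -/
def midSet (D : PlaneSys (G4 A B)) : Set (Sym2 (Bool ⊕ (A ⊕ B)) × Sym2 (Bool ⊕ (A ⊕ B))) :=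
  {p | D.Cross p.1 p.2 ∧ (p.1 = s(Sum.inl false, Sum.inl true) ∨ p.2 = s(Sum.inl false, Sum.inl true))}

theorem xx_thr (D : PlaneSys (G4 A B)) {f g : (A ⊕ Bool) × (B ⊕ Bool)} (h : XX D f g) (hf : Thr f) :
    ¬ Thr g := by
  intro hg
  have := h.2.2.1 (Sum.inl false)
  rw [hat_thr hf, hat_thr hg] at this
  exact this (Sym2.mem_mk_left _ _) (Sym2.mem_mk_left _ _)

theorem xx_symm (D : PlaneSys (G4 A B)) {f g : (A ⊕ Bool) × (B ⊕ Bool)} (h : XX D f g) : XX D g f := by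
  obtain ⟨h1, h2, h3, h4⟩ := h
  exact ⟨h2, h1, fun v hv hv' => h3 v hv' hv, by rw [Set.inter_comm]; exact h4⟩

theorem xx_le (D : PlaneSys (G4 A B)) :
    Set.ncard {p : ((A ⊕ Bool) × (B ⊕ Bool)) × ((A ⊕ Bool) × (B ⊕ Bool)) | XX D p.1 p.2} ≤
      D.cr2 + (midSet D).ncard := by
  set sec : (A ⊕ Bool) × (B ⊕ Bool) := (Sum.inr true, Sum.inr false) with hsec
  have hthr : ∀ f : (A ⊕ Bool) × (B ⊕ Bool), Thr f → f = sec ∨ f = (Sum.inr false, Sum.inr true) := by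
    rintro f ⟨k, rfl⟩
    cases k <;> simp [hsec]
  have hsecT : Thr sec := ⟨true, rfl⟩
  let X1 := {p : ((A ⊕ Bool) × (B ⊕ Bool)) × ((A ⊕ Bool) × (B ⊕ Bool)) |
    XX D p.1 p.2 ∧ p.1 ≠ sec ∧ p.2 ≠ sec}
  let X2 := {p : ((A ⊕ Bool) × (B ⊕ Bool)) × ((A ⊕ Bool) × (B ⊕ Bool)) |
    XX D p.1 p.2 ∧ (p.1 = sec ∨ p.2 = sec)}
  have hsub : {p : ((A ⊕ Bool) × (B ⊕ Bool)) × ((A ⊕ Bool) × (B ⊕ Bool)) | XX D p.1 p.2} ⊆ X1 ∪ X2 := by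
    intro p hp
    by_cases h : p.1 = sec ∨ p.2 = sec
    · exact Or.inr ⟨hp, h⟩
    · push Not at h
      exact Or.inl ⟨hp, h⟩
  refine (Set.ncard_le_ncard hsub (Set.toFinite _)).trans ((Set.ncard_union_le _ _).trans
    (Nat.add_le_add ?_ ?_))
  · refine Set.ncard_le_ncard_of_injOn (Prod.map hat hat) ?_ ?_ (Set.toFinite _)
    · rintro ⟨f, g⟩ hp
      exact hp.1
    · rintro ⟨f, g⟩ ⟨hx, h1, h2⟩ ⟨f', g'⟩ ⟨hx', h1', h2'⟩ he
      simp only [Prod.map_apply, Prod.mk.injEq] at he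
      have key : ∀ f f' : (A ⊕ Bool) × (B ⊕ Bool), hat f' ∈ (G4 A B).edgeSet → hat f = hat f' →
          f ≠ sec → f' ≠ sec → f = f' := by
        intro f f' hm he hs hs'
        by_cases ht : Thr f ∧ Thr f'
        · rw [(hthr f ht.1).resolve_left hs, (hthr f' ht.2).resolve_left hs']
        · exact hat_inj (hat_inn hm) he ht
      exact Prod.ext (key f f' hx'.1 he.1 h1 h1') (key g g' hx'.2.1 he.2 h2 h2')
  · refine Set.ncard_le_ncard_of_injOn (Prod.map hat hat) ?_ ?_ (Set.toFinite _)
    · rintro ⟨f, g⟩ hp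
      refine ⟨hp.1, ?_⟩
      rcases hp.2 with h | h
      · left
        simp only at h
        rw [h]; exact hat_thr hsecT
      · right
        simp only at h
        rw [h]; exact hat_thr hsecT
    · rintro ⟨f, g⟩ ⟨hx, h1⟩ ⟨f', g'⟩ ⟨hx', h1'⟩ he
      simp only [Prod.map_apply, Prod.mk.injEq] at he
      have aux : ∀ f g : (A ⊕ Bool) × (B ⊕ Bool), XX D f g → (f = sec ∨ g = sec) → Thr f → f = sec := by
        intro f g hx h ht
        rcases h with h | h
        · exact h
        · subst h; exact absurd hsecT (xx_thr D hx ht)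
      have key : ∀ f f' g g' : (A ⊕ Bool) × (B ⊕ Bool), XX D f g → XX D f' g' → (f = sec ∨ g = sec) →
          (f' = sec ∨ g' = sec) → hat f = hat f' → f = f' := by
        intro f f' g g' hx hx' h h' he
        by_cases ht : Thr f ∧ Thr f'
        · rw [aux f g hx h ht.1, aux f' g' hx' h' ht.2]
        · exact hat_inj (hat_inn hx'.1) he ht
      exact Prod.ext (key f f' g g' hx hx' h1 h1' he.1)
        (key g g' f f' (xx_symm D hx) (xx_symm D hx') h1.symm h1'.symm he.2)

/-- embedding of the tripartite graph -/
def triMap (m n : ℕ) : (Σ i : Fin 3, ![Fin 2, Fin m, Fin n] i) → Bool ⊕ (Fin m ⊕ Fin n)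
  | ⟨0, (i : Fin 2)⟩ => Sum.inl (decide (i = 1))
  | ⟨1, (a : Fin m)⟩ => Sum.inr (Sum.inl a)
  | ⟨2, (b : Fin n)⟩ => Sum.inr (Sum.inr b)

theorem triMap_inj (m n : ℕ) : Function.Injective (triMap m n) := by
  rintro ⟨i, x⟩ ⟨j, y⟩ h
  fin_cases i <;> fin_cases j <;> simp [triMap] at h
  · change Fin 2 at x
    change Fin 2 at y
    have : x = y := by
      revert h; revert x y; decide
    rw [this]
  · rw [show x = y from Sum.inl.inj h]
  · rw [show x = y from Sum.inr.inj h]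

theorem cls_inl {A B : Type*} (k : Bool) :
    cls (Sum.inl k : Bool ⊕ (A ⊕ B)) ≠ 2 ∧ cls (Sum.inl k : Bool ⊕ (A ⊕ B)) ≠ 3 := by
  cases k <;> simp [cls]

theorem cls_A {A B : Type*} (a : A) : cls (Sum.inr (Sum.inl a) : Bool ⊕ (A ⊕ B)) = 2 := rfl
theorem cls_B {A B : Type*} (a : B) : cls (Sum.inr (Sum.inr a) : Bool ⊕ (A ⊕ B)) = 3 := rfl

theorem tri_le (m n : ℕ) (D : PlaneSys (G4 (Fin m) (Fin n))) :
    2 * crossingNumber (triK 2 m n) + (midSet D).ncard ≤ D.cr2 := by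
  have hadj : ∀ a b, (triK 2 m n).Adj a b → (G4 (Fin m) (Fin n)).Adj (triMap m n a) (triMap m n b) := by
    rintro ⟨i, x⟩ ⟨j, y⟩ h
    replace h : i ≠ j := h
    fin_cases i <;> fin_cases j <;> simp only [ne_eq, not_true_eq_false] at h
    · exact (cls_inl _).1
    · exact (cls_inl _).2
    · exact (cls_inl _).1.symm
    · exact show (2 : Fin 4) ≠ 3 by decide
    · exact (cls_inl _).2.symm
    · exact show (3 : Fin 4) ≠ 2 by decide
  obtain ⟨S, hS⟩ := D.comap (triMap m n) (triMap_inj m n) hadj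
  have hfin : Finite (Σ i : Fin 3, ![Fin 2, Fin m, Fin n] i) := Finite.of_injective _ (triMap_inj m n)
  have hc := crossingNumber_le S
  have hno : s(Sum.inl false, Sum.inl true) ∉ Sym2.map (triMap m n) '' (triK 2 m n).edgeSet := by
    rintro ⟨e, he, h⟩
    induction e using Sym2.ind with
    | _ a b =>
      obtain ⟨i, x⟩ := a
      obtain ⟨j, y⟩ := b
      replace he : i ≠ j := he
      rw [Sym2.map_mk] at h
      fin_cases i <;> fin_cases j <;> simp [triMap] at h he
  refine (Nat.add_le_add_right (hc.trans hS) _).trans ?_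
  rw [← Set.ncard_union_eq ?_ (Set.toFinite _) (Set.toFinite _)]
  · refine Set.ncard_le_ncard ?_ (Set.toFinite _)
    rintro p (h | h)
    · exact h.1
    · exact h.1
  · rw [Set.disjoint_left]
    rintro p ⟨-, h1, h2⟩ ⟨-, h3 | h3⟩
    · rw [h3] at h1; exact hno h1
    · rw [h3] at h2; exact hno h2

theorem lower_bound (m n a : ℕ) (hm : m = 2 * a + 1) (hn : 0 < n)
    (hZ : ∀ a b : ℕ, 0 < a → 0 < b → crossingNumber (bipK a b) = Z a b)
    (hT : crossingNumber (triK 2 m n) = Z (m + 2) (n + 2) - m * n)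
    (D : PlaneSys (G4 (Fin m) (Fin n))) (T : ℕ) (hD : D.cr2 = 2 * T) :
    Z (m + 2) (n + 2) - m * n + (m / 2) * (n / 2) ≤ T := by
  obtain ⟨P⟩ := exists_opnPair D.toQD
  have h1 := xx_le D
  have h2 := tri_le m n D
  rw [hT] at h2
  obtain ⟨b, hb | hb⟩ := Nat.even_or_odd' n
  · have h3 := count_even P b (by simpa using hb) (fun f g h => (D.toQD.X_ne f g h).2.1)
    rw [Fintype.card_fin, Fintype.card_fin, hZ _ _ (by omega) (by omega)] at h3
    have hb0 : 0 < b := by omega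
    obtain ⟨c, rfl⟩ : ∃ c, b = c + 1 := ⟨b - 1, by omega⟩
    have z1 : Z (m + 2) (n + 1) = (a + 1) ^ 2 * (c + 1) ^ 2 := by
      unfold Z
      rw [show (m + 2) / 2 = a + 1 by omega, show (m + 2 - 1) / 2 = a + 1 by omega,
        show (n + 1) / 2 = c + 1 by omega, show (n + 1 - 1) / 2 = c + 1 by omega]
      ring
    have z2 : Z (m + 2) (n + 2) = (a + 1) ^ 2 * ((c + 2) * (c + 1)) := by
      unfold Z
      rw [show (m + 2) / 2 = a + 1 by omega, show (m + 2 - 1) / 2 = a + 1 by omega,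
        show (n + 2) / 2 = c + 2 by omega, show (n + 2 - 1) / 2 = c + 1 by omega]
      ring
    rw [z1] at h3
    rw [z2] at h2 ⊢
    rw [show m / 2 = a by omega, show n / 2 = c + 1 by omega]
    have h4 : 2 * ((a + 1) ^ 2 * ((c + 2) * (c + 1))) ≤ Set.ncard {p : ((Fin m ⊕ Bool) × (Fin n ⊕ Bool)) × ((Fin m ⊕ Bool) × (Fin n ⊕ Bool)) |
        XX D p.1 p.2} +
        2 * ((m + 1) * (c + 1)) := by
      refine le_of_mul_le_mul_left (?_ : 2 * (c + 1) * _ ≤ 2 * (c + 1) * _) (by omega)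
      nlinarith
    have h5 : m * n ≤ (a + 1) ^ 2 * ((c + 2) * (c + 1)) := by
      rw [hm, hb]
      exact Nat.mul_le_mul (by nlinarith) (by nlinarith)
    have h6 : m * n = 4 * (a * c) + 2 * c + 4 * a + 2 := by rw [hm, hb]; ring
    have h7 : (m + 1) * (c + 1) = 2 * (a * c) + 2 * c + 2 * a + 2 := by rw [hm]; ring
    have h8 : a * (c + 1) = a * c + a := by ring
    omega
  · have h3 := count_odd P b (by simpa using hb)
    rw [Fintype.card_fin, Fintype.card_fin, hZ _ _ (by omega) (by omega)] at h3
    have z2 : Z (m + 2) (n + 2) = (a + 1) ^ 2 * (b + 1) ^ 2 := by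
      unfold Z
      rw [show (m + 2) / 2 = a + 1 by omega, show (m + 2 - 1) / 2 = a + 1 by omega,
        show (n + 2) / 2 = b + 1 by omega, show (n + 2 - 1) / 2 = b + 1 by omega]
      ring
    rw [z2] at h2 h3 ⊢
    rw [show m / 2 = a by omega, show n / 2 = b by omega]
    have h5 : m * n ≤ (a + 1) ^ 2 * (b + 1) ^ 2 := by
      rw [hm, hb]
      exact Nat.mul_le_mul (by nlinarith) (by nlinarith)
    have h6 : m * n = 4 * (a * b) + 2 * b + 2 * a + 1 := by rw [hm, hb]; ring
    have h7 : 2 * (m + 1) * (b + 1) = 4 * (a * b) + 4 * b + 4 * a + 4 := by rw [hm]; ring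
    omega
end Lower



/-! ### Book drawings -/

section Book

/-- a parabola arc -/
def Par (σ p q : ℝ) : Set ℂ := {z | p ≤ z.re ∧ z.re ≤ q ∧ z.im = σ * ((z.re - p) * (q - z.re))}

theorem par_arc (σ : ℝ) {p q : ℝ} (h : p < q) : IsArc (Par σ p q) p q := by
  have := IsArc.of_path (γ := fun x : ℝ => (⟨x, σ * ((x - p) * (q - x))⟩ : ℂ)) h ?_ ?_
  · have e1 : (⟨p, σ * ((p - p) * (q - p))⟩ : ℂ) = p := by
      apply Complex.ext <;> simp
    have e2 : (⟨q, σ * ((q - p) * (q - q))⟩ : ℂ) = q := by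
      apply Complex.ext <;> simp
    simp only [e1, e2] at this
    convert this using 1
    ext z
    constructor
    · rintro ⟨h1, h2, h3⟩
      exact ⟨z.re, ⟨h1, h2⟩, Complex.ext rfl h3.symm⟩
    · rintro ⟨x, ⟨h1, h2⟩, rfl⟩
      exact ⟨h1, h2, rfl⟩
  · have : (fun x : ℝ => (⟨x, σ * ((x - p) * (q - x))⟩ : ℂ)) =
        fun x : ℝ => (x : ℂ) + ((σ * ((x - p) * (q - x)) : ℝ) : ℂ) * Complex.I := by
      funext x
      apply Complex.ext <;> simp
    rw [this]
    fun_prop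
  · intro x _ y _ hxy
    exact congrArg Complex.re hxy

theorem par_inter {σ τ p q r s : ℝ} (hσ : σ = 1 ∨ σ = -1) (hτ : τ = 1 ∨ τ = -1)
    (hpq : p < q) (hrs : r < s) (hne : ¬ (p = r ∧ q = s)) {z : ℂ} (h1 : z ∈ Par σ p q)
    (h2 : z ∈ Par τ r s) :
    (z.im = 0 ∧ (z.re = p ∨ z.re = q) ∧ (z.re = r ∨ z.re = s)) ∨
    (σ = τ ∧ ((p < r ∧ r < q ∧ q < s) ∨ (r < p ∧ p < s ∧ s < q))) := by
  obtain ⟨a1, a2, a3⟩ := h1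
  obtain ⟨b1, b2, b3⟩ := h2
  set x := z.re
  have hp1 : 0 ≤ (x - p) * (q - x) := mul_nonneg (by linarith) (by linarith)
  have hp2 : 0 ≤ (x - r) * (s - x) := mul_nonneg (by linarith) (by linarith)
  have zero : (x - p) * (q - x) = 0 → (x - r) * (s - x) = 0 →
      (z.im = 0 ∧ (x = p ∨ x = q) ∧ (x = r ∨ x = s)) := by
    intro h h'
    refine ⟨by rw [a3, h, mul_zero], ?_, ?_⟩
    · rcases mul_eq_zero.1 h with h | h
      · left; linarith
      · right; linarith
    · rcases mul_eq_zero.1 h' with h | h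
      · left; linarith
      · right; linarith
  by_cases hst : σ = τ
  · have heq : (x - p) * (q - x) = (x - r) * (s - x) := by
      rcases hσ with h | h <;> rw [← hst, h] at b3 <;> rw [h] at a3 <;> linarith
    by_cases h0 : (x - p) * (q - x) = 0
    · left; exact zero h0 (heq ▸ h0)
    · right
      refine ⟨hst, ?_⟩
      have hpos : 0 < (x - p) * (q - x) := lt_of_le_of_ne hp1 (Ne.symm h0)
      have xp : p < x := lt_of_le_of_ne a1 (by rintro h; apply h0; rw [← h]; ring)
      have xq : x < q := lt_of_le_of_ne a2 (by rintro h; apply h0; rw [← h]; ring)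
      have h0' : (x - r) * (s - x) ≠ 0 := heq ▸ h0
      have xr : r < x := lt_of_le_of_ne b1 (by rintro h; apply h0'; rw [← h]; ring)
      have xs : x < s := lt_of_le_of_ne b2 (by rintro h; apply h0'; rw [← h]; ring)
      rcases lt_trichotomy p r with h | h | h
      · left
        refine ⟨h, by linarith, ?_⟩
        by_contra hc
        push Not at hc
        nlinarith [mul_pos (sub_pos.2 h) (sub_pos.2 xs), mul_nonneg (sub_nonneg.2 hc) (sub_pos.2 xp).le]
      · exfalso
        apply hne
        refine ⟨h, ?_⟩
        subst h
        have := mul_left_cancel₀ (sub_ne_zero.2 xp.ne') heq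
        linarith
      · right
        refine ⟨h, by linarith, ?_⟩
        by_contra hc
        push Not at hc
        nlinarith [mul_pos (sub_pos.2 h) (sub_pos.2 xq), mul_nonneg (sub_nonneg.2 hc) (sub_pos.2 xr).le]
  · left
    have : (x - p) * (q - x) = -((x - r) * (s - x)) := by
      rcases hσ with h | h <;> rcases hτ with h' | h' <;> rw [h, h'] at hst <;>
        first | (exact absurd rfl hst) | (rw [h] at a3; rw [h'] at b3; linarith)
    exact zero (by linarith) (by linarith)

theorem par_once {σ p q r s : ℝ} (hσ : σ = 1 ∨ σ = -1)
    (h : (p < r ∧ r < q ∧ q < s) ∨ (r < p ∧ p < s ∧ s < q)) {z w : ℂ} (hz : z ∈ Par σ p q)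
    (hz' : z ∈ Par σ r s) (hw : w ∈ Par σ p q) (hw' : w ∈ Par σ r s) : z = w := by
  obtain ⟨a1, a2, a3⟩ := hz
  obtain ⟨b1, b2, b3⟩ := hz'
  obtain ⟨c1, c2, c3⟩ := hw
  obtain ⟨d1, d2, d3⟩ := hw'
  have e1 : (z.re - p) * (q - z.re) = (z.re - r) * (s - z.re) := by
    rcases hσ with h | h <;> rw [h] at a3 b3 <;> linarith
  have e2 : (w.re - p) * (q - w.re) = (w.re - r) * (s - w.re) := by
    rcases hσ with h | h <;> rw [h] at c3 d3 <;> linarith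
  have e3 : (z.re - w.re) * (p + q - r - s) = 0 := by linarith
  have e4 : p + q - r - s ≠ 0 := by
    rcases h with ⟨h1, h2, h3⟩ | ⟨h1, h2, h3⟩
    · apply ne_of_lt; linarith
    · apply ne_of_gt; linarith
  have e5 : z.re = w.re := by
    rcases mul_eq_zero.1 e3 with h | h
    · linarith
    · exact absurd h e4
  exact Complex.ext e5 (by rw [a3, c3, e5])

theorem tri_core {p q r s t u x : ℝ} (hp : 0 < p) (h1 : 4 * p ≤ r) (h2 : 4 * r ≤ t) (h3 : 4 * t ≤ q)
    (h4 : 4 * q ≤ s) (h5 : 4 * s ≤ u) (e1 : (x - p) * (q - x) = (x - r) * (s - x))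
    (e2 : (x - p) * (q - x) = (x - t) * (u - x)) : False := by
  have f1 : (r + s - p - q) * x = r * s - p * q := by linarith
  have f2 : (t + u - p - q) * x = t * u - p * q := by linarith
  have f3 : (r + s - p - q) * (t * u - p * q) = (t + u - p - q) * (r * s - p * q) := by
    rw [← f1, ← f2]; ring
  have hr : 0 < r := by linarith
  have ht : 0 < t := by linarith
  have hq : 0 < q := by linarith
  have hs : 0 < s := by linarith
  have hu : 0 < u := by linarith
  have g1 : 4 * (p * q) ≤ t * u := by
    have := mul_le_mul (show p ≤ t by linarith) (show 4 * q ≤ u by linarith) (by positivity) ht.le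
    linarith
  have g2 : (3 / 4 * s) * (3 / 4 * (t * u)) ≤ (r + s - p - q) * (t * u - p * q) :=
    mul_le_mul (by linarith) (by linarith) (by positivity) (by linarith)
  have g3 : (t + u - p - q) * (r * s - p * q) ≤ u * (r * s) := by
    have : 0 < p * q := by positivity
    have : p * q ≤ r * s := mul_le_mul (by linarith) (by linarith) hq.le hr.le
    exact mul_le_mul (by linarith) (by linarith) (by linarith) hu.le
  have g4 : u * (r * s) * 4 ≤ u * (t * s) := by
    have : 0 < u * s := by positivity
    nlinarith
  have : 0 < u * (t * s) := by positivity
  nlinarith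

theorem par_triple {σ : ℝ} (hσ : σ = 1 ∨ σ = -1) {p q r s t u : ℝ} (P : ℝ → Prop)
    (hP : ∀ a b, P a → P b → a < b → 4 * a ≤ b) (hP0 : ∀ a, P a → 0 < a)
    (Pp : P p) (Pq : P q) (Pr : P r) (Ps : P s) (Pt : P t) (Pu : P u)
    (h1 : (p < r ∧ r < q ∧ q < s) ∨ (r < p ∧ p < s ∧ s < q))
    (h2 : (p < t ∧ t < q ∧ q < u) ∨ (t < p ∧ p < u ∧ u < q))
    (h3 : (r < t ∧ t < s ∧ s < u) ∨ (t < r ∧ r < u ∧ u < s)) {z : ℂ}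
    (hz : z ∈ Par σ p q) (hz' : z ∈ Par σ r s) (hz'' : z ∈ Par σ t u) : False := by
  obtain ⟨a1, a2, a3⟩ := hz
  obtain ⟨b1, b2, b3⟩ := hz'
  obtain ⟨c1, c2, c3⟩ := hz''
  have e1 : (z.re - p) * (q - z.re) = (z.re - r) * (s - z.re) := by
    rcases hσ with h | h <;> rw [h] at a3 b3 <;> linarith
  have e2 : (z.re - p) * (q - z.re) = (z.re - t) * (u - z.re) := by
    rcases hσ with h | h <;> rw [h] at a3 c3 <;> linarith
  have core : ∀ p q r s t u : ℝ, P p → P q → P r → P s → P t → P u → p < r → r < t → t < q → q < s →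
      s < u → (z.re - p) * (q - z.re) = (z.re - r) * (s - z.re) →
      (z.re - p) * (q - z.re) = (z.re - t) * (u - z.re) → False := by
    intro p q r s t u Pp Pq Pr Ps Pt Pu i1 i2 i3 i4 i5 e1 e2
    exact tri_core (hP0 p Pp) (hP _ _ Pp Pr i1) (hP _ _ Pr Pt i2) (hP _ _ Pt Pq i3) (hP _ _ Pq Ps i4)
      (hP _ _ Ps Pu i5) e1 e2
  rcases h1 with ⟨i1, i2, i3⟩ | ⟨i1, i2, i3⟩ <;> rcases h2 with ⟨j1, j2, j3⟩ | ⟨j1, j2, j3⟩ <;>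
    rcases h3 with ⟨k1, k2, k3⟩ | ⟨k1, k2, k3⟩
  · exact core p q r s t u Pp Pq Pr Ps Pt Pu i1 k1 j2 i3 k3 e1 e2
  · exact core p q t u r s Pp Pq Pt Pu Pr Ps j1 k1 i2 j3 k3 e2 e1
  · linarith
  · exact core t u p q r s Pt Pu Pp Pq Pr Ps j1 i1 k2 j3 i3 e2.symm (e2.symm.trans e1)
  · exact core r s p q t u Pr Ps Pp Pq Pt Pu i1 j1 k2 i3 j3 e1.symm (e1.symm.trans e2)
  · linarith
  · exact core r s t u p q Pr Ps Pt Pu Pp Pq k1 j1 i2 k3 j3 (e1.symm.trans e2) e1.symm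
  · exact core t u r s p q Pt Pu Pr Ps Pp Pq k1 i1 j2 k3 i3 (e2.symm.trans e1) e2.symm

end Book



section Book2
variable {V : Type*}

/-- sign of a page -/
noncomputable def sgn2 (b : Bool) : ℝ := if b then 1 else -1

theorem sgn2_or (b : Bool) : sgn2 b = 1 ∨ sgn2 b = -1 := by cases b <;> simp [sgn2]

theorem sgn2_inj {a b : Bool} (h : sgn2 a = sgn2 b) : a = b := by
  cases a <;> cases b <;> simp [sgn2] at h ⊢ <;> norm_num at h

/-- edge curves of a book drawing -/
def bookC (X : V → ℝ) (pg : Sym2 V → Bool) (e : Sym2 V) : Set ℂ :=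
  {z | ∃ a b, e = s(a, b) ∧ X a < X b ∧ z ∈ Par (sgn2 (pg e)) (X a) (X b)}

theorem bookC_mk {X : V → ℝ} (pg : Sym2 V → Bool) {a b : V} (h : X a < X b) :
    bookC X pg s(a, b) = Par (sgn2 (pg s(a, b))) (X a) (X b) := by
  ext z
  constructor
  · rintro ⟨a', b', he, hlt, hz⟩
    rw [Sym2.eq_iff] at he
    rcases he with ⟨rfl, rfl⟩ | ⟨rfl, rfl⟩
    · exact hz
    · exact absurd h (not_lt.2 hlt.le)
  · intro hz
    exact ⟨a, b, rfl, h, hz⟩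

/-- interleaving edges -/
def Interl (X : V → ℝ) (e f : Sym2 V) : Prop :=
  ∃ a b c d, e = s(a, b) ∧ f = s(c, d) ∧ X a < X c ∧ X c < X b ∧ X b < X d

theorem exists_book (G : SimpleGraph V) (X : V → ℝ) (hinj : Function.Injective X)
    (hpos : ∀ v, 0 < X v) (hsep : ∀ a b, X a < X b → 4 * X a ≤ X b) (pg : Sym2 V → Bool) :
    ∃ S : PlaneSys G, ∀ e f, S.Cross e f → pg e = pg f ∧ (Interl X e f ∨ Interl X f e) := by
  have rep : ∀ e ∈ G.edgeSet, ∃ a b, e = s(a, b) ∧ X a < X b := by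
    intro e he
    induction e using Sym2.ind with
    | _ a b =>
      rcases lt_trichotomy (X a) (X b) with h | h | h
      · exact ⟨a, b, rfl, h⟩
      · exact absurd (hinj h) (G.ne_of_adj he)
      · exact ⟨b, a, Sym2.eq_swap, h⟩
  have key : ∀ a b c d, X a < X b → X c < X d → s(a, b) ≠ s(c, d) → ∀ z,
      z ∈ bookC X pg s(a, b) → z ∈ bookC X pg s(c, d) →
      (∃ v, v ∈ s(a, b) ∧ v ∈ s(c, d) ∧ z = (X v : ℂ)) ∨ (pg s(a, b) = pg s(c, d) ∧
        ((X a < X c ∧ X c < X b ∧ X b < X d) ∨ (X c < X a ∧ X a < X d ∧ X d < X b))) := by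
    intro a b c d hab hcd hne z hz hz'
    rw [bookC_mk pg hab] at hz
    rw [bookC_mk pg hcd] at hz'
    have hn : ¬ (X a = X c ∧ X b = X d) := by
      rintro ⟨h, h'⟩
      exact hne (by rw [hinj h, hinj h'])
    rcases par_inter (sgn2_or _) (sgn2_or _) hab hcd hn hz hz' with ⟨h0, h1, h2⟩ | ⟨h1, h2⟩
    · left
      have : ∀ v, z.re = X v → z = (X v : ℂ) := fun v hv => Complex.ext (by simpa using hv) (by simpa using h0)
      have m1 : ∀ v, z.re = X v → v ∈ s(a, b) := by
        intro v hv
        rcases h1 with h | h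
        · rw [hinj (hv.symm.trans h)]; exact Sym2.mem_mk_left _ _
        · rw [hinj (hv.symm.trans h)]; exact Sym2.mem_mk_right _ _
      have m2 : ∀ v, z.re = X v → v ∈ s(c, d) := by
        intro v hv
        rcases h2 with h | h
        · rw [hinj (hv.symm.trans h)]; exact Sym2.mem_mk_left _ _
        · rw [hinj (hv.symm.trans h)]; exact Sym2.mem_mk_right _ _
      rcases h1 with h | h
      · exact ⟨a, m1 a h, m2 a h, this a h⟩
      · exact ⟨b, m1 b h, m2 b h, this b h⟩
    · right
      exact ⟨sgn2_inj h1, h2⟩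
  refine ⟨⟨fun v => (X v : ℂ), bookC X pg, ?_, ?_, ?_, ?_, ?_, ?_⟩, ?_⟩
  · intro a b h
    exact hinj (Complex.ofReal_injective h)
  · intro a b hadj
    rcases lt_trichotomy (X a) (X b) with h | h | h
    · rw [bookC_mk pg h]; exact par_arc _ h
    · exact absurd (hinj h) (G.ne_of_adj hadj)
    · rw [Sym2.eq_swap, bookC_mk pg h]; exact (par_arc _ h).symm
  · intro e he c hc hmem
    obtain ⟨a, b, rfl, hab⟩ := rep e he
    rw [bookC_mk pg hab] at hmem
    obtain ⟨h1, h2, h3⟩ := hmem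
    simp only [Complex.ofReal_re, Complex.ofReal_im] at h1 h2 h3
    have : (X c - X a) * (X b - X c) = 0 := by
      rcases sgn2_or (pg s(a, b)) with h | h <;> rw [h] at h3 <;> linarith
    rcases mul_eq_zero.1 this with h | h
    · exact hc (by rw [hinj (sub_eq_zero.1 h)]; exact Sym2.mem_mk_left _ _)
    · exact hc (by rw [← hinj (sub_eq_zero.1 h)]; exact Sym2.mem_mk_right _ _)
  · intro e he f hf hne v hv hv' z hz
    obtain ⟨a, b, rfl, hab⟩ := rep e he
    obtain ⟨c, d, rfl, hcd⟩ := rep f hf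
    rcases key a b c d hab hcd hne z hz.1 hz.2 with ⟨w, hw, hw', hzw⟩ | ⟨-, h⟩
    · have : w = v := by
        by_contra hwv
        apply hne
        rw [(Sym2.mem_and_mem_iff hwv).1 ⟨hw, hv⟩, (Sym2.mem_and_mem_iff hwv).1 ⟨hw', hv'⟩]
      rw [hzw, this]; rfl
    · exfalso
      rw [Sym2.mem_iff] at hv hv'
      rcases hv with rfl | rfl <;> rcases hv' with rfl | rfl <;>
        rcases h with ⟨h1, h2, h3⟩ | ⟨h1, h2, h3⟩ <;> linarith
  · intro e he f hf hdis z hz w hw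
    obtain ⟨a, b, rfl, hab⟩ := rep e he
    obtain ⟨c, d, rfl, hcd⟩ := rep f hf
    have hne : s(a, b) ≠ s(c, d) := fun h => hdis a (Sym2.mem_mk_left _ _) (h ▸ Sym2.mem_mk_left _ _)
    rcases key a b c d hab hcd hne z hz.1 hz.2 with ⟨v, hv, hv', -⟩ | ⟨hp, h⟩
    · exact absurd hv' (hdis v hv)
    · rw [bookC_mk pg hab, bookC_mk pg hcd, ← hp] at hz hw
      exact par_once (sgn2_or _) h hz.1 hz.2 hw.1 hw.2
  · intro e he f hf g hg hef heg hfg z hz1 hz2 hz3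
    obtain ⟨a, b, rfl, hab⟩ := rep e he
    obtain ⟨c, d, rfl, hcd⟩ := rep f hf
    obtain ⟨i, j, rfl, hij⟩ := rep g hg
    rcases key a b c d hab hcd hef z hz1 hz2 with ⟨v, -, -, h⟩ | ⟨p1, k1⟩
    · exact ⟨v, h⟩
    rcases key a b i j hab hij heg z hz1 hz3 with ⟨v, -, -, h⟩ | ⟨p2, k2⟩
    · exact ⟨v, h⟩
    rcases key c d i j hcd hij hfg z hz2 hz3 with ⟨v, -, -, h⟩ | ⟨p3, k3⟩
    · exact ⟨v, h⟩
    exfalso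
    rw [bookC_mk pg hab] at hz1
    rw [bookC_mk pg hcd, ← p1] at hz2
    rw [bookC_mk pg hij, ← p2] at hz3
    refine par_triple (sgn2_or _) (fun x => ∃ v, x = X v) ?_ ?_ ⟨a, rfl⟩ ⟨b, rfl⟩ ⟨c, rfl⟩ ⟨d, rfl⟩
      ⟨i, rfl⟩ ⟨j, rfl⟩ k1 k2 k3 hz1 hz2 hz3
    · rintro _ _ ⟨v, rfl⟩ ⟨w, rfl⟩ h
      exact hsep v w h
    · rintro _ ⟨v, rfl⟩
      exact hpos v
  · rintro e f ⟨he, hf, hdis, z, hz, hz'⟩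
    obtain ⟨a, b, rfl, hab⟩ := rep e he
    obtain ⟨c, d, rfl, hcd⟩ := rep f hf
    have hne : s(a, b) ≠ s(c, d) := fun h => hdis a (Sym2.mem_mk_left _ _) (h ▸ Sym2.mem_mk_left _ _)
    rcases key a b c d hab hcd hne z hz hz' with ⟨v, hv, hv', -⟩ | ⟨hp, h⟩
    · exact absurd hv' (hdis v hv)
    · refine ⟨hp, ?_⟩
      rcases h with h | h
      · exact Or.inl ⟨a, b, c, d, rfl, rfl, h⟩
      · exact Or.inr ⟨c, d, a, b, rfl, rfl, h⟩

/-- integer positions -/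
theorem exists_book_nat [Finite V] (G : SimpleGraph V) (pos : V → ℕ) (hinj : Function.Injective pos)
    (pg : Sym2 V → Bool) :
    ∃ S : PlaneSys G, S.cr2 ≤ 2 * Set.ncard {q : (V × V) × (V × V) | G.Adj q.1.1 q.1.2 ∧
      G.Adj q.2.1 q.2.2 ∧ pg s(q.1.1, q.1.2) = pg s(q.2.1, q.2.2) ∧
      pos q.1.1 < pos q.2.1 ∧ pos q.2.1 < pos q.1.2 ∧ pos q.1.2 < pos q.2.2} := by
  have hlt : ∀ a b, (4 : ℝ) ^ pos a < 4 ^ pos b → pos a < pos b := by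
    intro a b h
    exact (pow_lt_pow_iff_right₀ (by norm_num)).1 h
  obtain ⟨S, hS⟩ := exists_book G (fun v => (4 : ℝ) ^ pos v) (fun a b h => hinj
    (pow_right_injective₀ (by norm_num) (by norm_num) h)) (fun v => by positivity) (by
      intro a b h
      have := hlt a b h
      rw [← pow_succ']
      exact pow_le_pow_right₀ (by norm_num) this) pg
  refine ⟨S, ?_⟩
  let F : Set ((V × V) × (V × V)) := {q | G.Adj q.1.1 q.1.2 ∧
      G.Adj q.2.1 q.2.2 ∧ pg s(q.1.1, q.1.2) = pg s(q.2.1, q.2.2) ∧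
      pos q.1.1 < pos q.2.1 ∧ pos q.2.1 < pos q.1.2 ∧ pos q.1.2 < pos q.2.2}
  have hsub : {p : Sym2 V × Sym2 V | S.Cross p.1 p.2} ⊆
      (fun q : (V × V) × (V × V) => (s(q.1.1, q.1.2), s(q.2.1, q.2.2))) '' F ∪
      (fun q : (V × V) × (V × V) => (s(q.2.1, q.2.2), s(q.1.1, q.1.2))) '' F := by
    rintro ⟨e, f⟩ hc
    obtain ⟨hp, ⟨a, b, c, d, h1, h2, h3, h4, h5⟩ | ⟨a, b, c, d, h1, h2, h3, h4, h5⟩⟩ := hS e f hc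
    · left
      refine ⟨((a, b), (c, d)), ⟨?_, ?_, ?_, hlt _ _ h3, hlt _ _ h4, hlt _ _ h5⟩, ?_⟩
      · have := hc.1; simp only [h1] at this; exact this
      · have := hc.2.1; simp only [h2] at this; exact this
      · simpa only [h1, h2] using hp
      · simp only [h1, h2]
    · right
      refine ⟨((a, b), (c, d)), ⟨?_, ?_, ?_, hlt _ _ h3, hlt _ _ h4, hlt _ _ h5⟩, ?_⟩
      · have := hc.2.1; simp only [h1] at this; exact this
      · have := hc.1; simp only [h2] at this; exact this
      · simpa only [h1, h2] using hp.symm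
      · simp only [h1, h2]
  refine (Set.ncard_le_ncard hsub (Set.toFinite _)).trans ((Set.ncard_union_le _ _).trans ?_)
  rw [two_mul]
  exact Nat.add_le_add (Set.ncard_image_le (Set.toFinite _)) (Set.ncard_image_le (Set.toFinite _))

end Book2



/-! ### The upper bound -/

section Upper

/-- part of a block -/
def clsb : Fin 6 → Fin 4 := ![2, 0, 3, 1, 2, 3]

/-- page of a pair of blocks -/
def pI (s t : Fin 6) : Bool :=
  decide ((s, t) ∈ ([(0, 5), (2, 4), (0, 1), (1, 4), (1, 5), (1, 2)] : List (Fin 6 × Fin 6)) ∨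
    (t, s) ∈ ([(0, 5), (2, 4), (0, 1), (1, 4), (1, 5), (1, 2)] : List (Fin 6 × Fin 6)))

theorem pI_symm (s t : Fin 6) : pI s t = pI t s := by
  unfold pI
  simp only [or_comm]

/-- the list of crossing patterns -/
def patt : List (Fin 6 × Fin 6 × Fin 6 × Fin 6) :=
  [(0, 0, 5, 5), (0, 1, 5, 5), (2, 2, 4, 4), (0, 0, 1, 5), (1, 2, 4, 4), (1, 2, 2, 4),
   (0, 0, 2, 2), (0, 0, 2, 3), (0, 2, 2, 3), (0, 1, 2, 3), (4, 4, 5, 5), (3, 4, 4, 5), (3, 4, 5, 5)]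

set_option maxRecDepth 100000 in
theorem patt_complete : ∀ t1 t2 t3 t4 : Fin 6, t1 ≤ t2 → t2 ≤ t3 → t3 ≤ t4 →
    clsb t1 ≠ clsb t3 → clsb t2 ≠ clsb t4 → pI t1 t3 = pI t2 t4 →
    (t1 = t2 → t1 ≠ 1 ∧ t1 ≠ 3) → (t2 = t3 → t2 ≠ 1 ∧ t2 ≠ 3) → (t3 = t4 → t3 ≠ 1 ∧ t3 ≠ 3) →
    (t1, t2, t3, t4) ∈ patt := by
  decide

/-- increasing pairs below `k` -/
def Prs (k : ℕ) : Finset (ℕ × ℕ) := (Finset.range k ×ˢ Finset.range k).filter fun p => p.1 < p.2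

theorem mem_Prs {k i j : ℕ} : (i, j) ∈ Prs k ↔ i < j ∧ j < k := by
  simp [Prs]; omega

theorem card_Prs (k : ℕ) : (Prs k).card = k.choose 2 := by
  induction k with
  | zero => rfl
  | succ k ih =>
    have : Prs (k + 1) = Prs k ∪ (Finset.range k).image (fun i => (i, k)) := by
      ext ⟨i, j⟩
      simp only [Finset.mem_union, mem_Prs, Finset.mem_image, Finset.mem_range, Prod.mk.injEq]
      constructor
      · intro h
        by_cases hj : j < k
        · left; omega
        · right; exact ⟨i, by omega, rfl, by omega⟩
      · rintro (h | ⟨a, h1, h2, h3⟩) <;> omega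
    rw [this, Finset.card_union_of_disjoint, ih, Finset.card_image_of_injective, Finset.card_range,
      Nat.choose_succ_succ' k 1, Nat.choose_one_right]
    · ring
    · intro a b h; simpa using h
    · rw [Finset.disjoint_left]
      rintro ⟨i, j⟩ h h'
      rw [mem_Prs] at h
      simp at h'
      omega

/-- vertex codes -/
abbrev Cd := Fin 6 × ℕ

/-- quadruples with two pairs -/
def U22 (s t : Fin 6) (k l : ℕ) : Finset (Cd × Cd × Cd × Cd) :=
  (Prs k ×ˢ Prs l).image fun p => ((s, p.1.1), (s, p.1.2), (t, p.2.1), (t, p.2.2))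

/-- quadruples with a pair in front -/
def U2 (s t u : Fin 6) (k l r : ℕ) : Finset (Cd × Cd × Cd × Cd) :=
  (Prs k ×ˢ (Finset.range l ×ˢ Finset.range r)).image
    fun p => ((s, p.1.1), (s, p.1.2), (t, p.2.1), (u, p.2.2))

/-- quadruples with a pair in the middle -/
def U12 (s t u : Fin 6) (k l r : ℕ) : Finset (Cd × Cd × Cd × Cd) :=
  (Prs k ×ˢ (Finset.range l ×ˢ Finset.range r)).image
    fun p => ((s, p.2.1), (t, p.1.1), (t, p.1.2), (u, p.2.2))

/-- quadruples with a pair at the end -/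
def U112 (s t u : Fin 6) (k l r : ℕ) : Finset (Cd × Cd × Cd × Cd) :=
  (Prs k ×ˢ (Finset.range l ×ˢ Finset.range r)).image
    fun p => ((s, p.2.1), (t, p.2.2), (u, p.1.1), (u, p.1.2))

/-- quadruples without pairs -/
def U1 (k l : ℕ) : Finset (Cd × Cd × Cd × Cd) :=
  (Finset.range k ×ˢ Finset.range l).image fun p => ((0, p.1), (1, 0), (2, p.2), (3, 0))

theorem card_U22 (s t : Fin 6) (k l : ℕ) : (U22 s t k l).card ≤ k.choose 2 * l.choose 2 := by
  refine Finset.card_image_le.trans ?_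
  rw [Finset.card_product, card_Prs, card_Prs]

theorem card_U2 (s t u : Fin 6) (k l r : ℕ) : (U2 s t u k l r).card ≤ k.choose 2 * (l * r) := by
  refine Finset.card_image_le.trans ?_
  rw [Finset.card_product, card_Prs, Finset.card_product, Finset.card_range, Finset.card_range]

theorem card_U12 (s t u : Fin 6) (k l r : ℕ) : (U12 s t u k l r).card ≤ k.choose 2 * (l * r) := by
  refine Finset.card_image_le.trans ?_
  rw [Finset.card_product, card_Prs, Finset.card_product, Finset.card_range, Finset.card_range]

theorem card_U112 (s t u : Fin 6) (k l r : ℕ) : (U112 s t u k l r).card ≤ k.choose 2 * (l * r) := by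
  refine Finset.card_image_le.trans ?_
  rw [Finset.card_product, card_Prs, Finset.card_product, Finset.card_range, Finset.card_range]

theorem card_U1 (k l : ℕ) : (U1 k l).card ≤ k * l := by
  refine Finset.card_image_le.trans ?_
  rw [Finset.card_product, Finset.card_range, Finset.card_range]

/-- all crossing quadruples -/
def UU (a1 a2 b1 b2 : ℕ) : Finset (Cd × Cd × Cd × Cd) :=
  U22 0 5 a1 b1 ∪ (U112 0 1 5 b1 a1 1 ∪ (U22 2 4 b2 a2 ∪ (U2 0 1 5 a1 1 b1 ∪ (U112 1 2 4 a2 1 b2 ∪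
  (U12 1 2 4 b2 1 a2 ∪ (U22 0 2 a1 b2 ∪ (U2 0 2 3 a1 b2 1 ∪ (U12 0 2 3 b2 a1 1 ∪ (U1 a1 b2 ∪
  (U22 4 5 a2 b1 ∪ (U12 3 4 5 a2 1 b1 ∪ U112 3 4 5 b1 1 a2)))))))))))

theorem card_add_le {s t : Finset (Cd × Cd × Cd × Cd)} {x y : ℕ} (hs : s.card ≤ x) (ht : t.card ≤ y) :
    (s ∪ t).card ≤ x + y :=
  (Finset.card_union_le _ _).trans (Nat.add_le_add hs ht)

theorem card_UU (a1 a2 b1 b2 : ℕ) : (UU a1 a2 b1 b2).card ≤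
    (a1.choose 2 + a2.choose 2) * (b1.choose 2 + b2.choose 2) + (b1 + b2) * (a1.choose 2 + a2.choose 2) +
    (a1 + a2) * (b1.choose 2 + b2.choose 2) + a1 * b2 := by
  refine (card_add_le (card_U22 _ _ _ _) (card_add_le (card_U112 _ _ _ _ _ _) (card_add_le
    (card_U22 _ _ _ _) (card_add_le (card_U2 _ _ _ _ _ _) (card_add_le (card_U112 _ _ _ _ _ _)
    (card_add_le (card_U12 _ _ _ _ _ _) (card_add_le (card_U22 _ _ _ _) (card_add_le
    (card_U2 _ _ _ _ _ _) (card_add_le (card_U12 _ _ _ _ _ _) (card_add_le (card_U1 _ _)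
    (card_add_le (card_U22 _ _ _ _) (card_add_le (card_U12 _ _ _ _ _ _)
    (card_U112 _ _ _ _ _ _))))))))))))).trans (le_of_eq ?_)
  ring

/-- block sizes -/
def szb (a1 a2 b1 b2 : ℕ) : Fin 6 → ℕ := ![a1, 1, b2, 1, a2, b1]

theorem mem_UU {a1 a2 b1 b2 : ℕ} {p q r s : Cd}
    (hp : p.2 < szb a1 a2 b1 b2 p.1) (hq : q.2 < szb a1 a2 b1 b2 q.1)
    (hr : r.2 < szb a1 a2 b1 b2 r.1) (hs : s.2 < szb a1 a2 b1 b2 s.1)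
    (h1 : p.1 ≤ q.1) (h1' : p.1 = q.1 → p.2 < q.2) (h2 : q.1 ≤ r.1) (h2' : q.1 = r.1 → q.2 < r.2)
    (h3 : r.1 ≤ s.1) (h3' : r.1 = s.1 → r.2 < s.2) (c1 : clsb p.1 ≠ clsb r.1) (c2 : clsb q.1 ≠ clsb s.1)
    (hpg : pI p.1 r.1 = pI q.1 s.1) : (p, q, r, s) ∈ UU a1 a2 b1 b2 := by
  obtain ⟨t1, i1⟩ := p
  obtain ⟨t2, i2⟩ := q
  obtain ⟨t3, i3⟩ := r
  obtain ⟨t4, i4⟩ := s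
  simp only at *
  have aux : ∀ t t' : Fin 6, ∀ i i' : ℕ, i' < szb a1 a2 b1 b2 t' → (t = t' → i < i') →
      t = t' → t ≠ 1 ∧ t ≠ 3 := by
    intro t t' i i' hi hlt he
    have := hlt he
    constructor <;> rintro rfl <;> subst he <;> simp [szb] at hi <;> omega
  have hm := patt_complete t1 t2 t3 t4 h1 h2 h3 c1 c2 hpg (aux t1 t2 i1 i2 hq h1') (aux t2 t3 i2 i3 hr h2')
    (aux t3 t4 i3 i4 hs h3')
  simp only [patt, List.mem_cons, Prod.mk.injEq, List.not_mem_nil, or_false] at hm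
  simp only [UU, Finset.mem_union]
  have m22 : ∀ s t k l, i1 < i2 → i2 < k → i3 < i4 → i4 < l →
      ((s, i1), (s, i2), (t, i3), (t, i4)) ∈ U22 s t k l := by
    intro s t k l e1 e2 e3 e4
    exact Finset.mem_image.2 ⟨((i1, i2), (i3, i4)), Finset.mem_product.2 ⟨mem_Prs.2 ⟨e1, e2⟩,
      mem_Prs.2 ⟨e3, e4⟩⟩, rfl⟩
  have m2 : ∀ s t u k l r, i1 < i2 → i2 < k → i3 < l → i4 < r →
      ((s, i1), (s, i2), (t, i3), (u, i4)) ∈ U2 s t u k l r := by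
    intro s t u k l r e1 e2 e3 e4
    exact Finset.mem_image.2 ⟨((i1, i2), (i3, i4)), Finset.mem_product.2 ⟨mem_Prs.2 ⟨e1, e2⟩,
      Finset.mem_product.2 ⟨Finset.mem_range.2 e3, Finset.mem_range.2 e4⟩⟩, rfl⟩
  have m12 : ∀ s t u k l r, i2 < i3 → i3 < k → i1 < l → i4 < r →
      ((s, i1), (t, i2), (t, i3), (u, i4)) ∈ U12 s t u k l r := by
    intro s t u k l r e1 e2 e3 e4
    exact Finset.mem_image.2 ⟨((i2, i3), (i1, i4)), Finset.mem_product.2 ⟨mem_Prs.2 ⟨e1, e2⟩,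
      Finset.mem_product.2 ⟨Finset.mem_range.2 e3, Finset.mem_range.2 e4⟩⟩, rfl⟩
  have m112 : ∀ s t u k l r, i3 < i4 → i4 < k → i1 < l → i2 < r →
      ((s, i1), (t, i2), (u, i3), (u, i4)) ∈ U112 s t u k l r := by
    intro s t u k l r e1 e2 e3 e4
    exact Finset.mem_image.2 ⟨((i3, i4), (i1, i2)), Finset.mem_product.2 ⟨mem_Prs.2 ⟨e1, e2⟩,
      Finset.mem_product.2 ⟨Finset.mem_range.2 e3, Finset.mem_range.2 e4⟩⟩, rfl⟩
  rcases hm with ⟨rfl, rfl, rfl, rfl⟩ | ⟨rfl, rfl, rfl, rfl⟩ | ⟨rfl, rfl, rfl, rfl⟩ | ⟨rfl, rfl, rfl, rfl⟩ |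
    ⟨rfl, rfl, rfl, rfl⟩ | ⟨rfl, rfl, rfl, rfl⟩ | ⟨rfl, rfl, rfl, rfl⟩ | ⟨rfl, rfl, rfl, rfl⟩ |
    ⟨rfl, rfl, rfl, rfl⟩ | ⟨rfl, rfl, rfl, rfl⟩ | ⟨rfl, rfl, rfl, rfl⟩ | ⟨rfl, rfl, rfl, rfl⟩ |
    ⟨rfl, rfl, rfl, rfl⟩
  · iterate 0 right
    left; exact m22 _ _ _ _ (h1' rfl) hq (h3' rfl) hs
  · iterate 1 right
    left; exact m112 _ _ _ _ _ _ (h3' rfl) hs hp hq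
  · iterate 2 right
    left; exact m22 _ _ _ _ (h1' rfl) hq (h3' rfl) hs
  · iterate 3 right
    left; exact m2 _ _ _ _ _ _ (h1' rfl) hq hr hs
  · iterate 4 right
    left; exact m112 _ _ _ _ _ _ (h3' rfl) hs hp hq
  · iterate 5 right
    left; exact m12 _ _ _ _ _ _ (h2' rfl) hr hp hs
  · iterate 6 right
    left; exact m22 _ _ _ _ (h1' rfl) hq (h3' rfl) hs
  · iterate 7 right
    left; exact m2 _ _ _ _ _ _ (h1' rfl) hq hr hs
  · iterate 8 right
    left; exact m12 _ _ _ _ _ _ (h2' rfl) hr hp hs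
  · iterate 9 right
    left
    have e2 : i2 = 0 := Nat.lt_one_iff.1 hq
    have e4 : i4 = 0 := Nat.lt_one_iff.1 hs
    subst e2 e4
    exact Finset.mem_image.2 ⟨(i1, i3), Finset.mem_product.2 ⟨Finset.mem_range.2 hp,
      Finset.mem_range.2 hr⟩, rfl⟩
  · iterate 10 right
    left; exact m22 _ _ _ _ (h1' rfl) hq (h3' rfl) hs
  · iterate 11 right
    left; exact m12 _ _ _ _ _ _ (h2' rfl) hr hp hs
  · iterate 12 right
    exact m112 _ _ _ _ _ _ (h3' rfl) hs hp hq

/-- code of a vertex -/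
def code (m n : ℕ) : Bool ⊕ (Fin m ⊕ Fin n) → Cd
  | Sum.inl false => (1, 0)
  | Sum.inl true => (3, 0)
  | Sum.inr (Sum.inl a) => if a.1 < m / 2 then (0, a.1) else (4, a.1 - m / 2)
  | Sum.inr (Sum.inr b) => if b.1 < n / 2 then (2, b.1) else (5, b.1 - n / 2)

theorem code_inj (m n : ℕ) : Function.Injective (code m n) := by
  rintro ((_ | _) | a | b) ((_ | _) | a' | b') h <;> simp only [code] at h <;>
    (try split_ifs at h) <;> simp [Prod.ext_iff] at h ⊢ <;> (try apply Fin.ext) <;> omega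

theorem code_cls (m n : ℕ) (v : Bool ⊕ (Fin m ⊕ Fin n)) : clsb (code m n v).1 = cls v := by
  rcases v with ((_ | _) | a | b)
  · rfl
  · rfl
  · simp only [code]; split_ifs <;> rfl
  · simp only [code]; split_ifs <;> rfl

theorem code_sz (m n : ℕ) (v : Bool ⊕ (Fin m ⊕ Fin n)) :
    (code m n v).2 < szb (m / 2) (m - m / 2) (n - n / 2) (n / 2) (code m n v).1 := by
  rcases v with ((_ | _) | a | b)
  · exact Nat.zero_lt_one
  · exact Nat.zero_lt_one
  · simp only [code]; split_ifs with h
    · exact h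
    · have := a.2
      change a.1 - m / 2 < m - m / 2
      omega
  · simp only [code]; split_ifs with h
    · exact h
    · have := b.2
      change b.1 - n / 2 < n - n / 2
      omega

theorem code_lt (m n : ℕ) (v : Bool ⊕ (Fin m ⊕ Fin n)) : (code m n v).2 < m + n + 1 := by
  rcases v with ((_ | _) | a | b)
  · exact Nat.succ_pos _
  · exact Nat.succ_pos _
  · have := a.2
    simp only [code]; split_ifs with h <;> simp only <;> omega
  · have := b.2
    simp only [code]; split_ifs with h <;> simp only <;> omega

/-- position of a vertex -/
def posn (m n : ℕ) (v : Bool ⊕ (Fin m ⊕ Fin n)) : ℕ :=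
  (code m n v).1.1 * (m + n + 1) + (code m n v).2

theorem posn_lt {m n : ℕ} {v w : Bool ⊕ (Fin m ⊕ Fin n)} (h : posn m n v < posn m n w) :
    (code m n v).1 ≤ (code m n w).1 ∧ ((code m n v).1 = (code m n w).1 →
      (code m n v).2 < (code m n w).2) := by
  have h1 := code_lt m n v
  have h2 := code_lt m n w
  unfold posn at h
  constructor
  · rw [Fin.le_def]
    by_contra hc
    push Not at hc
    nlinarith
  · intro he
    rw [he] at h
    omega

theorem posn_inj (m n : ℕ) : Function.Injective (posn m n) := by
  intro v w h
  have h1 := code_lt m n v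
  have h2 := code_lt m n w
  unfold posn at h
  apply code_inj m n
  have e : (code m n v).1.1 = (code m n w).1.1 := by
    rcases lt_trichotomy (code m n v).1.1 (code m n w).1.1 with hc | hc | hc
    · nlinarith
    · exact hc
    · nlinarith
  rw [e] at h
  exact Prod.ext (Fin.ext e) (by omega)

theorem choose_half (m : ℕ) : (m / 2).choose 2 + (m - m / 2).choose 2 + m = (m + 2) / 2 * ((m + 2 - 1) / 2) := by
  have h2 : ∀ k : ℕ, k.choose 2 * 2 + k = k * k := by
    intro k
    induction k with
    | zero => rfl
    | succ k ih => rw [Nat.choose_succ_succ' k 1, Nat.choose_one_right]; nlinarith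
  obtain ⟨k, hk | hk⟩ := Nat.even_or_odd' m
  · rw [show m / 2 = k by omega, show m - k = k by omega, show (m + 2) / 2 = k + 1 by omega,
      show (m + 2 - 1) / 2 = k by omega]
    have := h2 k
    nlinarith
  · rw [show m / 2 = k by omega, show m - k = k + 1 by omega, show (m + 2) / 2 = k + 1 by omega,
      show (m + 2 - 1) / 2 = k + 1 by omega]
    have := h2 k
    have := h2 (k + 1)
    nlinarith

theorem upper_bound (m n : ℕ) : ∃ S : PlaneSys (G4 (Fin m) (Fin n)),
    S.cr2 ≤ 2 * (Z (m + 2) (n + 2) - m * n + (m / 2) * (n / 2)) := by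
  let pg : Sym2 (Bool ⊕ (Fin m ⊕ Fin n)) → Bool :=
    Sym2.lift ⟨fun a b => pI (code m n a).1 (code m n b).1, fun a b => pI_symm _ _⟩
  obtain ⟨S, hS⟩ := exists_book_nat (G4 (Fin m) (Fin n)) (posn m n) (posn_inj m n) pg
  refine ⟨S, hS.trans (Nat.mul_le_mul_left 2 ?_)⟩
  have h1 := Set.ncard_le_ncard_of_injOn (s := {q : ((Bool ⊕ (Fin m ⊕ Fin n)) × (Bool ⊕ (Fin m ⊕ Fin n))) ×
      ((Bool ⊕ (Fin m ⊕ Fin n)) × (Bool ⊕ (Fin m ⊕ Fin n))) | (G4 (Fin m) (Fin n)).Adj q.1.1 q.1.2 ∧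
      (G4 (Fin m) (Fin n)).Adj q.2.1 q.2.2 ∧ pg s(q.1.1, q.1.2) = pg s(q.2.1, q.2.2) ∧
      posn m n q.1.1 < posn m n q.2.1 ∧ posn m n q.2.1 < posn m n q.1.2 ∧
      posn m n q.1.2 < posn m n q.2.2})
    (t := (UU (m / 2) (m - m / 2) (n - n / 2) (n / 2) : Set (Cd × Cd × Cd × Cd)))
    (fun q => (code m n q.1.1, code m n q.2.1, code m n q.1.2, code m n q.2.2)) ?_ ?_ (Set.toFinite _)
  · rw [Set.ncard_coe_finset] at h1
    refine h1.trans ((card_UU _ _ _ _).trans ?_)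
    have e1 := choose_half m
    have e2 := choose_half n
    set p := (m / 2).choose 2
    set q := (m - m / 2).choose 2
    set r := (n / 2).choose 2
    set s := (n - n / 2).choose 2
    have e3 : Z (m + 2) (n + 2) = (p + q + m) * (r + s + n) := by
      unfold Z
      rw [e1, e2]; ring
    rw [e3, show m / 2 + (m - m / 2) = m by omega, show n - n / 2 + n / 2 = n by omega]
    have e4 : (p + q + m) * (r + s + n) = (p + q) * (s + r) + n * (p + q) + m * (s + r) + m * n := by ring
    rw [e4, Nat.add_sub_cancel]
  · rintro ⟨⟨a, b⟩, ⟨c, d⟩⟩ ⟨hab, hcd, hpg, o1, o2, o3⟩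
    refine Finset.mem_coe.2 (mem_UU (code_sz m n a) (code_sz m n c) (code_sz m n b) (code_sz m n d)
      (posn_lt o1).1 (posn_lt o1).2 (posn_lt o2).1 (posn_lt o2).2 (posn_lt o3).1 (posn_lt o3).2 ?_ ?_ hpg)
    · rw [code_cls, code_cls]; exact hab
    · rw [code_cls, code_cls]; exact hcd
  · rintro ⟨⟨a, b⟩, ⟨c, d⟩⟩ - ⟨⟨a', b'⟩, ⟨c', d'⟩⟩ - h
    simp only [Prod.mk.injEq] at h
    rw [code_inj m n h.1, code_inj m n h.2.1, code_inj m n h.2.2.1, code_inj m n h.2.2.2]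

end Upper



/-! ### The theorem -/

section Final

theorem cr_mono {V W : Type*} [Finite V] {G : SimpleGraph V} {H : SimpleGraph W}
    (S : PlaneSys G) (φ : W → V) (hφ : Function.Injective φ)
    (hadj : ∀ a b, H.Adj a b → G.Adj (φ a) (φ b)) : crossingNumber H ≤ crossingNumber G := by
  obtain ⟨S1, h1⟩ := crossingNumber_attained S
  obtain ⟨S2, h2⟩ := S1.comap_le φ hφ hadj
  have : Finite W := Finite.of_injective φ hφ
  have := crossingNumber_le S2
  omega

/-- the 4-partite graph inside `G4` -/
def quadMap (m n : ℕ) : (Σ i : Fin 4, ![Fin 1, Fin 1, Fin m, Fin n] i) → Bool ⊕ (Fin m ⊕ Fin n)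
  | ⟨0, _⟩ => Sum.inl false
  | ⟨1, _⟩ => Sum.inl true
  | ⟨2, (a : Fin m)⟩ => Sum.inr (Sum.inl a)
  | ⟨3, (b : Fin n)⟩ => Sum.inr (Sum.inr b)

/-- the inverse of `quadMap` -/
def quadInv (m n : ℕ) : Bool ⊕ (Fin m ⊕ Fin n) → (Σ i : Fin 4, ![Fin 1, Fin 1, Fin m, Fin n] i)
  | Sum.inl false => ⟨0, (0 : Fin 1)⟩
  | Sum.inl true => ⟨1, (0 : Fin 1)⟩
  | Sum.inr (Sum.inl a) => ⟨2, a⟩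
  | Sum.inr (Sum.inr b) => ⟨3, b⟩

theorem quadInv_map (m n : ℕ) (x) : quadInv m n (quadMap m n x) = x := by
  obtain ⟨i, x⟩ := x
  fin_cases i
  · change Fin 1 at x
    rw [Subsingleton.elim x 0]; rfl
  · change Fin 1 at x
    rw [Subsingleton.elim x 0]; rfl
  · rfl
  · rfl

theorem quadMap_inv (m n : ℕ) (x) : quadMap m n (quadInv m n x) = x := by
  rcases x with (_ | _) | (a | b) <;> rfl

theorem quadMap_cls (m n : ℕ) (x) : cls (quadMap m n x) = x.1 := by
  obtain ⟨i, x⟩ := x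
  fin_cases i <;> rfl

theorem quad_eq (m n : ℕ) : crossingNumber (quadK 1 1 m n) = crossingNumber (G4 (Fin m) (Fin n)) := by
  obtain ⟨S, -⟩ := upper_bound m n
  have hi := (Function.LeftInverse.injective (quadInv_map m n))
  have hi' := (Function.LeftInverse.injective (quadMap_inv m n))
  have hadj : ∀ a b, (quadK 1 1 m n).Adj a b → (G4 (Fin m) (Fin n)).Adj (quadMap m n a) (quadMap m n b) := by
    intro a b h
    replace h : a.1 ≠ b.1 := h
    change cls _ ≠ cls _
    rwa [quadMap_cls, quadMap_cls]
  have : Finite (Σ i : Fin 4, ![Fin 1, Fin 1, Fin m, Fin n] i) := Finite.of_injective _ hi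
  refine le_antisymm (cr_mono S _ hi hadj) ?_
  obtain ⟨S', -⟩ := S.comap_le _ hi hadj
  refine cr_mono S' _ hi' ?_
  intro a b h
  change (quadInv m n a).1 ≠ (quadInv m n b).1
  rw [← quadMap_cls, ← quadMap_cls, quadMap_inv, quadMap_inv]
  exact h

theorem swap_le (m n : ℕ) : crossingNumber (G4 (Fin m) (Fin n)) ≤ crossingNumber (G4 (Fin n) (Fin m)) := by
  obtain ⟨S, -⟩ := upper_bound n m
  refine cr_mono S (Sum.map id Sum.swap) (Function.injective_id.sumMap Sum.swap_leftInverse.injective) ?_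
  intro a b h
  change cls _ ≠ cls _
  replace h : cls a ≠ cls b := h
  rcases a with (_ | _) | (a | a) <;> rcases b with (_ | _) | (b | b) <;> simp [cls] at h ⊢

theorem tri_adj (m n : ℕ) (a b) (h : (triK 2 m n).Adj a b) :
    (G4 (Fin m) (Fin n)).Adj (triMap m n a) (triMap m n b) := by
  obtain ⟨i, x⟩ := a
  obtain ⟨j, y⟩ := b
  replace h : i ≠ j := h
  fin_cases i <;> fin_cases j <;> simp only [ne_eq, not_true_eq_false] at h
  · exact (cls_inl _).1
  · exact (cls_inl _).2
  · exact (cls_inl _).1.symm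
  · exact show (2 : Fin 4) ≠ 3 by decide
  · exact (cls_inl _).2.symm
  · exact show (3 : Fin 4) ≠ 2 by decide

/-- exchange the last two parts -/
def triSwap (m n : ℕ) : (Σ i : Fin 3, ![Fin 2, Fin m, Fin n] i) → (Σ i : Fin 3, ![Fin 2, Fin n, Fin m] i)
  | ⟨0, (i : Fin 2)⟩ => ⟨0, i⟩
  | ⟨1, (a : Fin m)⟩ => ⟨2, a⟩
  | ⟨2, (b : Fin n)⟩ => ⟨1, b⟩

theorem triSwap_swap (m n : ℕ) (x) : triSwap n m (triSwap m n x) = x := by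
  obtain ⟨i, x⟩ := x
  fin_cases i <;> rfl

theorem tri_swap_le (m n : ℕ) : crossingNumber (triK 2 m n) ≤ crossingNumber (triK 2 n m) := by
  obtain ⟨S0, -⟩ := upper_bound n m
  obtain ⟨S, -⟩ := S0.comap_le _ (triMap_inj n m) (tri_adj n m)
  have : Finite (Σ i : Fin 3, ![Fin 2, Fin n, Fin m] i) := Finite.of_injective _ (triMap_inj n m)
  refine cr_mono S (triSwap m n) (Function.LeftInverse.injective (triSwap_swap m n)) ?_
  rintro ⟨i, x⟩ ⟨j, y⟩ h
  replace h : i ≠ j := h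
  change (triSwap m n ⟨i, x⟩).1 ≠ (triSwap m n ⟨j, y⟩).1
  fin_cases i <;> fin_cases j <;> simp [triSwap] at h ⊢

theorem Z_comm (a b : ℕ) : Z a b = Z b a := by unfold Z; ring

theorem main_odd (m n : ℕ) (hn : 0 < n) (hm : Odd m)
    (hZC : ∀ a b : ℕ, 0 < a → 0 < b → crossingNumber (bipK a b) = Z a b)
    (hHC : crossingNumber (triK 2 m n) = Z (m + 2) (n + 2) - m * n) :
    crossingNumber (G4 (Fin m) (Fin n)) = Z (m + 2) (n + 2) - m * n + (m / 2) * (n / 2) := by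
  obtain ⟨a, ha⟩ := hm
  obtain ⟨S, hS⟩ := upper_bound m n
  obtain ⟨D, hD⟩ := crossingNumber_attained S
  have h1 := crossingNumber_le S
  have h2 := lower_bound m n a ha hn hZC hHC D _ hD
  omega

end Final

theorem statement9 (m n : ℕ) (hm : 0 < m) (hn : 0 < n)
    (hodd : Odd m ∨ Odd n)
    (hZC : ∀ a b : ℕ, 0 < a → 0 < b → crossingNumber (bipK a b) = Z a b)
    (hHC : (crossingNumber (triK 2 m n) : ℤ) = (Z (m + 2) (n + 2) : ℤ) - (m : ℤ) * n) :
    (crossingNumber (quadK 1 1 m n) : ℤ) =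
      (Z (m + 2) (n + 2) : ℤ) - (m : ℤ) * n + ((m / 2 : ℕ) : ℤ) * ((n / 2 : ℕ) : ℤ) := by
  have hle : m * n ≤ Z (m + 2) (n + 2) := by
    zify
    have : (0 : ℤ) ≤ (crossingNumber (triK 2 m n) : ℤ) := Int.natCast_nonneg _
    linarith
  have hH : crossingNumber (triK 2 m n) = Z (m + 2) (n + 2) - m * n := by
    zify [hle]
    exact hHC
  have key : crossingNumber (quadK 1 1 m n) = Z (m + 2) (n + 2) - m * n + (m / 2) * (n / 2) := by
    rw [quad_eq]
    rcases hodd with h | h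
    · exact main_odd m n hn h hZC hH
    · rw [le_antisymm (swap_le m n) (swap_le n m), Z_comm, Nat.mul_comm m n,
        Nat.mul_comm (m / 2)]
      refine main_odd n m hm h hZC ?_
      rw [le_antisymm (tri_swap_le n m) (tri_swap_le m n), hH, Z_comm, Nat.mul_comm m n]
  rw [key, Nat.cast_add, Nat.cast_sub hle, Nat.cast_mul, Nat.cast_mul]
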